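/- Let A be a system of p arcs in minimal position in a closed disk, let n be the number of intersection points between the arcs of A, and let d be the largest distance from a face of A to the boundary of the disk, where the distance from a face to the boundary is the minimal number of crossings with arcs of A of a path from the face to the boundary. Then n ≤ (6d + 7)·p. -/

import Mathlib

/-!
Statement 11: a system of `p` arcs in minimal position in a closed disk, all of whose
faces are at crossing-distance at most `d` from the boundary, has at most `(6d + 7)·p`
intersection points.
-/

noncomputable section

open Set Topology

/-- The Euclidean plane. -/
abbrev Plane := EuclideanSpace ℝ (Fin 2)

/-- A family of `p` arcs in the closed unit disk: each arc is an injective continuous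
map of `[0,1]` into the disk, with endpoints on the boundary circle and interior in the
open disk. -/
structure ArcFamily : Type where
  p : ℕ
  arcs : Fin p → C(unitInterval, Plane)
  arc_inj : ∀ i, Function.Injective (arcs i)
  mem_disk : ∀ i t, ‖arcs i t‖ ≤ 1
  endpoint₀ : ∀ i, ‖arcs i 0‖ = 1
  endpoint₁ : ∀ i, ‖arcs i 1‖ = 1
  interior_lt : ∀ i (t : unitInterval), t ≠ 0 → t ≠ 1 → ‖arcs i t‖ < 1

namespace ArcFamily

/-- The union of the images of the arcs. -/
def image (A : ArcFamily) : Set Plane := ⋃ i, Set.range (A.arcs i)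

/-- The parameters at which the family passes through a point. -/
def params (A : ArcFamily) (x : Plane) : Set (Fin A.p × unitInterval) :=
  {q | A.arcs q.1 q.2 = x}

/-- The intersection points between arcs of the family: points traversed at least
twice. -/
def crossings (A : ArcFamily) : Set Plane := {x | 2 ≤ Nat.card (A.params x)}

/-- The number of intersection points between the arcs of the family. -/
def crossingNumber (A : ArcFamily) : ℕ := A.crossings.ncard

/-- General position: finitely many crossings, at most two strands through any point,
and all endpoints distinct. -/
def InGeneralPosition (A : ArcFamily) : Prop :=
  A.crossings.Finite ∧ (∀ x : Plane, (A.params x).Finite) ∧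
  (∀ x : Plane, Nat.card (A.params x) ≤ 2) ∧
  ∀ i j : Fin A.p, ∀ a b : unitInterval, (a = 0 ∨ a = 1) → (b = 0 ∨ b = 1) →
    A.arcs i a = A.arcs j b → i = j ∧ a = b

/-- Minimal position: the number of crossings is minimal among all families of arcs in
general position with the same endpoints (homotopy with endpoints fixed in the disk). -/
def MinimalPosition (A : ArcFamily) : Prop :=
  ∀ B : ArcFamily, B.InGeneralPosition → ∀ hp : B.p = A.p,
    (∀ i : Fin B.p, B.arcs i 0 = A.arcs (Fin.cast hp i) 0 ∧
      B.arcs i 1 = A.arcs (Fin.cast hp i) 1) →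
    A.crossingNumber ≤ B.crossingNumber

/-- A face of the arc family: a connected component of the complement of the arcs in
the disk. -/
def IsFaceOf (A : ArcFamily) (F : Set Plane) : Prop :=
  ∃ x ∈ Metric.closedBall (0 : Plane) 1 \ A.image,
    F = connectedComponentIn (Metric.closedBall (0 : Plane) 1 \ A.image) x

/-- The distance from a face to the boundary of the disk: the minimal number of
crossings with the arcs of a path in the disk from the face to the boundary circle. -/
def faceDist (A : ArcFamily) (F : Set Plane) : ℕ :=
  sInf {m : ℕ | ∃ γ : C(unitInterval, Plane), (∀ t, ‖γ t‖ ≤ 1) ∧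
    γ 0 ∈ F ∧ ‖γ 1‖ = 1 ∧
    {t : unitInterval | γ t ∈ A.image}.Finite ∧
    m = Nat.card {t : unitInterval | γ t ∈ A.image}}

/-- The largest distance from a face of the family to the boundary of the disk. -/
def maxFaceDist (A : ArcFamily) : ℕ :=
  sSup {m : ℕ | ∃ F : Set Plane, A.IsFaceOf F ∧ m = A.faceDist F}

end ArcFamily

/-! ### Continuous logarithms -/

theorem exists_continuous_log {X : Type*} [TopologicalSpace X] [SimplyConnectedSpace X]
    [LocallyPathConnectedSpace X] {f : X → ℂ} (hf : Continuous f) (h0 : ∀ x, f x ≠ 0) :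
    ∃ L : X → ℂ, Continuous L ∧ ∀ x, Complex.exp (L x) = f x := by
  obtain ⟨x₀⟩ : Nonempty X := inferInstance
  obtain ⟨F, ⟨-, hF⟩, -⟩ := Complex.isCoveringMapOn_exp.existsUnique_continuousMap_lifts
    ⟨f, hf⟩ (Complex.exp_log (h0 x₀)) h0
  exact ⟨F, F.continuous, fun x => congrFun hF x⟩

theorem log_sub_log_const {X : Type*} [TopologicalSpace X] {s : Set X} (hs : IsPreconnected s)
    {L M : X → ℂ} (hL : ContinuousOn L s) (hM : ContinuousOn M s)
    (h : ∀ x ∈ s, Complex.exp (L x) = Complex.exp (M x)) {x y : X} (hx : x ∈ s) (hy : y ∈ s) :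
    L x - M x = L y - M y := by
  have : DiscreteTopology (AddSubgroup.zmultiples (2 * Real.pi * Complex.I) : Set ℂ) :=
    NormedSpace.discreteTopology_zmultiples _
  refine hs.constant_of_mapsTo (T := (AddSubgroup.zmultiples (2 * Real.pi * Complex.I) : Set ℂ))
    ⟨this⟩ (hL.sub hM) (fun z hz => ?_) hx hy
  obtain ⟨n, hn⟩ := Complex.exp_eq_exp_iff_exists_int.1 (h z hz)
  exact AddSubgroup.mem_zmultiples_iff.2 ⟨n, by rw [Pi.sub_apply, hn]; simp⟩

/-- The variation of a logarithm along a connected set on which the function stays in a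
slit plane. -/
theorem log_variation {X : Type*} [TopologicalSpace X] {s : Set X} (hs : IsPreconnected s)
    {L : X → ℂ} (hL : ContinuousOn L s) {c : ℂ}
    (h : ∀ x ∈ s, Complex.exp (L x) * c ∈ Complex.slitPlane) {x y : X} (hx : x ∈ s) (hy : y ∈ s) :
    L x - L y = Complex.log (Complex.exp (L x) * c) - Complex.log (Complex.exp (L y) * c) := by
  have hc : c ≠ 0 := by
    rintro rfl
    simpa using h x hx
  have key := log_sub_log_const (L := fun z => L z + Complex.log c)
    (M := fun z => Complex.log (Complex.exp (L z) * c)) hs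
    (hL.add continuousOn_const)
    (ContinuousOn.clog ((Complex.continuous_exp.comp_continuousOn hL).mul continuousOn_const) h)
    (fun z hz => by
      rw [Complex.exp_add, Complex.exp_log hc,
        Complex.exp_log (Complex.slitPlane_ne_zero (h z hz))]) hx hy
  linear_combination key

theorem arg_pos_mul_exp {r θ : ℝ} (hr : 0 < r) (h1 : -Real.pi < θ) (h2 : θ ≤ Real.pi) :
    (r * Complex.exp (θ * Complex.I)).arg = θ := by
  rw [Complex.exp_mul_I]
  exact Complex.arg_mul_cos_add_sin_mul_I hr ⟨h1, h2⟩

/-! ### The radial retraction onto the disk -/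

/-- The radial retraction of the plane onto the closed unit disk. -/
def discRetract (w : ℂ) : ℂ := ((max 1 ‖w‖)⁻¹ : ℝ) * w

theorem continuous_discRetract : Continuous discRetract := by
  unfold discRetract
  refine (Complex.continuous_ofReal.comp (Continuous.inv₀ (by fun_prop) fun w => ?_)).mul
    continuous_id
  have := le_max_left 1 ‖w‖
  positivity

theorem norm_discRetract_le (w : ℂ) : ‖discRetract w‖ ≤ 1 := by
  have h1 : (0 : ℝ) < max 1 ‖w‖ := lt_of_lt_of_le one_pos (le_max_left _ _)
  rw [discRetract, norm_mul, Complex.norm_real, Real.norm_of_nonneg (by positivity),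
    inv_mul_le_iff₀ h1, mul_one]
  exact le_max_right _ _

theorem discRetract_eq {w : ℂ} (hw : ‖w‖ ≤ 1) : discRetract w = w := by
  simp [discRetract, max_eq_left hw]

/-! ### Covering the disk by three closed sets -/

theorem kkm_disc {A₀ A₁ A₂ : Set ℂ} (h₀ : IsClosed A₀) (h₁ : IsClosed A₁) (h₂ : IsClosed A₂)
    (hcov : ∀ w : ℂ, ‖w‖ ≤ 1 → w ∈ A₀ ∨ w ∈ A₁ ∨ w ∈ A₂) {θ₁ θ₂ θ₃ : ℝ}
    (h12 : θ₁ ≤ θ₂) (h23 : θ₂ ≤ θ₃) (h31 : θ₃ ≤ θ₁ + 2 * Real.pi)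
    (ha₀ : ∀ θ ∈ Icc θ₁ θ₂, Complex.exp (θ * Complex.I) ∈ A₀)
    (ha₁ : ∀ θ ∈ Icc θ₂ θ₃, Complex.exp (θ * Complex.I) ∈ A₁)
    (ha₂ : ∀ θ ∈ Icc θ₃ (θ₁ + 2 * Real.pi), Complex.exp (θ * Complex.I) ∈ A₂) :
    ∃ w : ℂ, ‖w‖ ≤ 1 ∧ w ∈ A₀ ∧ w ∈ A₁ ∧ w ∈ A₂ := by
  by_contra! hne
  set d₀ : ℂ → ℝ := fun w => Metric.infDist w A₀ with hd₀
  set d₁ : ℂ → ℝ := fun w => Metric.infDist w A₁ with hd₁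
  set d₂ : ℂ → ℝ := fun w => Metric.infDist w A₂ with hd₂
  have n₀ : A₀.Nonempty := ⟨_, ha₀ θ₁ ⟨le_rfl, h12⟩⟩
  have n₁ : A₁.Nonempty := ⟨_, ha₁ θ₂ ⟨le_rfl, h23⟩⟩
  have n₂ : A₂.Nonempty := ⟨_, ha₂ θ₃ ⟨le_rfl, h31⟩⟩
  have z₀ : ∀ w, d₀ w = 0 ↔ w ∈ A₀ := fun w => (h₀.mem_iff_infDist_zero n₀).symm
  have z₁ : ∀ w, d₁ w = 0 ↔ w ∈ A₁ := fun w => (h₁.mem_iff_infDist_zero n₁).symm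
  have z₂ : ∀ w, d₂ w = 0 ↔ w ∈ A₂ := fun w => (h₂.mem_iff_infDist_zero n₂).symm
  have p₀ : ∀ w, 0 ≤ d₀ w := fun w => Metric.infDist_nonneg
  have p₁ : ∀ w, 0 ≤ d₁ w := fun w => Metric.infDist_nonneg
  have p₂ : ∀ w, 0 ≤ d₂ w := fun w => Metric.infDist_nonneg
  set ζ : ℂ := Complex.exp ((Real.pi / 3 : ℝ) * Complex.I) with hζ
  set ξ : ℂ := Complex.exp ((-(Real.pi / 3) : ℝ) * Complex.I) with hξ
  have hζv : ζ = 1 / 2 + (Real.sqrt 3 / 2 : ℝ) * Complex.I := by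
    rw [hζ, Complex.exp_mul_I, ← Complex.ofReal_cos, ← Complex.ofReal_sin, Real.cos_pi_div_three,
      Real.sin_pi_div_three]
    push_cast; ring
  have hξv : ξ = 1 / 2 - (Real.sqrt 3 / 2 : ℝ) * Complex.I := by
    rw [hξ, Complex.exp_mul_I, ← Complex.ofReal_cos, ← Complex.ofReal_sin, Real.cos_neg,
      Real.sin_neg, Real.cos_pi_div_three, Real.sin_pi_div_three]
    push_cast; ring
  have hs3 : ((Real.sqrt 3 : ℝ) : ℂ) ^ 2 = 3 := by
    rw [← Complex.ofReal_pow, Real.sq_sqrt (by norm_num)]; norm_num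
  have hζξ : ζ * ξ = 1 := by
    rw [hζv, hξv]; push_cast
    linear_combination (1 / 4 : ℂ) * hs3 - (Real.sqrt 3 / 2 : ℂ) ^ 2 * Complex.I_sq
  have hζ2 : ζ * ζ = - ξ := by
    rw [hζv, hξv]; push_cast
    linear_combination (-1 / 4 : ℂ) * hs3 + (Real.sqrt 3 / 2 : ℂ) ^ 2 * Complex.I_sq
  have hξ2 : ξ * ξ = - ζ := by
    rw [hζv, hξv]; push_cast
    linear_combination (-1 / 4 : ℂ) * hs3 + (Real.sqrt 3 / 2 : ℂ) ^ 2 * Complex.I_sq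
  set Φ : ℂ → ℂ := fun w => d₀ w - d₁ w * ξ - d₂ w * ζ with hΦ
  have hΦc : Continuous Φ := by
    have := Metric.continuous_infDist_pt A₀
    have := Metric.continuous_infDist_pt A₁
    have := Metric.continuous_infDist_pt A₂
    fun_prop
  have hΦ0 : ∀ w, ‖w‖ ≤ 1 → Φ w ≠ 0 := by
    intro w hw h
    have hre := congrArg Complex.re h
    have him := congrArg Complex.im h
    simp [hΦ, hζv, hξv] at hre him
    have h3 : (0 : ℝ) < Real.sqrt 3 := by positivity
    have e1 : d₁ w = d₂ w := by
      have : (d₁ w - d₂ w) * Real.sqrt 3 = 0 := by linear_combination 2 * him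
      rcases mul_eq_zero.1 this with h' | h'
      · linarith
      · exact absurd h' h3.ne'
    have e0 : d₀ w = d₁ w := by norm_num at hre; linarith
    have : d₀ w = 0 := by
      rcases hcov w hw with h' | h' | h'
      · exact (z₀ w).2 h'
      · rw [e0]; exact (z₁ w).2 h'
      · rw [e0, e1]; exact (z₂ w).2 h'
    exact hne w hw ((z₀ w).1 this) ((z₁ w).1 (e0 ▸ this)) ((z₂ w).1 (e1 ▸ e0 ▸ this))
  obtain ⟨L, hLc, hL⟩ := exists_continuous_log (f := fun w => Φ (discRetract w))
    (hΦc.comp continuous_discRetract) (fun w => hΦ0 _ (norm_discRetract_le w))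
  set E : ℝ → ℂ := fun θ => Complex.exp (θ * Complex.I) with hE
  have hE1 : ∀ θ, ‖E θ‖ = 1 := fun θ => Complex.norm_exp_ofReal_mul_I θ
  set M : ℝ → ℂ := fun θ => L (E θ) with hM
  have hMc : Continuous M := hLc.comp (by fun_prop)
  have hMe : ∀ θ, Complex.exp (M θ) = Φ (E θ) := fun θ => by
    rw [hM, hL, discRetract_eq (hE1 θ).le]
  have hper : M (θ₁ + 2 * Real.pi) = M θ₁ := by
    simp only [hM, hE]
    congr 1
    push_cast
    rw [add_mul, Complex.exp_add, Complex.exp_two_pi_mul_I, mul_one]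
  have hE1' : E (θ₁ + 2 * Real.pi) = E θ₁ := by
    simp only [hE]
    push_cast
    rw [add_mul, Complex.exp_add, Complex.exp_two_pi_mul_I, mul_one]
  have hπ := Real.pi_pos
  have slit : ∀ a b : ℝ, 0 ≤ a → 0 ≤ b → (a * ζ + b * ξ : ℂ) ≠ 0 →
      (a * ζ + b * ξ : ℂ) ∈ Complex.slitPlane := by
    intro a b ha hb hab
    left
    have : (a * ζ + b * ξ : ℂ).re = (a + b) / 2 := by simp [hζv, hξv]; ring
    rw [this]
    rcases ha.lt_or_eq with h | h
    · linarith
    rcases hb.lt_or_eq with h' | h'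
    · linarith
    · exact absurd (by simp [← h, ← h']) hab
  -- one side: on which the values are `a ζ + b ξ`, beginning on the ray of `ξ` and ending on
  -- the ray of `ζ`
  have side : ∀ (α β : ℝ) (c : ℂ) (a b : ℝ → ℝ), α ≤ β → c ≠ 0 →
      (∀ θ ∈ Icc α β, 0 ≤ a θ ∧ 0 ≤ b θ ∧ Φ (E θ) * c = a θ * ζ + b θ * ξ) →
      a α = 0 → b β = 0 → (M β - M α).im = 2 * Real.pi / 3 := by
    intro α β c a b hαβ hc hab ha hb
    have hne' : ∀ θ ∈ Icc α β, (a θ * ζ + b θ * ξ : ℂ) ≠ 0 := fun θ hθ => by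
      rw [← (hab θ hθ).2.2]
      exact mul_ne_zero (hΦ0 _ (hE1 θ).le) hc
    have := log_variation (isPreconnected_Icc (a := α) (b := β)) hMc.continuousOn (c := c)
      (fun θ hθ => by
        rw [hMe, (hab θ hθ).2.2]
        exact slit _ _ (hab θ hθ).1 (hab θ hθ).2.1 (hne' θ hθ)) (right_mem_Icc.2 hαβ)
        (left_mem_Icc.2 hαβ)
    rw [this, hMe, hMe, (hab _ (right_mem_Icc.2 hαβ)).2.2, (hab _ (left_mem_Icc.2 hαβ)).2.2, ha, hb]
    have na := hne' _ (right_mem_Icc.2 hαβ)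
    have nb := hne' _ (left_mem_Icc.2 hαβ)
    rw [hb] at na
    rw [ha] at nb
    have pa : 0 < a β := lt_of_le_of_ne (hab _ (right_mem_Icc.2 hαβ)).1
      (fun h => na (by simp [← h]))
    have pb : 0 < b α := lt_of_le_of_ne (hab _ (left_mem_Icc.2 hαβ)).2.1
      (fun h => nb (by simp [← h]))
    simp only [Complex.ofReal_zero, zero_mul, add_zero, zero_add, Complex.sub_im, Complex.log_im]
    rw [hζ, hξ, arg_pos_mul_exp pa (by linarith) (by linarith),
      arg_pos_mul_exp pb (by linarith) (by linarith)]
    ring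
  have hζ0 : ζ ≠ 0 := Complex.exp_ne_zero _
  have hξ0 : ξ ≠ 0 := Complex.exp_ne_zero _
  have s0 := side θ₁ θ₂ (-1) (fun θ => d₂ (E θ)) (fun θ => d₁ (E θ)) h12 (by norm_num)
    (fun θ hθ => ⟨p₂ _, p₁ _, by
      simp only [hΦ]
      rw [(z₀ (E θ)).2 (ha₀ θ hθ)]; push_cast; ring⟩)
    ((z₂ _).2 (by rw [← hE1']; exact ha₂ _ ⟨h31, le_rfl⟩))
    ((z₁ _).2 (ha₁ _ ⟨le_rfl, h23⟩))
  have s1 := side θ₂ θ₃ ζ (fun θ => d₀ (E θ)) (fun θ => d₂ (E θ)) h23 hζ0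
    (fun θ hθ => ⟨p₀ _, p₂ _, by
      simp only [hΦ]
      rw [(z₁ (E θ)).2 (ha₁ θ hθ)]; push_cast
      linear_combination (-(d₂ (E θ)) : ℂ) * hζ2⟩)
    ((z₀ _).2 (ha₀ _ ⟨h12, le_rfl⟩))
    ((z₂ _).2 (ha₂ _ ⟨le_rfl, h31⟩))
  have s2 := side θ₃ (θ₁ + 2 * Real.pi) ξ (fun θ => d₁ (E θ)) (fun θ => d₀ (E θ)) h31 hξ0
    (fun θ hθ => ⟨p₁ _, p₀ _, by
      simp only [hΦ]
      rw [(z₂ (E θ)).2 (ha₂ θ hθ)]; push_cast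
      linear_combination (-(d₁ (E θ)) : ℂ) * hξ2⟩)
    ((z₁ _).2 (ha₁ _ ⟨h23, le_rfl⟩))
    ((z₀ _).2 (by rw [hE1']; exact ha₀ _ ⟨le_rfl, h12⟩))
  rw [hper] at s2
  simp only [Complex.sub_im] at s0 s1 s2
  linarith

/-! ### Paths with interlaced endpoints intersect -/

theorem arg_one_sub_exp {φ : ℝ} (h : φ ≠ 0) (h2 : |φ| < 2 * Real.pi) :
    (1 - Complex.exp (-φ * Complex.I)).arg = (if 0 < φ then 1 else -1) * (Real.pi / 2) - φ / 2 := by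
  have hπ := Real.pi_pos
  rw [abs_lt] at h2
  have e : 1 - Complex.exp (-φ * Complex.I) =
      (2 * Real.sin (φ / 2) : ℝ) * Complex.exp ((Real.pi / 2 - φ / 2 : ℝ) * Complex.I) := by
    have h1 : (1 : ℂ) =
        Complex.exp ((φ / 2 : ℂ) * Complex.I) * Complex.exp (-(φ / 2 : ℂ) * Complex.I) := by
      rw [← Complex.exp_add]; simp
    have h2 : Complex.exp (-φ * Complex.I) = Complex.exp (-(φ / 2 : ℂ) * Complex.I) *
        Complex.exp (-(φ / 2 : ℂ) * Complex.I) := by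
      rw [← Complex.exp_add]; congr 1; ring
    have h3 : Complex.exp ((Real.pi / 2 - φ / 2 : ℝ) * Complex.I) = Complex.I *
        Complex.exp (-(φ / 2 : ℂ) * Complex.I) := by
      have : ((Real.pi / 2 - φ / 2 : ℝ) * Complex.I : ℂ) =
          (Real.pi / 2 : ℂ) * Complex.I + -(φ / 2 : ℂ) * Complex.I := by push_cast; ring
      rw [this, Complex.exp_add, Complex.exp_pi_div_two_mul_I]
    rw [h3, h2]
    nth_rewrite 1 [h1]
    push_cast
    rw [Complex.sin]
    rw [show (-(φ / 2 : ℂ) * Complex.I) = -(φ / 2 * Complex.I) by ring]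
    linear_combination (-Complex.exp (-(φ / 2 * Complex.I)) *
      (Complex.exp (-(φ / 2 * Complex.I)) - Complex.exp (φ / 2 * Complex.I))) * Complex.I_sq
  rw [e]
  rcases lt_or_gt_of_ne h with h | h
  · have hs : Real.sin (φ / 2) < 0 := Real.sin_neg_of_neg_of_neg_pi_lt (by linarith) (by linarith)
    have : ((2 * Real.sin (φ / 2) : ℝ) : ℂ) * Complex.exp ((Real.pi / 2 - φ / 2 : ℝ) * Complex.I)
      = ((-(2 * Real.sin (φ / 2)) : ℝ) : ℂ) *
        Complex.exp ((-(Real.pi / 2) - φ / 2 : ℝ) * Complex.I) := by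
      have : ((Real.pi / 2 - φ / 2 : ℝ) * Complex.I) = (-(Real.pi / 2) - φ / 2 : ℝ) * Complex.I
        + Real.pi * Complex.I := by push_cast; ring
      rw [this, Complex.exp_add, Complex.exp_pi_mul_I]; push_cast; ring
    rw [this, arg_pos_mul_exp (by linarith) (by linarith) (by linarith), if_neg (by linarith)]
    ring
  · have hs : 0 < Real.sin (φ / 2) := Real.sin_pos_of_pos_of_lt_pi (by linarith) (by linarith)
    rw [arg_pos_mul_exp (by linarith) (by linarith) (by linarith), if_pos h]
    ring

theorem sub_mul_conj_mem_slitPlane {x w : ℂ} (hx : ‖x‖ = 1) (hw : ‖w‖ ≤ 1) (h : w ≠ x) :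
    (x - w) * (starRingEnd ℂ) x ∈ Complex.slitPlane := by
  left
  have hx2 : x.re * x.re + x.im * x.im = 1 := by
    have := Complex.normSq_eq_norm_sq x
    rw [hx, Complex.normSq_apply] at this; linarith
  have hw2 : w.re * w.re + w.im * w.im ≤ 1 := by
    have := Complex.normSq_eq_norm_sq w
    rw [Complex.normSq_apply] at this
    nlinarith [norm_nonneg w]
  have hd : 0 < (x.re - w.re) ^ 2 + (x.im - w.im) ^ 2 := by
    by_contra hcon
    apply h
    apply Complex.ext
    · nlinarith [sq_nonneg (x.re - w.re), sq_nonneg (x.im - w.im)]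
    · nlinarith [sq_nonneg (x.re - w.re), sq_nonneg (x.im - w.im)]
  simp
  nlinarith

theorem paths_intersect {γ₁ γ₂ : ℝ → ℂ} (h₁ : Continuous γ₁) (h₂ : Continuous γ₂)
    (n₁ : ∀ t, ‖γ₁ t‖ ≤ 1) (n₂ : ∀ t, ‖γ₂ t‖ ≤ 1) {a b c e : ℝ}
    (ha : γ₁ 0 = Complex.exp (a * Complex.I)) (hb : γ₁ 1 = Complex.exp (b * Complex.I))
    (hc : γ₂ 0 = Complex.exp (c * Complex.I)) (he : γ₂ 1 = Complex.exp (e * Complex.I))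
    (hac : a < c) (hcb : c < b)
    (hout : e < a ∧ b < e + 2 * Real.pi ∨ b < e ∧ e < a + 2 * Real.pi) :
    ∃ s t, γ₁ s = γ₂ t := by
  by_contra! hne
  obtain ⟨L, hLc, hL⟩ := exists_continuous_log (X := ℝ × ℝ) (f := fun q => γ₁ q.1 - γ₂ q.2)
    (by fun_prop) (fun q => sub_ne_zero.2 (hne _ _))
  have hE1 : ∀ θ : ℝ, ‖Complex.exp (θ * Complex.I)‖ = 1 := fun θ => Complex.norm_exp_ofReal_mul_I θ
  have hconj : ∀ θ : ℝ, (starRingEnd ℂ) (Complex.exp (θ * Complex.I)) =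
      Complex.exp (-(θ * Complex.I)) := fun θ => by
    rw [← Complex.exp_conj]; simp
  have harg : ∀ x y : ℝ, x ≠ y → |x - y| < 2 * Real.pi →
      (((Complex.exp (x * Complex.I) - Complex.exp (y * Complex.I)) *
        (starRingEnd ℂ) (Complex.exp (x * Complex.I)))).arg =
        (if y < x then 1 else -1) * (Real.pi / 2) - (x - y) / 2 := by
    intro x y hxy h
    have : (Complex.exp (x * Complex.I) - Complex.exp (y * Complex.I)) *
        (starRingEnd ℂ) (Complex.exp (x * Complex.I)) =
        1 - Complex.exp (-(x - y : ℝ) * Complex.I) := by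
      rw [hconj, sub_mul, ← Complex.exp_add, ← Complex.exp_add]
      congr 1
      · simp
      · congr 1; push_cast; ring
    rw [this, arg_one_sub_exp (sub_ne_zero.2 hxy) h]
    simp only [sub_pos]
  have edge₁ : ∀ (s x y y' : ℝ), γ₁ s = Complex.exp (x * Complex.I) →
      γ₂ 0 = Complex.exp (y * Complex.I) → γ₂ 1 = Complex.exp (y' * Complex.I) →
      x ≠ y → |x - y| < 2 * Real.pi → x ≠ y' → |x - y'| < 2 * Real.pi →
      (L (s, 1) - L (s, 0)).im = ((if y' < x then 1 else -1) * (Real.pi / 2) - (x - y') / 2) -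
        ((if y < x then 1 else -1) * (Real.pi / 2) - (x - y) / 2) := by
    intro s x y y' hs h0 h1 k1 k2 k3 k4
    have := log_variation (s := univ) isPreconnected_univ (L := fun t => L (s, t))
      (c := (starRingEnd ℂ) (γ₁ s)) (by fun_prop)
      (fun t _ => by
        rw [hL]
        exact sub_mul_conj_mem_slitPlane (by rw [hs]; exact hE1 _) (n₂ t) (hne s t).symm)
      (mem_univ (1 : ℝ)) (mem_univ 0)
    rw [this, hL, hL]
    simp only [Complex.sub_im, Complex.log_im]
    rw [h0, h1, hs, harg x y' k3 k4, harg x y k1 k2]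
  have edge₂ : ∀ (t x y y' : ℝ), γ₂ t = Complex.exp (x * Complex.I) →
      γ₁ 0 = Complex.exp (y * Complex.I) → γ₁ 1 = Complex.exp (y' * Complex.I) →
      x ≠ y → |x - y| < 2 * Real.pi → x ≠ y' → |x - y'| < 2 * Real.pi →
      (L (1, t) - L (0, t)).im = ((if y' < x then 1 else -1) * (Real.pi / 2) - (x - y') / 2) -
        ((if y < x then 1 else -1) * (Real.pi / 2) - (x - y) / 2) := by
    intro t x y y' ht h0 h1 k1 k2 k3 k4
    have := log_variation (s := univ) isPreconnected_univ (L := fun s => L (s, t))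
      (c := - (starRingEnd ℂ) (γ₂ t)) (by fun_prop)
      (fun s _ => by
        rw [hL]
        have := sub_mul_conj_mem_slitPlane (x := γ₂ t) (by rw [ht]; exact hE1 _) (n₁ s) (hne s t)
        convert this using 1
        simp only
        ring)
      (mem_univ (1 : ℝ)) (mem_univ 0)
    rw [this, hL, hL]
    simp only [Complex.sub_im, Complex.log_im]
    have r : ∀ u v k : ℂ, (u - v) * -k = (v - u) * k := fun u v k => by ring
    rw [r, r, h0, h1, ht, harg x y' k3 k4, harg x y k1 k2]
  have hπ := Real.pi_pos
  rcases hout with ⟨h1, h2⟩ | ⟨h1, h2⟩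
  · have i1 := edge₁ 0 a c e ha hc he (by linarith) (by rw [abs_lt]; constructor <;> linarith)
      (by linarith) (by rw [abs_lt]; constructor <;> linarith)
    have i2 := edge₂ 1 e a b he ha hb (by linarith) (by rw [abs_lt]; constructor <;> linarith)
      (by linarith) (by rw [abs_lt]; constructor <;> linarith)
    have i3 := edge₁ 1 b c e hb hc he (by linarith) (by rw [abs_lt]; constructor <;> linarith)
      (by linarith) (by rw [abs_lt]; constructor <;> linarith)
    have i4 := edge₂ 0 c a b hc ha hb (by linarith) (by rw [abs_lt]; constructor <;> linarith)
      (by linarith) (by rw [abs_lt]; constructor <;> linarith)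
    simp only [Complex.sub_im] at i1 i2 i3 i4
    repeat rw [if_pos (by linarith)] at i1
    repeat rw [if_neg (by linarith)] at i1
    repeat rw [if_neg (by linarith)] at i2
    repeat rw [if_pos (by linarith)] at i3
    rw [if_neg (by linarith), if_pos (by linarith)] at i4
    linarith
  · have i1 := edge₁ 0 a c e ha hc he (by linarith) (by rw [abs_lt]; constructor <;> linarith)
      (by linarith) (by rw [abs_lt]; constructor <;> linarith)
    have i2 := edge₂ 1 e a b he ha hb (by linarith) (by rw [abs_lt]; constructor <;> linarith)
      (by linarith) (by rw [abs_lt]; constructor <;> linarith)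
    have i3 := edge₁ 1 b c e hb hc he (by linarith) (by rw [abs_lt]; constructor <;> linarith)
      (by linarith) (by rw [abs_lt]; constructor <;> linarith)
    have i4 := edge₂ 0 c a b hc ha hb (by linarith) (by rw [abs_lt]; constructor <;> linarith)
      (by linarith) (by rw [abs_lt]; constructor <;> linarith)
    simp only [Complex.sub_im] at i1 i2 i3 i4
    repeat rw [if_neg (by linarith)] at i1
    repeat rw [if_pos (by linarith)] at i2
    rw [if_neg (by linarith), if_pos (by linarith)] at i3
    rw [if_neg (by linarith), if_pos (by linarith)] at i4
    linarith

/-! ### The Borsuk criterion and the local structure of the complement of arcs -/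

theorem borsuk_criterion {K C : Set ℂ} (hK : IsCompact K) (hC : IsOpen C) (hfr : frontier C ⊆ K)
    (hb : Bornology.IsBounded C) {x : ℂ} (hx : x ∈ C) {n : ℤ} (hn : n ≠ 0) {R : ℂ → ℂ}
    (hR : ContinuousOn R (closure C)) (hR0 : ∀ w ∈ closure C, R w ≠ 0) {G : ℂ → ℂ}
    (hG : ContinuousOn G K) (hGe : ∀ w ∈ K, Complex.exp (G w) = (w - x) ^ n * R w) : False := by
  classical
  obtain ⟨g, hg⟩ := ContinuousMap.exists_restrict_eq hK.isClosed
    (⟨K.domRestrict G, continuousOn_iff_continuous_domRestrict.mp hG⟩ : C(K, ℂ))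
  have hgG : ∀ w ∈ K, g w = G w := fun w hw => congrArg (fun f : C(K, ℂ) => f ⟨w, hw⟩) hg
  set E : ℂ → ℂ := C.piecewise (fun w => Complex.exp (g w) / R w) (fun w => (w - x) ^ n) with hE
  have hEc : Continuous E := by
    rw [← continuousOn_univ]
    refine ContinuousOn.piecewise ?_ ?_ ?_
    · rintro w ⟨-, hw⟩
      rw [hgG w (hfr hw), hGe w (hfr hw), mul_div_assoc, div_self (hR0 w hw.1), mul_one]
    · rw [univ_inter]
      exact ContinuousOn.div (Complex.continuous_exp.comp g.continuous).continuousOn hR hR0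
    · rw [univ_inter, hC.isClosed_compl.closure_eq]
      refine ContinuousOn.zpow₀ (by fun_prop) n fun w hw => Or.inl ?_
      rw [sub_ne_zero]
      rintro rfl
      exact hw hx
  have hE0 : ∀ w, E w ≠ 0 := by
    intro w
    by_cases hw : w ∈ C
    · rw [hE, piecewise_eq_of_mem _ _ _ hw]
      exact div_ne_zero (Complex.exp_ne_zero _) (hR0 w (subset_closure hw))
    · rw [hE, piecewise_eq_of_notMem _ _ _ hw]
      refine zpow_ne_zero n (sub_ne_zero.2 ?_)
      rintro rfl
      exact hw hx
  obtain ⟨L, hLc, hL⟩ := exists_continuous_log hEc hE0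
  obtain ⟨r, hr⟩ := hb.subset_ball x
  have hr0 : 0 < r := by
    have := hr hx
    simpa using this
  set c : ℝ → ℂ := fun θ => x + r * Complex.exp (θ * Complex.I) with hc
  have hcE : ∀ θ, E (c θ) = Complex.exp (n * (Real.log r + θ * Complex.I)) := by
    intro θ
    have : c θ ∉ C := fun h => by
      have := hr h
      simp [hc, Complex.norm_exp_ofReal_mul_I, abs_of_pos hr0] at this
    rw [hE, piecewise_eq_of_notMem _ _ _ this, Complex.exp_int_mul, Complex.exp_add,
      ← Complex.ofReal_exp, Real.exp_log hr0]
    simp [hc]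
  have := log_sub_log_const (s := univ) isPreconnected_univ (L := fun θ => L (c θ))
    (M := fun θ : ℝ => (n * (Real.log r + θ * Complex.I) : ℂ)) (by fun_prop) (by fun_prop)
    (fun θ _ => by rw [hL, hcE]) (mem_univ 0) (mem_univ (2 * Real.pi))
  have hper : c (2 * Real.pi) = c 0 := by
    simp [hc]
  rw [hper] at this
  have h2 : (n : ℂ) * (2 * Real.pi * Complex.I) = 0 := by
    push_cast at this
    linear_combination this
  simp [hn, Real.pi_ne_zero] at h2

theorem exists_continuousOn_range_of_factors {X : Type*} [TopologicalSpace X] [CompactSpace X]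
    {φ ℓ : X → ℂ} (hφ : Continuous φ) (hℓ : Continuous ℓ) (h : ∀ x y, φ x = φ y → ℓ x = ℓ y) :
    ∃ g : ℂ → ℂ, ContinuousOn g (range φ) ∧ ∀ x, g (φ x) = ℓ x := by
  classical
  set f : C(X, range φ) := ⟨rangeFactorization φ, hφ.subtype_mk _⟩ with hf
  have hq : IsQuotientMap f :=
    f.continuous.isClosedMap.isQuotientMap f.continuous rangeFactorization_surjective
  have hfac : Function.FactorsThrough (⟨ℓ, hℓ⟩ : C(X, ℂ)) f := fun x y hxy =>
    h x y (congrArg Subtype.val hxy)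
  set g := hq.lift ⟨ℓ, hℓ⟩ hfac with hg
  have hgx : ∀ x, g ⟨φ x, mem_range_self x⟩ = ℓ x := fun x =>
    congrArg (fun k : C(X, ℂ) => k x) (hq.lift_comp ⟨ℓ, hℓ⟩ hfac)
  refine ⟨fun w => if hw : w ∈ range φ then g ⟨w, hw⟩ else 0, ?_, fun x => ?_⟩
  · rw [continuousOn_iff_continuous_domRestrict]
    convert g.continuous using 1
    ext w
    simp [domRestrict]
  · simp [hgx]

theorem div_mem_slitPlane {s : Set ℂ} (hs : Convex ℝ s) {x y w : ℂ} (hx : x ∈ s) (hy : y ∈ s)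
    (hw : w ∉ s) : (w - x) / (w - y) ∈ Complex.slitPlane := by
  by_contra h
  rw [Complex.mem_slitPlane_iff, not_or, not_lt, not_not] at h
  have hwy : w - y ≠ 0 := sub_ne_zero.2 (fun h => hw (h ▸ hy))
  set r := ((w - x) / (w - y)).re with hr
  have e : (w - x) / (w - y) = r := Complex.ext rfl (by simp [h.2])
  rw [div_eq_iff hwy] at e
  apply hw
  have h1 : (0 : ℝ) < 1 - r := by linarith [h.1]
  have h1' : (1 - r : ℂ) ≠ 0 := by
    have : ((1 - r : ℝ) : ℂ) ≠ 0 := by exact_mod_cast h1.ne'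
    simpa using this
  have : w = (1 / (1 - r)) • x + (-r / (1 - r)) • y := by
    simp only [Complex.real_smul]
    push_cast
    field_simp
    linear_combination e
  rw [this]
  exact hs hx hy (by positivity) (div_nonneg (by linarith [h.1]) h1.le) (by field_simp; ring)

theorem exists_int_relation {M N : ℕ} (hMN : M ≤ N) (hN : 0 < N) (c : Fin N → Fin M → ℤ) :
    ∃ n : Fin N → ℤ, n ≠ 0 ∧ ∃ t : ℤ, ∀ k, ∑ j, n j * c j k = t := by
  rcases Nat.eq_zero_or_pos M with rfl | hM
  · exact ⟨fun _ => 1, fun h => by simpa using congrFun h ⟨0, hN⟩, 0, fun k => k.elim0⟩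
  obtain ⟨v, hv0, hv, -⟩ := Int.Matrix.exists_ne_zero_int_vec_norm_le
    (α := Fin M) (β := Option (Fin N))
    (Matrix.of fun k j => j.elim (-1) (fun j => c j k)) (by simp; omega) (by simpa using hM)
  have hv' : ∀ k, ∑ j, v (some j) * c j k = v none := by
    intro k
    have := congrFun hv k
    simp [Matrix.mulVec, dotProduct, Fintype.sum_option] at this
    rw [← sub_eq_zero, ← this, sub_eq_neg_add]
    congr 1
    exact Finset.sum_congr rfl fun j _ => mul_comm _ _
  refine ⟨fun j => v (some j), fun h => hv0 ?_, v none, hv'⟩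
  have h' : ∀ j, v (some j) = 0 := fun j => congrFun h j
  funext j
  cases j with
  | none => rw [← hv' ⟨0, hM⟩]; simp [h']
  | some j => exact h' j

theorem frontier_pathComponentIn_subset {K : Set ℂ} (hK : IsClosed K) {x : ℂ} :
    frontier (pathComponentIn Kᶜ x) ⊆ K := by
  intro y hy
  by_contra hyK
  have ho := hK.isOpen_compl.pathComponentIn x
  have hoy := hK.isOpen_compl.pathComponentIn y
  obtain ⟨w, hwy, hwx⟩ := mem_closure_iff.1 hy.1 _ hoy (mem_pathComponentIn_self hyK)
  rw [ho.frontier_eq] at hy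
  exact hy.2 (JoinedIn.trans hwx (JoinedIn.symm hwy))

theorem pathComponentIn_subset_ball {K : Set ℂ} {z : ℂ} {ε : ℝ} (hS : Metric.sphere z ε ⊆ K)
    {x : ℂ} (hx : x ∈ Metric.ball z ε) (hxK : x ∉ K) :
    pathComponentIn Kᶜ x ⊆ Metric.ball z ε := by
  have hc := (isPathConnected_pathComponentIn (show x ∈ Kᶜ from hxK)).isConnected.isPreconnected
  refine hc.subset_left_of_subset_union (v := (Metric.closedBall z ε)ᶜ) Metric.isOpen_ball
    Metric.isClosed_closedBall.isOpen_compl ?_ ?_ ⟨x, mem_pathComponentIn_self hxK, hx⟩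
  · exact disjoint_compl_right_iff_subset.2 Metric.ball_subset_closedBall
  · intro y hy
    have : y ∉ Metric.sphere z ε := fun h => JoinedIn.target_mem hy (hS h)
    simp only [mem_union, Metric.mem_ball, mem_compl_iff, Metric.mem_closedBall, Metric.mem_sphere]
      at this ⊢
    rcases lt_trichotomy (dist y z) ε with h | h | h
    · exact Or.inl h
    · exact absurd h this
    · exact Or.inr (not_le.2 h)

/-- Among `N + 1` points close to the common origin `z` of `M` half-arcs, two can be joined
in the complement of the half-arcs and of a compact set meeting them only at their ends. -/
theorem exists_joinedIn_of_half_arcs {M N : ℕ} (hMN : M ≤ N) (hN : 0 < N) {z : ℂ}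
    {h : Fin M → ℝ → ℂ} (hc : ∀ k, Continuous (h k)) (h0 : ∀ k, h k 0 = z)
    (hinj : ∀ k l s t, s ∈ Icc (0 : ℝ) 1 → t ∈ Icc (0 : ℝ) 1 → h k s = h l t →
      k = l ∧ s = t ∨ s = 0 ∧ t = 0)
    {Q : Set ℂ} (hQ : IsCompact Q)
    (hQh : ∀ k, ∀ t ∈ Icc (0 : ℝ) 1, h k t ∈ Q → t = 1) {δ ε : ℝ} (hδε : δ ≤ ε)
    (hQδ : Disjoint Q (Metric.ball z δ)) (hS : Metric.sphere z ε ⊆ Q)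
    {x : Fin (N + 1) → ℂ} (hx : ∀ j, x j ∈ Metric.ball z δ)
    (hxP : ∀ j k, ∀ t ∈ Icc (0 : ℝ) 1, h k t ≠ x j) :
    ∃ i j, i ≠ j ∧ JoinedIn ((⋃ k, h k '' Icc 0 1) ∪ Q)ᶜ (x i) (x j) := by
  classical
  by_contra! hcon
  set P : Set ℂ := ⋃ k, h k '' Icc 0 1 with hP
  have hPc : IsCompact P := isCompact_iUnion fun k => isCompact_Icc.image (hc k)
  set K := P ∪ Q with hK
  have hKc : IsCompact K := hPc.union hQ
  have hxK : ∀ j, x j ∉ K := by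
    rintro j (hj | hj)
    · obtain ⟨k, t, ht, e⟩ := mem_iUnion.1 hj
      exact hxP j k t ht e
    · exact hQδ.le_bot ⟨hj, hx j⟩
  have hne : ∀ i j, i ≠ j → x i ≠ x j := fun i j hij e =>
    hcon i j hij (e ▸ JoinedIn.refl (hxK i))
  -- the logarithms on the half-arcs
  set f : Fin N → ℂ → ℂ := fun j w => (w - x j.succ) / (w - x 0) with hf
  have hf0 : ∀ j w, w ∈ K → f j w ≠ 0 := fun j w hw =>
    div_ne_zero (sub_ne_zero.2 fun e => hxK _ (e ▸ hw)) (sub_ne_zero.2 fun e => hxK _ (e ▸ hw))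
  have hfc : ∀ j, ContinuousOn (f j) K := fun j =>
    ContinuousOn.div (by fun_prop) (by fun_prop)
      (fun w hw => sub_ne_zero.2 fun e => hxK _ (e ▸ hw))
  have hmem : ∀ k, ∀ t ∈ Icc (0 : ℝ) 1, h k t ∈ K := fun k t ht =>
    Or.inl (mem_iUnion.2 ⟨k, t, ht, rfl⟩)
  have hg : ∀ j, ∃ g : ℂ → ℂ, ContinuousOn g P ∧ ∀ w ∈ P, Complex.exp (g w) = f j w := by
    intro j
    have hl : ∀ k, ∃ L : ℝ → ℂ, Continuous L ∧ L 0 = Complex.log (f j z) ∧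
        ∀ t ∈ Icc (0 : ℝ) 1, Complex.exp (L t) = f j (h k t) := by
      intro k
      have hcl : ∀ t : ℝ, (projIcc (0 : ℝ) 1 zero_le_one t : ℝ) ∈ Icc (0 : ℝ) 1 :=
        fun t => (projIcc (0 : ℝ) 1 zero_le_one t).2
      obtain ⟨L, hLc, hL⟩ := exists_continuous_log
        (f := fun t : ℝ => f j (h k (projIcc (0 : ℝ) 1 zero_le_one t)))
        ((hfc j).comp_continuous ((hc k).comp (continuous_subtype_val.comp continuous_projIcc))
          (fun t => hmem k _ (hcl t)))
        (fun t => hf0 _ _ (hmem k _ (hcl t)))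
      have hL' : ∀ t ∈ Icc (0 : ℝ) 1, Complex.exp (L t) = f j (h k t) := fun t ht => by
        rw [hL, projIcc_of_mem zero_le_one ht]
      have hz : z ∈ K := h0 k ▸ hmem k 0 (by simp)
      refine ⟨fun t => L t - L 0 + Complex.log (f j z), by fun_prop, by simp, fun t ht => ?_⟩
      rw [Complex.exp_add, Complex.exp_sub, hL' t ht, hL' 0 (by simp),
        Complex.exp_log (hf0 j z hz), h0 k, div_mul_cancel₀ _ (hf0 j z hz)]
    choose L hLc hL0 hL using hl
    obtain ⟨g, hgc, hgL⟩ := exists_continuousOn_range_of_factors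
      (X := Fin M × Icc (0 : ℝ) 1) (φ := fun q => h q.1 q.2) (ℓ := fun q => L q.1 q.2)
      (continuous_prod_of_discrete_left.2 fun k => (hc k).comp continuous_subtype_val)
      (continuous_prod_of_discrete_left.2 fun k => (hLc k).comp continuous_subtype_val)
      (by
        rintro ⟨k, s, hs⟩ ⟨l, t, ht⟩ e
        rcases hinj k l s t hs ht e with ⟨rfl, rfl⟩ | ⟨rfl, rfl⟩
        · rfl
        · simp [hL0])
    have hr : range (fun q : Fin M × Icc (0 : ℝ) 1 => h q.1 q.2) = P := by
      ext w
      simp [hP]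
    rw [hr] at hgc
    refine ⟨g, hgc, fun w hw => ?_⟩
    obtain ⟨k, t, ht, rfl⟩ := mem_iUnion.1 hw
    rw [hgL (k, ⟨t, ht⟩)]
    exact hL k t ht
  choose g hgc hge using hg
  have hsl : ∀ j, ∀ w ∈ Q, f j w ∈ Complex.slitPlane := fun j w hw =>
    div_mem_slitPlane (convex_ball z δ) (hx _) (hx _) fun hwb => hQδ.le_bot ⟨hw, hwb⟩
  have hcj : ∀ j k, ∃ m : ℤ, g j (h k 1) =
      Complex.log (f j (h k 1)) + m * (2 * Real.pi * Complex.I) := by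
    intro j k
    rw [← Complex.exp_eq_exp_iff_exists_int, hge j _ (mem_iUnion.2 ⟨k, 1, by simp, rfl⟩),
      Complex.exp_log (hf0 j _ (hmem k 1 (by simp)))]
  choose c hcj using hcj
  obtain ⟨n, hn0, T, hT⟩ := exists_int_relation hMN hN c
  set G : ℂ → ℂ := fun w => if w ∈ P then ∑ j, n j * g j w else
    ∑ j, n j * Complex.log (f j w) + T * (2 * Real.pi * Complex.I) with hG
  have hGP : ∀ w ∈ P, G w = ∑ j, n j * g j w := fun w hw => if_pos hw
  have hGQ : ∀ w ∈ Q, G w = ∑ j, n j * Complex.log (f j w) + T * (2 * Real.pi * Complex.I) := by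
    intro w hw
    by_cases hwP : w ∈ P
    · rw [hGP w hwP]
      obtain ⟨k, t, ht, rfl⟩ := mem_iUnion.1 hwP
      obtain rfl := hQh k t ht hw
      rw [← hT k, Finset.sum_congr rfl fun j _ => by rw [hcj j k]]
      push_cast
      rw [Finset.sum_mul, ← Finset.sum_add_distrib]
      exact Finset.sum_congr rfl fun j _ => by ring
    · exact if_neg hwP
  have hGc : ContinuousOn G K := by
    refine ContinuousOn.union_of_isClosed ?_ ?_ hPc.isClosed hQ.isClosed
    · refine ContinuousOn.congr ?_ hGP
      exact continuousOn_finsetSum _ fun j _ => continuousOn_const.mul (hgc j)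
    · refine ContinuousOn.congr ?_ hGQ
      refine ContinuousOn.add (continuousOn_finsetSum _ fun j _ => continuousOn_const.mul
        (ContinuousOn.clog ((hfc j).mono subset_union_right) (hsl j))) continuousOn_const
  have hGe : ∀ w ∈ K, Complex.exp (G w) = ∏ j, f j w ^ n j := by
    intro w hw
    by_cases hwP : w ∈ P
    · rw [hGP w hwP, Complex.exp_sum]
      exact Finset.prod_congr rfl fun j _ => by rw [Complex.exp_int_mul, hge j w hwP]
    · have hwQ : w ∈ Q := hw.resolve_left hwP
      rw [hGQ w hwQ, Complex.exp_add, Complex.exp_sum, Complex.exp_int_mul,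
        Complex.exp_two_pi_mul_I, one_zpow, mul_one]
      exact Finset.prod_congr rfl fun j _ => by
        rw [Complex.exp_int_mul, Complex.exp_log (hf0 j w hw)]
  obtain ⟨j₀, hj₀⟩ : ∃ j, n j ≠ 0 := by
    by_contra! hall
    exact hn0 (funext hall)
  have hε : x j₀.succ ∈ Metric.ball z ε := Metric.ball_subset_ball hδε (hx _)
  set C := pathComponentIn Kᶜ (x j₀.succ) with hC
  have hCo : IsOpen C := hKc.isClosed.isOpen_compl.pathComponentIn _
  have hfr : frontier C ⊆ K := frontier_pathComponentIn_subset hKc.isClosed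
  have hCcl : ∀ i, i ≠ j₀.succ → x i ∉ closure C := by
    intro i hi hcl
    by_cases hiC : x i ∈ C
    · exact hcon _ _ hi.symm hiC
    · exact hxK i (hfr (by rw [hCo.frontier_eq]; exact ⟨hcl, hiC⟩))
  refine borsuk_criterion hKc hCo hfr (Metric.isBounded_ball.subset
    (pathComponentIn_subset_ball (hS.trans subset_union_right) hε (hxK _)))
    (mem_pathComponentIn_self (hxK _)) hj₀
    (R := fun w => (∏ j ∈ Finset.univ.erase j₀, f j w ^ n j) * ((w - x 0) ^ n j₀)⁻¹)
    ?_ ?_ hGc ?_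
  · have hs : ∀ i, i ≠ j₀.succ → ∀ w ∈ closure C, w - x i ≠ 0 := fun i hi w hw =>
      sub_ne_zero.2 fun e => hCcl i hi (e ▸ hw)
    have h00 := hs 0 (Fin.succ_ne_zero j₀).symm
    refine ContinuousOn.mul (continuousOn_finsetProd _ fun j hj => ?_) ?_
    · have hj' := hs j.succ (by simpa using Finset.ne_of_mem_erase hj)
      exact ContinuousOn.zpow₀ (ContinuousOn.div (by fun_prop) (by fun_prop) h00) _
        fun w hw => Or.inl (div_ne_zero (hj' w hw) (h00 w hw))
    · exact ContinuousOn.inv₀ (ContinuousOn.zpow₀ (by fun_prop) _ fun w hw => Or.inl (h00 w hw))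
        fun w hw => zpow_ne_zero _ (h00 w hw)
  · intro w hw
    have hs : ∀ i, i ≠ j₀.succ → w - x i ≠ 0 := fun i hi =>
      sub_ne_zero.2 fun e => hCcl i hi (e ▸ hw)
    have h00 := hs 0 (Fin.succ_ne_zero j₀).symm
    refine mul_ne_zero (Finset.prod_ne_zero_iff.2 fun j hj => zpow_ne_zero _
      (div_ne_zero (hs _ (by simpa using Finset.ne_of_mem_erase hj)) h00))
      (inv_ne_zero (zpow_ne_zero _ h00))
  · intro w hw
    rw [hGe w hw, ← Finset.mul_prod_erase _ _ (Finset.mem_univ j₀)]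
    simp only [hf, div_zpow]
    rw [div_eq_mul_inv]
    ring

/-! ### Paths converging to a point -/

theorem exists_path_of_seq {U : Set ℂ} {z : ℂ} {y : ℕ → ℂ}
    (h : ∀ n, JoinedIn (Metric.ball z ((1 / 2) ^ n) ∩ U) (y n) (y (n + 1))) :
    ∃ γ : Path (y 0) z, ∀ t, t ≠ 1 → γ t ∈ Metric.ball z 1 ∩ U := by
  choose P hP using h
  have hP' : ∀ n t, (P n).extend t ∈ Metric.ball z ((1 / 2) ^ n) ∩ U := fun n t =>
    hP n (projIcc 0 1 zero_le_one t)
  have hyb : ∀ n, dist (y n) z < (1 / 2) ^ n := fun n => by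
    have := (hP' n 0).1
    rwa [Path.extend_zero] at this
  set f : ℕ → ℝ → ℂ := fun n t => (P n).extend ((t - (1 - (1 / 2) ^ n)) * 2 ^ (n + 1)) - y n with hf
  have hfc : ∀ n, Continuous (f n) := fun n =>
    ((P n).continuous_extend.comp (by fun_prop)).sub continuous_const
  have hfb : ∀ n t, ‖f n t‖ ≤ 2 * (1 / 2) ^ n := by
    intro n t
    rw [hf, ← dist_eq_norm]
    have h1 := (hP' n ((t - (1 - (1 / 2) ^ n)) * 2 ^ (n + 1))).1
    have h2 := hyb n
    rw [Metric.mem_ball] at h1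
    have := dist_triangle_right ((P n).extend ((t - (1 - (1 / 2) ^ n)) * 2 ^ (n + 1))) (y n) z
    linarith
  have hsum : Summable (fun n : ℕ => 2 * (1 / 2 : ℝ) ^ n) :=
    (summable_geometric_of_lt_one (by norm_num) (by norm_num)).mul_left 2
  set g : ℝ → ℂ := fun t => y 0 + ∑' n, f n t with hg
  have hgc : Continuous g := continuous_const.add (continuous_tsum hfc hsum hfb)
  have hpow : ∀ k : ℕ, (0 : ℝ) < (1 / 2) ^ k := fun k => by positivity
  have hpow' : ∀ k : ℕ, (1 / 2 : ℝ) ^ k * 2 ^ (k + 1) = 2 := fun k => by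
    rw [pow_succ, ← mul_assoc, ← mul_pow]; norm_num
  have late : ∀ n t, 1 - (1 / 2) ^ (n + 1) ≤ t → f n t = y (n + 1) - y n := by
    intro n t ht
    simp only [hf]
    rw [Path.extend_of_one_le]
    have := hpow' n
    have h2 : (1 / 2 : ℝ) ^ (n + 1) = (1 / 2) ^ n * (1 / 2) := pow_succ _ _
    have h3 : (0 : ℝ) < 2 ^ (n + 1) := by positivity
    nlinarith
  have early : ∀ n t, t ≤ 1 - (1 / 2) ^ n → f n t = 0 := by
    intro n t ht
    simp only [hf]
    rw [Path.extend_of_le_zero, sub_self]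
    have h3 : (0 : ℝ) < 2 ^ (n + 1) := by positivity
    nlinarith
  have hg0 : g 0 = y 0 := by
    simp only [hg]
    rw [tsum_congr (fun n => early n 0 ?_), tsum_zero, add_zero]
    have : (1 / 2 : ℝ) ^ n ≤ 1 := pow_le_one₀ (by norm_num) (by norm_num)
    linarith
  have hyz : Filter.Tendsto y Filter.atTop (𝓝 z) := by
    rw [tendsto_iff_dist_tendsto_zero]
    exact squeeze_zero (fun n => dist_nonneg) (fun n => (hyb n).le)
      (tendsto_pow_atTop_nhds_zero_of_lt_one (by norm_num) (by norm_num))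
  have hg1 : g 1 = z := by
    simp only [hg]
    have hs : Summable (fun n => f n 1) := Summable.of_norm_bounded hsum (fun n => hfb n 1)
    have h1 := hs.hasSum.tendsto_sum_nat
    have h2 : ∀ n, ∑ i ∈ Finset.range n, f i 1 = y n - y 0 := fun n => by
      rw [Finset.sum_congr rfl fun i _ => late i 1 (by linarith [hpow (i + 1)])]
      exact Finset.sum_range_sub y n
    simp_rw [h2] at h1
    rw [tendsto_nhds_unique h1 (hyz.sub_const (y 0))]
    ring
  refine ⟨⟨⟨fun t => g t, hgc.comp continuous_subtype_val⟩, by simpa using hg0, by simpa using hg1⟩,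
    fun t ht => ?_⟩
  have ht1 : (t : ℝ) < 1 := unitInterval.lt_one_iff_ne_one.2 ht
  obtain ⟨n, hn1, hn2⟩ := exists_nat_pow_near_of_lt_one (x := 1 - (t : ℝ)) (y := 1 / 2)
    (by linarith) (by linarith [t.2.1]) (by norm_num) (by norm_num)
  have : g t = (P n).extend ((t - (1 - (1 / 2) ^ n)) * 2 ^ (n + 1)) := by
    simp only [hg]
    rw [tsum_eq_sum (s := Finset.range (n + 1)) fun k hk => early k t ?_,
      Finset.sum_range_succ, Finset.sum_congr rfl fun k hk => late k t ?_,
      Finset.sum_range_sub y n]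
    · simp only [hf]; ring
    · have : (1 / 2 : ℝ) ^ n ≤ (1 / 2) ^ (k + 1) :=
        pow_le_pow_of_le_one (by norm_num) (by norm_num) (by simpa using hk)
      linarith
    · have : (1 / 2 : ℝ) ^ k ≤ (1 / 2) ^ (n + 1) :=
        pow_le_pow_of_le_one (by norm_num) (by norm_num) (by simpa using hk)
      linarith
  change g t ∈ _
  rw [this]
  refine ⟨Metric.ball_subset_ball ?_ (hP' n _).1, (hP' n _).2⟩
  exact pow_le_one₀ (by norm_num) (by norm_num)

theorem dist_discRetract_le {z w : ℂ} (hz : ‖z‖ ≤ 1) : dist (discRetract w) z ≤ dist w z := by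
  rcases le_or_gt ‖w‖ 1 with hw | hw
  · rw [discRetract_eq hw]
  rw [discRetract, max_eq_right hw.le, dist_eq_norm, dist_eq_norm]
  set r := ‖w‖ with hr
  have hr0 : 0 < r := by linarith
  set u : ℂ := (r⁻¹ : ℝ) * w with hu
  have hw' : w = (r : ℂ) * u := by
    have hrC : (r : ℂ) ≠ 0 := by exact_mod_cast hr0.ne'
    rw [hu]; push_cast; field_simp
  have hu1 : ‖u‖ = 1 := by
    rw [hu, norm_mul, Complex.norm_real, Real.norm_of_nonneg (by positivity), ← hr]
    field_simp
  rw [hw']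
  have hu2 : u.re * u.re + u.im * u.im = 1 := by
    have := Complex.normSq_eq_norm_sq u
    rw [hu1, Complex.normSq_apply] at this; linarith
  have hz2 : z.re * z.re + z.im * z.im ≤ 1 := by
    have := Complex.normSq_eq_norm_sq z
    rw [Complex.normSq_apply] at this
    nlinarith [norm_nonneg z]
  refine le_of_sq_le_sq ?_ (norm_nonneg _)
  rw [← Complex.normSq_eq_norm_sq, ← Complex.normSq_eq_norm_sq, Complex.normSq_apply,
    Complex.normSq_apply]
  simp
  have h1 : u.re * z.re + u.im * z.im ≤ 1 := by
    nlinarith [sq_nonneg (u.re - z.re), sq_nonneg (u.im - z.im)]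
  nlinarith [mul_nonneg (sub_nonneg.2 hw.le) (sub_nonneg.2 h1), mul_self_nonneg (r - 1)]

theorem interior_arc_eq_empty {σ : ℝ → ℂ} (hc : Continuous σ) (hi : Function.Injective σ) :
    interior (σ '' Icc 0 1) = ∅ := by
  by_contra hne
  obtain ⟨z, hz⟩ := nonempty_iff_ne_empty.2 hne
  obtain ⟨r, hr, hb⟩ := Metric.isOpen_iff.1 isOpen_interior z hz
  have hb' : Metric.ball z r ⊆ σ '' Icc 0 1 := hb.trans interior_subset
  set c : ℝ → ℂ := fun θ => z + (r / 2 : ℝ) * Complex.exp (θ * Complex.I) with hcdef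
  have hcc : Continuous c := by fun_prop
  have hcb : ∀ θ, c θ ∈ Metric.ball z r := fun θ => by
    simp only [hcdef, Metric.mem_ball, dist_eq_norm, add_sub_cancel_left, norm_mul,
      Complex.norm_exp_ofReal_mul_I, mul_one, Complex.norm_real, Real.norm_eq_abs]
    rw [abs_of_pos (by linarith)]; linarith
  choose f hf hfe using fun θ => hb' (hcb θ)
  have hfc : Continuous f := by
    have hemb : IsClosedEmbedding (fun t : Icc (0 : ℝ) 1 => σ t) :=
      (hc.comp continuous_subtype_val).isClosedEmbedding
        (fun s t hst => Subtype.ext (hi hst))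
    have : Continuous (fun θ => (⟨f θ, hf θ⟩ : Icc (0 : ℝ) 1)) := by
      rw [hemb.isInducing.continuous_iff]
      convert hcc using 1
      exact funext hfe
    exact continuous_subtype_val.comp this
  have hper : ∀ θ, f (θ + 2 * Real.pi) = f θ := fun θ => hi (by
    rw [hfe, hfe]
    simp only [hcdef]
    push_cast
    rw [add_mul, Complex.exp_add, Complex.exp_two_pi_mul_I, mul_one])
  set g : ℝ → ℝ := fun θ => f θ - f (θ + Real.pi) with hg
  have hgc : Continuous g := by fun_prop
  have hg1 : g Real.pi = - g 0 := by
    simp only [hg]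
    have := hper 0
    rw [show Real.pi + Real.pi = 0 + 2 * Real.pi by ring, this]
    simp
  have : (0 : ℝ) ∈ g '' uIcc 0 Real.pi := by
    apply intermediate_value_uIcc hgc.continuousOn
    rw [hg1, mem_uIcc]
    rcases le_total (g 0) 0 with h | h
    · left; constructor <;> linarith
    · right; constructor <;> linarith
  obtain ⟨θ, -, hθ⟩ := this
  have h1 : f θ = f (θ + Real.pi) := sub_eq_zero.1 hθ
  have h2 : c θ = c (θ + Real.pi) := by rw [← hfe, ← hfe, h1]
  simp only [hcdef, Complex.ofReal_add] at h2
  rw [add_mul, Complex.exp_add, Complex.exp_pi_mul_I, add_right_inj] at h2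
  have h3 : ((r / 2 : ℝ) : ℂ) * Complex.exp (θ * Complex.I) = 0 := by linear_combination h2 / 2
  rcases mul_eq_zero.1 h3 with h | h
  · rw [Complex.ofReal_eq_zero] at h; linarith
  · exact Complex.exp_ne_zero _ h

/-! ### Systems of arcs in the plane -/

/-- A finite system of arcs of the closed unit disk, each prolonged radially to an injective
line, pairwise meeting only at the points of a finite set `X`, with no triple point. -/
structure ArcSys where
  p : ℕ
  σ : Fin p → ℝ → ℂ
  X : Set ℂ
  cont : ∀ i, Continuous (σ i)
  inj : ∀ i, Function.Injective (σ i)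
  norm_lt : ∀ i t, 0 < t → t < 1 → ‖σ i t‖ < 1
  norm_zero : ∀ i, ‖σ i 0‖ = 1
  norm_one : ∀ i, ‖σ i 1‖ = 1
  ext_neg : ∀ i t, t ≤ 0 → σ i t = (1 - t : ℝ) * σ i 0
  ext_pos : ∀ i t, 1 ≤ t → σ i t = (t : ℝ) * σ i 1
  X_fin : X.Finite
  X_lt : ∀ z ∈ X, ‖z‖ < 1
  cross : ∀ i j s t, i ≠ j → σ i s = σ j t → σ i s ∈ X
  triple : ∀ i j k r s t, σ i r = σ j s → σ j s = σ k t → i = j ∨ j = k ∨ i = k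

namespace ArcSys

variable (S : ArcSys)

/-- The `i`-th arc. -/
def arc (i : Fin S.p) : Set ℂ := S.σ i '' Icc 0 1

/-- The union of the arcs. -/
def img : Set ℂ := ⋃ i, S.arc i

/-- The points of the open disk off the arcs. -/
def free : Set ℂ := {w | ‖w‖ < 1 ∧ w ∉ S.img}

open Classical in
/-- The arcs through a point. -/
def strands (z : ℂ) : Finset (Fin S.p) := Finset.univ.filter fun i => z ∈ S.arc i

/-- The point `x` is joined to `z` by a path which is off the arcs until its end. -/
def Adj (x z : ℂ) : Prop := ∃ γ : Path x z, ∀ t, t ≠ 1 → γ t ∈ S.free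

variable {S}

theorem mem_strands {i : Fin S.p} {z : ℂ} : i ∈ S.strands z ↔ z ∈ S.arc i := by
  simp [strands]

theorem mem_img {z : ℂ} : z ∈ S.img ↔ ∃ i, z ∈ S.arc i := mem_iUnion

theorem isCompact_arc (i : Fin S.p) : IsCompact (S.arc i) := isCompact_Icc.image (S.cont i)

theorem isCompact_img : IsCompact S.img := isCompact_iUnion isCompact_arc

theorem isOpen_free : IsOpen S.free :=
  (isOpen_lt continuous_norm continuous_const).inter isCompact_img.isClosed.isOpen_compl

theorem norm_le_iff {i : Fin S.p} {t : ℝ} : ‖S.σ i t‖ ≤ 1 ↔ t ∈ Icc (0 : ℝ) 1 := by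
  rcases le_or_gt t 0 with h | h
  · rw [S.ext_neg i t h, norm_mul, S.norm_zero, mul_one, Complex.norm_real, Real.norm_eq_abs,
      abs_of_pos (by linarith)]
    constructor
    · intro h'; constructor <;> linarith
    · intro h'; linarith [h'.1]
  rcases le_or_gt 1 t with h' | h'
  · rw [S.ext_pos i t h', norm_mul, S.norm_one, mul_one, Complex.norm_real, Real.norm_eq_abs,
      abs_of_pos (by linarith)]
    constructor
    · intro h'; constructor <;> linarith
    · intro h'; linarith [h'.2]
  · simp only [(S.norm_lt i t h h').le, mem_Icc, h.le, h'.le, and_self]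

theorem norm_eq_one_iff {i : Fin S.p} {t : ℝ} : ‖S.σ i t‖ = 1 ↔ t = 0 ∨ t = 1 := by
  constructor
  · intro h
    have ht := norm_le_iff.1 h.le
    by_contra! hne
    exact (S.norm_lt i t (lt_of_le_of_ne ht.1 hne.1.symm) (lt_of_le_of_ne ht.2 hne.2)).ne h
  · rintro (rfl | rfl)
    · exact S.norm_zero i
    · exact S.norm_one i

theorem norm_le_of_mem_arc {i : Fin S.p} {z : ℂ} (hz : z ∈ S.arc i) : ‖z‖ ≤ 1 := by
  obtain ⟨t, ht, rfl⟩ := hz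
  exact norm_le_iff.2 ht

theorem mem_line_of_discRetract_mem {i : Fin S.p} {w : ℂ} (hw : ‖w‖ ≤ 2)
    (h : discRetract w ∈ S.arc i) : w ∈ S.σ i '' Icc (-1) 2 := by
  rcases le_or_gt ‖w‖ 1 with h1 | h1
  · rw [discRetract_eq h1] at h
    obtain ⟨t, ht, rfl⟩ := h
    exact ⟨t, ⟨by linarith [ht.1], by linarith [ht.2]⟩, rfl⟩
  obtain ⟨t, ht, e⟩ := h
  have hr0 : ‖w‖ ≠ 0 := by linarith
  have hrC : (‖w‖ : ℂ) ≠ 0 := by exact_mod_cast hr0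
  have e' : w = (‖w‖ : ℂ) * S.σ i t := by
    rw [e, discRetract, max_eq_right h1.le]
    push_cast
    field_simp
  have hn : ‖S.σ i t‖ = 1 := by
    have := congrArg norm e'
    rw [norm_mul, Complex.norm_real, norm_norm] at this
    exact (mul_right_eq_self₀.1 this.symm).resolve_right hr0
  rcases norm_eq_one_iff.1 hn with rfl | rfl
  · refine ⟨1 - ‖w‖, ⟨by linarith, by linarith⟩, ?_⟩
    rw [S.ext_neg i _ (by linarith)]
    rw [sub_sub_cancel]
    exact e'.symm
  · refine ⟨‖w‖, ⟨by linarith, by linarith⟩, ?_⟩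
    rw [S.ext_pos i _ h1.le]
    exact e'.symm

theorem joinedIn_free_of_joinedIn {V : Set ℂ} (hV : IsOpen V) {x y : ℂ}
    (h : JoinedIn (V ∩ {w | ‖w‖ ≤ 1 ∧ w ∉ S.img}) x y) (hx : ‖x‖ < 1) (hy : ‖y‖ < 1) :
    JoinedIn (V ∩ S.free) x y := by
  obtain ⟨γ, hγ⟩ := h
  have hO : IsOpen (V \ S.img) := hV.sdiff isCompact_img.isClosed
  have hK : IsCompact (range γ) := isCompact_range γ.continuous
  obtain ⟨η, hη, hsub⟩ := hK.exists_thickening_subset_open hO (by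
    rintro _ ⟨t, rfl⟩
    exact ⟨(hγ t).1, (hγ t).2.2⟩)
  set r := min η 1 / 2 with hr
  have hr0 : 0 < r := by positivity
  have hrη : r < η := by
    have := min_le_left η 1
    linarith
  have hr1 : r < 1 := by
    have := min_le_right η 1
    linarith
  have near : ∀ (t : unitInterval) (s : ℝ), 0 ≤ s → s ≤ r → (1 - s : ℝ) * γ t ∈ V \ S.img := by
    intro t s h0 h1
    refine hsub (Metric.mem_thickening_iff.2 ⟨γ t, mem_range_self t, ?_⟩)
    rw [dist_eq_norm]
    have : ((1 - s : ℝ) * γ t - γ t : ℂ) = (-s : ℝ) * γ t := by push_cast; ring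
    rw [this, norm_mul, Complex.norm_real, Real.norm_eq_abs, abs_neg, abs_of_nonneg h0]
    have := (hγ t).2.1
    nlinarith
  have sh : ∀ (t : unitInterval) (s : ℝ), 0 < s ∨ ‖γ t‖ < 1 → 0 ≤ s → s ≤ r →
      (1 - s : ℝ) * γ t ∈ V ∩ S.free := by
    intro t s hs h0 h1
    have := near t s h0 h1
    refine ⟨this.1, ?_, this.2⟩
    rw [norm_mul, Complex.norm_real, Real.norm_eq_abs, abs_of_nonneg (by linarith)]
    have := (hγ t).2.1
    rcases hs with hs | hs
    · nlinarith
    · nlinarith [norm_nonneg (γ t)]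
  have seg : ∀ t : unitInterval, ‖γ t‖ < 1 →
      JoinedIn (V ∩ S.free) (γ t) ((1 - r : ℝ) * γ t) := by
    intro t ht
    refine JoinedIn.ofLine (f := fun s => (1 - s * r : ℝ) * γ t) (by fun_prop) (by simp)
      (by simp) ?_
    rintro _ ⟨s, hs, rfl⟩
    exact sh t _ (Or.inr ht) (by nlinarith [hs.1]) (by nlinarith [hs.2])
  have s0 := seg 0 (by simpa using hx)
  have s1 := seg 1 (by simpa using hy)
  rw [γ.source] at s0
  rw [γ.target] at s1
  refine s0.trans (JoinedIn.trans ?_ s1.symm)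
  refine ⟨⟨⟨fun t => (1 - r : ℝ) * γ t, by fun_prop⟩, by simp, by simp⟩, fun t => ?_⟩
  exact sh t r (Or.inl hr0) hr0.le le_rfl

theorem exists_joinedIn_near {z : ℂ} (hz : ‖z‖ ≤ 1) {ε : ℝ} (hε : 0 < ε) :
    ∃ δ > 0, δ ≤ ε ∧ ∀ N, 2 * (S.strands z).card ≤ N → 0 < N → ∀ x : Fin (N + 1) → ℂ,
      (∀ j, x j ∈ Metric.ball z δ ∩ S.free) →
      ∃ i j, i ≠ j ∧ JoinedIn (Metric.ball z ε ∩ S.free) (x i) (x j) := by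
  classical
  -- it suffices to treat small `ε`
  wlog hε1 : ε ≤ 1 generalizing ε
  · obtain ⟨δ, h0, h1, h2⟩ := this one_pos le_rfl
    refine ⟨δ, h0, h1.trans (not_le.1 hε1).le, fun N h3 h4 x hx => ?_⟩
    obtain ⟨i, j, hij, h⟩ := h2 N h3 h4 x hx
    exact ⟨i, j, hij, h.mono (inter_subset_inter_left _
      (Metric.ball_subset_ball (not_le.1 hε1).le))⟩
  have hτ : ∀ i, ∃ τ ∈ Icc (0 : ℝ) 1, i ∈ S.strands z → S.σ i τ = z := by
    intro i
    by_cases hi : i ∈ S.strands z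
    · obtain ⟨t, ht, e⟩ := mem_strands.1 hi
      exact ⟨t, ht, fun _ => e⟩
    · exact ⟨0, by simp, fun h => absurd h hi⟩
  choose τ hτI hτ using hτ
  obtain ⟨ρ, hρ0, hρε, hρX⟩ : ∃ ρ > 0, ρ ≤ ε ∧ ∀ w ∈ S.X, dist w z < ρ → w = z := by
    have : IsOpen (S.X \ {z})ᶜ := (S.X_fin.subset sdiff_subset).isClosed.isOpen_compl
    obtain ⟨ρ, hρ, hb⟩ := Metric.isOpen_iff.1 this z (by simp)
    refine ⟨min ρ ε, lt_min hρ hε, min_le_right _ _, fun w hw hd => ?_⟩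
    by_contra hne
    exact hb (show w ∈ Metric.ball z ρ from hd.trans_le (min_le_left _ _)) ⟨hw, hne⟩
  obtain ⟨η, hη0, hη1, hη⟩ : ∃ η > 0, η ≤ 1 ∧ ∀ i ∈ S.strands z, ∀ t, |t - τ i| ≤ η →
      dist (S.σ i t) z < ρ := by
    have : ∀ᶠ η in 𝓝[>] (0 : ℝ), ∀ i, i ∈ S.strands z → ∀ t, |t - τ i| ≤ η →
        dist (S.σ i t) z < ρ := by
      rw [Filter.eventually_all]
      intro i
      by_cases hi : i ∈ S.strands z
      · obtain ⟨e, he, h⟩ := Metric.continuousAt_iff.1 (S.cont i).continuousAt ρ hρ0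
        filter_upwards [Ioo_mem_nhdsGT he] with η hη _ t ht
        rw [hτ i hi] at h
        exact h (lt_of_le_of_lt ht hη.2)
      · exact Filter.Eventually.of_forall fun η h => absurd h hi
    obtain ⟨η, h1, h2⟩ := (this.and (Ioo_mem_nhdsGT one_pos)).exists
    exact ⟨η, h2.1, h2.2.le, h1⟩
  set Q₁ : Fin S.p → Set ℂ := fun i =>
    S.σ i '' {u | u ∈ Icc (-1 : ℝ) 2 ∧ (i ∈ S.strands z → η ≤ |u - τ i|)} with hQ₁
  have hQ₁c : ∀ i, IsCompact (Q₁ i) := by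
    intro i
    refine IsCompact.image ?_ (S.cont i)
    refine isCompact_Icc.inter_right ?_
    by_cases hi : i ∈ S.strands z
    · simp only [hi, true_imp_iff]
      exact isClosed_le continuous_const (by fun_prop)
    · simp only [hi, false_imp_iff]
      exact isClosed_univ
  set Q : Set ℂ := Metric.sphere z ε ∪ ⋃ i, Q₁ i with hQ
  have hQc : IsCompact Q := (isCompact_sphere z ε).union (isCompact_iUnion hQ₁c)
  have hzQ : z ∉ Q := by
    rintro (h | h)
    · rw [Metric.mem_sphere, dist_self] at h
      exact hε.ne h
    · obtain ⟨i, u, ⟨hu, hui⟩, e⟩ := mem_iUnion.1 h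
      have hu' : u ∈ Icc (0 : ℝ) 1 := norm_le_iff.1 (e ▸ hz)
      have hi : i ∈ S.strands z := mem_strands.2 ⟨u, hu', e⟩
      have := S.inj i ((hτ i hi).trans e.symm)
      have h2 := hui hi
      rw [this, sub_self, abs_zero] at h2
      linarith
  obtain ⟨δ₀, hδ₀, hδQ⟩ := Metric.isOpen_iff.1 hQc.isClosed.isOpen_compl z hzQ
  refine ⟨min δ₀ ε, lt_min hδ₀ hε, min_le_right _ _, fun N hMN hN x hx => ?_⟩
  -- the half-arcs
  have hcard : Fintype.card ({i // i ∈ S.strands z} × Bool) = 2 * (S.strands z).card := by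
    simp [mul_comm]
  set e := (Fintype.equivFinOfCardEq hcard).symm with he
  set sg : Bool → ℝ := fun b => if b then 1 else -1 with hsg
  have hsg1 : ∀ b, |sg b| = 1 := by intro b; cases b <;> simp [hsg]
  set h : Fin (2 * (S.strands z).card) → ℝ → ℂ := fun k s =>
    S.σ (e k).1 (τ (e k).1 + η * (sg (e k).2 * s)) with hh
  have hnear : ∀ k, ∀ s ∈ Icc (0 : ℝ) 1, dist (h k s) z < ρ := by
    intro k s hs
    refine hη _ (e k).1.2 _ ?_
    rw [add_sub_cancel_left, abs_mul, abs_mul, hsg1, abs_of_pos hη0, abs_of_nonneg hs.1]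
    nlinarith [hs.2]
  have hz_iff : ∀ k s, h k s = z → s = 0 := by
    intro k s hs
    have := S.inj _ (hs.trans (hτ (e k).1 (e k).1.2).symm)
    have h2 : η * (sg (e k).2 * s) = 0 := by linarith
    have h3 : sg (e k).2 ≠ 0 := fun h => by have := hsg1 (e k).2; rw [h] at this; simp at this
    simpa [hη0.ne', h3] using h2
  obtain ⟨i, j, hij, hJ⟩ := exists_joinedIn_of_half_arcs (h := h) (z := z) (Q := Q)
    (δ := min δ₀ ε) (ε := ε) (x := x) hMN hN
    (fun k => (S.cont _).comp (by fun_prop))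
    (fun k => by simp only [hh, mul_zero, add_zero]; exact hτ _ (e k).1.2)
    (by
      intro k l s t hs ht hkl
      by_cases hi : ((e k).1 : Fin S.p) = (e l).1
      · simp only [hh] at hkl
        rw [← hi] at hkl
        have h1 := S.inj _ hkl
        have h2 : sg (e k).2 * s = sg (e l).2 * t := by
          have : η * (sg (e k).2 * s - sg (e l).2 * t) = 0 := by linarith
          have := (mul_eq_zero.1 this).resolve_left hη0.ne'
          linarith
        by_cases hb : (e k).2 = (e l).2
        · left
          refine ⟨e.injective (Prod.ext (Subtype.ext hi) hb), ?_⟩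
          rw [← hb] at h2
          refine mul_left_cancel₀ (fun h => ?_) h2
          have := hsg1 (e k).2; rw [h] at this; simp at this
        · right
          have : sg (e k).2 = - sg (e l).2 := by
            revert hb
            cases (e k).2 <;> cases (e l).2 <;> simp [hsg]
          rw [this] at h2
          have h3 : s = -t := by
            have h4 : sg (e l).2 ≠ 0 := fun h => by
              have := hsg1 (e l).2; rw [h] at this; simp at this
            have : sg (e l).2 * (s + t) = 0 := by linarith
            have := (mul_eq_zero.1 this).resolve_left h4
            linarith
          constructor <;> linarith [hs.1, ht.1]
      · right
        have hX := S.cross _ _ _ _ hi hkl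
        have hez := hρX _ hX (hnear k s hs)
        exact ⟨hz_iff k s hez, hz_iff l t (hkl ▸ hez)⟩)
    hQc
    (by
      rintro k s hs (hm | hm)
      · have := hnear k s hs
        rw [Metric.mem_sphere] at hm
        linarith
      · obtain ⟨i, u, ⟨hu, hui⟩, eu⟩ := mem_iUnion.1 hm
        by_cases hi : i = (e k).1
        · subst hi
          have h1 := S.inj _ eu
          have h2 := hui (e k).1.2
          rw [h1, add_sub_cancel_left, abs_mul, abs_mul, hsg1, abs_of_pos hη0,
            abs_of_nonneg hs.1] at h2
          have : 1 ≤ s := by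
            by_contra! hs1
            nlinarith
          exact le_antisymm hs.2 this
        · exfalso
          have hX := S.cross _ _ _ _ hi eu
          rw [eu] at hX
          have hez := hρX _ hX (hnear k s hs)
          apply hzQ
          right
          exact mem_iUnion.2 ⟨i, u, ⟨hu, hui⟩, eu.trans hez⟩)
    (min_le_right _ _)
    (disjoint_left.2 fun w hw hwb =>
      hδQ (Metric.ball_subset_ball (min_le_left _ _) hwb) hw)
    subset_union_left
    (fun j => (hx j).1)
    (by
      intro j k t ht hk
      have hxj := (hx j).2
      apply hxj.2
      rw [← hk]
      refine mem_img.2 ⟨(e k).1, τ (e k).1 + η * (sg (e k).2 * t),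
        (norm_le_iff (S := S) (i := (e k).1)).1 ?_, rfl⟩
      change ‖h k t‖ ≤ 1
      rw [hk]; exact hxj.1.le)
  refine ⟨i, j, hij, ?_⟩
  refine joinedIn_free_of_joinedIn Metric.isOpen_ball ?_ (hx i).2.1 (hx j).2.1
  obtain ⟨γ, hγ⟩ := hJ
  have hK : IsOpen ((⋃ k, h k '' Icc 0 1) ∪ Q)ᶜ := by
    refine (IsClosed.union ?_ hQc.isClosed).isOpen_compl
    refine (isCompact_iUnion fun k => isCompact_Icc.image ?_).isClosed
    exact (S.cont _).comp (by fun_prop)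
  have hball : ∀ t, γ t ∈ Metric.ball z ε := fun t =>
    pathComponentIn_subset_ball (K := (⋃ k, h k '' Icc 0 1) ∪ Q)
      (subset_union_left.trans subset_union_right)
      (Metric.ball_subset_ball (min_le_right _ _) (hx i).1) (by
        have := hγ 0
        rwa [γ.source] at this)
      ⟨γ.truncateOfLE t.2.1 |>.cast (by simp) (by simp), fun s => hγ _⟩
  refine ⟨⟨⟨fun t => discRetract (γ t), continuous_discRetract.comp γ.continuous⟩, ?_, ?_⟩, ?_⟩
  · simp [discRetract_eq (hx i).2.1.le]
  · simp [discRetract_eq (hx j).2.1.le]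
  · intro t
    refine ⟨lt_of_le_of_lt (dist_discRetract_le hz) (hball t), norm_discRetract_le _, fun hm => ?_⟩
    obtain ⟨i, hi⟩ := mem_img.1 hm
    have hn : ‖γ t‖ ≤ 2 := by
      have h1 : dist (γ t) z < ε := hball t
      rw [dist_eq_norm] at h1
      have := norm_le_norm_add_norm_sub' (γ t) z
      linarith
    obtain ⟨u, hu, eu⟩ := mem_line_of_discRetract_mem hn hi
    apply hγ t
    by_cases hc : i ∈ S.strands z ∧ |u - τ i| < η
    · left
      rcases le_total (τ i) u with hle | hle
      · refine mem_iUnion.2 ⟨e.symm (⟨i, hc.1⟩, true), (u - τ i) / η, ⟨?_, ?_⟩, ?_⟩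
        · exact div_nonneg (by linarith) hη0.le
        · rw [div_le_one hη0]; exact (le_abs_self _).trans hc.2.le
        · simp only [hh, Equiv.apply_symm_apply, hsg]
          rw [← eu]
          congr 1
          simp; field_simp; ring
      · refine mem_iUnion.2 ⟨e.symm (⟨i, hc.1⟩, false), (τ i - u) / η, ⟨?_, ?_⟩, ?_⟩
        · exact div_nonneg (by linarith) hη0.le
        · rw [div_le_one hη0]; exact (neg_sub u (τ i) ▸ neg_le_abs (u - τ i)).trans hc.2.le
        · simp only [hh, Equiv.apply_symm_apply, hsg]
          rw [← eu]
          congr 1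
          simp; field_simp; ring
    · right; right
      exact mem_iUnion.2 ⟨i, u, ⟨hu, fun h => not_lt.1 fun h' => hc ⟨h, h'⟩⟩, eu⟩

end ArcSys

namespace ArcSys

variable {S : ArcSys}

theorem Adj.mem_free {x z : ℂ} (h : S.Adj x z) : x ∈ S.free := by
  obtain ⟨γ, hγ⟩ := h
  simpa using hγ 0 (by simp)

theorem Adj.of_joinedIn {x y z : ℂ} (h : S.Adj x z) (hxy : JoinedIn S.free y x) : S.Adj y z := by
  obtain ⟨γ, hγ⟩ := h
  obtain ⟨γ', hγ'⟩ := hxy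
  refine ⟨γ'.trans γ, fun t ht => ?_⟩
  rw [Path.trans_apply]
  split_ifs with h
  · exact hγ' _
  · refine hγ _ fun h1 => ht ?_
    have := congrArg Subtype.val h1
    have h2 : (2 * t - 1 : ℝ) = 1 := this
    exact Subtype.ext (show (t : ℝ) = 1 by linarith)

theorem interior_img : interior S.img = ∅ := by
  rw [interior_eq_empty_iff_dense_compl, img, compl_iUnion]
  exact dense_iInter_of_isOpen (fun i => (isCompact_arc i).isClosed.isOpen_compl) fun i =>
    interior_eq_empty_iff_dense_compl.1 (interior_arc_eq_empty (S.cont i) (S.inj i))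

theorem exists_mem_free_near {z : ℂ} (hz : ‖z‖ ≤ 1) {ε : ℝ} (hε : 0 < ε) :
    ∃ x, x ∈ Metric.ball z ε ∩ S.free := by
  have hd : Dense S.imgᶜ := interior_eq_empty_iff_dense_compl.1 interior_img
  have hcl : z ∈ closure (Metric.ball (0 : ℂ) 1) := by
    rw [closure_ball _ one_ne_zero]; simpa using hz
  obtain ⟨w, hw⟩ := Metric.mem_closure_iff.1 hcl ε hε
  have hO : IsOpen (Metric.ball z ε ∩ Metric.ball (0 : ℂ) 1) :=
    Metric.isOpen_ball.inter Metric.isOpen_ball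
  obtain ⟨x, hx, hxi⟩ := hd.inter_open_nonempty _ hO ⟨w, by
    rw [Metric.mem_ball, dist_comm]; exact hw.2, hw.1⟩
  exact ⟨x, hx.1, by simpa using hx.2, hxi⟩

/-- Near a point of the closed disk, every free point is joined to free points arbitrarily close,
without going far away. -/
theorem exists_forall_joinedIn {z : ℂ} (hz : ‖z‖ ≤ 1) {ε : ℝ} (hε : 0 < ε) :
    ∃ δ > 0, ∀ x ∈ Metric.ball z δ ∩ S.free, ∀ r > 0,
      ∃ y ∈ Metric.ball z r, JoinedIn (Metric.ball z ε ∩ S.free) x y := by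
  by_contra! hcon
  obtain ⟨δ, hδ, -, h⟩ := exists_joinedIn_near (S := S) hz hε
  choose! x hx r hr hxr using hcon
  -- a sequence of radii
  set ρ : ℕ → ℝ := fun n => Nat.rec δ (fun _ q => min q (r q)) n with hρ
  have hρs : ∀ n, ρ (n + 1) = min (ρ n) (r (ρ n)) := fun n => rfl
  have hρ0 : ∀ n, 0 < ρ n := by
    intro n
    induction n with
    | zero => exact hδ
    | succ n ih => rw [hρs]; exact lt_min ih (hr _ ih)
  have hanti : Antitone ρ := antitone_nat_of_succ_le fun n => by rw [hρs]; exact min_le_left _ _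
  set N := 2 * (S.strands z).card + 1
  have key : ∀ i j, i < j → ¬ JoinedIn (Metric.ball z ε ∩ S.free) (x (ρ i)) (x (ρ j)) := by
    intro i j hij
    refine hxr _ (hρ0 i) _ ?_
    have h1 := (hx _ (hρ0 j)).1
    refine Metric.ball_subset_ball ?_ h1
    refine (hanti (Nat.succ_le_of_lt hij)).trans ?_
    rw [Nat.succ_eq_add_one, hρs]; exact min_le_right _ _
  obtain ⟨i, j, hij, hJ⟩ := h N (by omega) (by omega) (fun k => x (ρ k)) (fun k =>
    ⟨Metric.ball_subset_ball (hanti (Nat.zero_le _)) (hx _ (hρ0 k)).1, (hx _ (hρ0 k)).2⟩)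
  rcases lt_or_gt_of_ne (fun h => hij (Fin.ext h) : (i : ℕ) ≠ j) with h | h
  · exact key _ _ h hJ
  · exact key _ _ h hJ.symm

/-- Accessibility: every free point near `z` is adjacent to `z`. -/
theorem exists_forall_adj {z : ℂ} (hz : ‖z‖ ≤ 1) :
    ∃ δ > 0, ∀ x ∈ Metric.ball z δ ∩ S.free, S.Adj x z := by
  have h : ∀ n : ℕ, ∃ δ > 0, ∀ x ∈ Metric.ball z δ ∩ S.free, ∀ r > 0,
      ∃ y ∈ Metric.ball z r, JoinedIn (Metric.ball z ((1 / 2 : ℝ) ^ n) ∩ S.free) x y :=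
    fun n => exists_forall_joinedIn hz (by positivity)
  choose δ hδ h using h
  choose! nx hnx hj using h
  refine ⟨δ 0, hδ 0, fun x hx => ?_⟩
  set y : ℕ → ℂ := fun n => Nat.rec x (fun k q => nx k q (δ (k + 1))) n with hy
  have hys : ∀ n, y (n + 1) = nx n (y n) (δ (n + 1)) := fun n => rfl
  have hmem : ∀ n, y n ∈ Metric.ball z (δ n) ∩ S.free := by
    intro n
    induction n with
    | zero => exact hx
    | succ n ih =>
      rw [hys]
      exact ⟨hnx n _ ih _ (hδ _), (hj n _ ih _ (hδ (n + 1))).target_mem.2⟩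
  obtain ⟨γ, hγ⟩ := exists_path_of_seq (U := S.free) (z := z) (y := y) fun n => by
    rw [hys]
    exact hj n _ (hmem n) _ (hδ _)
  exact ⟨γ, fun t ht => (hγ t ht).2⟩

theorem card_strands_le (z : ℂ) : (S.strands z).card ≤ 2 := by
  by_contra! h
  obtain ⟨a, b, c, ha, hb, hc, hab, hac, hbc⟩ := Finset.two_lt_card_iff.1 h
  obtain ⟨r, -, h1⟩ := mem_strands.1 ha
  obtain ⟨s, -, h2⟩ := mem_strands.1 hb
  obtain ⟨t, -, h3⟩ := mem_strands.1 hc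
  rcases S.triple a b c r s t (h1.trans h2.symm) (h2.trans h3.symm) with h | h | h
  exacts [hab h, hbc h, hac h]

theorem strands_eq_empty {z : ℂ} (hz : z ∉ S.img) : S.strands z = ∅ := by
  by_contra h
  obtain ⟨i, hi⟩ := Finset.nonempty_iff_ne_empty.2 h
  exact hz (mem_img.2 ⟨i, mem_strands.1 hi⟩)

end ArcSys

namespace ArcSys

variable (S : ArcSys)

/-- The endpoints of the arcs. -/
def ep (e : Fin S.p × Bool) : ℂ := S.σ e.1 (if e.2 then 1 else 0)

open Classical in
/-- The number of endpoints whose argument is at most that of `s`; it locates a point of the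
unit circle among the endpoints. -/
def gap (s : ℂ) : ℕ := (Finset.univ.filter fun e => (S.ep e).arg ≤ s.arg).card

open Classical in
/-- `S.Reach g n w` means that `w` can be joined to a point of the unit circle in the gap `g`
with at most `n` hits on the arcs. -/
inductive Reach : ℕ → ℕ → ℂ → Prop
  | root (s : ℂ) (hs : ‖s‖ = 1) : Reach (S.gap s) (if s ∈ S.img then 1 else 0) s
  | leave (g n : ℕ) (x z : ℂ) (h : S.Adj x z) (hz : ‖z‖ ≤ 1) (hz' : z ∉ S.free)
      (hr : Reach g n z) : Reach g n x
  | hit (g n : ℕ) (x z : ℂ) (h : S.Adj x z) (hz : ‖z‖ < 1) (hz' : z ∈ S.img)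
      (hr : Reach g n x) : Reach g (n + 1) z

/-- The least number of hits needed to reach the circle. -/
def depth (w : ℂ) : ℕ := sInf {n | ∃ g, S.Reach g n w}

/-- The least gap reached with the least number of hits. -/
def lab (w : ℂ) : ℕ := sInf {g | S.Reach g (S.depth w) w}

/-- The points of the closed disk with label in `C` met only by arcs of `H`. -/
def track (C : Set ℕ) (H : Finset (Fin S.p)) : Set ℂ :=
  {v | ‖v‖ ≤ 1 ∧ S.lab v ∈ C ∧ S.strands v ⊆ H}

variable {S}

theorem ep_mem_arc (e : Fin S.p × Bool) : S.ep e ∈ S.arc e.1 := by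
  unfold ep
  split_ifs
  · exact ⟨1, by simp, rfl⟩
  · exact ⟨0, by simp, rfl⟩

theorem norm_ep (e : Fin S.p × Bool) : ‖S.ep e‖ = 1 := by
  unfold ep
  split_ifs
  · exact S.norm_one _
  · exact S.norm_zero _

theorem exists_ep_eq {s : ℂ} {i : Fin S.p} (h : s ∈ S.arc i) (hs : ‖s‖ = 1) :
    ∃ c, S.ep (i, c) = s := by
  obtain ⟨t, ht, rfl⟩ := h
  rcases norm_eq_one_iff.1 hs with rfl | rfl
  · exact ⟨false, rfl⟩
  · exact ⟨true, rfl⟩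

theorem ep_injective : Function.Injective S.ep := by
  rintro ⟨i, c⟩ ⟨j, e⟩ h
  by_cases hij : i = j
  · subst hij
    have := S.inj _ h
    cases c <;> cases e <;> simp_all
  · exfalso
    have h1 := S.X_lt _ (S.cross _ _ _ _ hij h)
    have h2 := norm_ep (S := S) (i, c)
    unfold ep at h2
    exact h1.ne h2

theorem not_mem_free_of_norm {s : ℂ} (hs : ‖s‖ = 1) : s ∉ S.free := fun h => h.1.ne hs

theorem not_mem_free_of_mem_img {s : ℂ} (hs : s ∈ S.img) : s ∉ S.free := fun h => h.2 hs

theorem reach_of_norm {g n : ℕ} {s : ℂ} (hs : ‖s‖ = 1) (h : S.Reach g n s) : g = S.gap s := by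
  cases h with
  | root => rfl
  | leave g n x z h => exact absurd h.mem_free (not_mem_free_of_norm hs)
  | hit g n x z h hz => exact absurd hs hz.ne

theorem exists_reach_of_norm {s : ℂ} (hs : ‖s‖ = 1) : ∃ g n, S.Reach g n s := ⟨_, _, .root s hs⟩

theorem Reach.of_joinedIn {g n : ℕ} {x y : ℂ} (h : S.Reach g n x) (hxy : JoinedIn S.free y x) :
    S.Reach g n y := by
  have hx : x ∈ S.free := hxy.target_mem
  cases h with
  | root s hs => exact absurd hx (not_mem_free_of_norm hs)
  | leave g n x z h hz hz' hr => exact .leave _ _ _ z (h.of_joinedIn hxy) hz hz' hr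
  | hit g n x z h hz hz' => exact absurd hx (not_mem_free_of_mem_img hz')

theorem reach_congr {g n : ℕ} {x y : ℂ} (h : JoinedIn S.free x y) :
    S.Reach g n x ↔ S.Reach g n y :=
  ⟨fun h' => h'.of_joinedIn h.symm, fun h' => h'.of_joinedIn h⟩

theorem depth_congr {x y : ℂ} (h : JoinedIn S.free x y) : S.depth x = S.depth y := by
  unfold depth; simp only [reach_congr h]

theorem lab_congr {x y : ℂ} (h : JoinedIn S.free x y) : S.lab x = S.lab y := by
  unfold lab; simp only [reach_congr h, depth_congr h]

theorem Reach.depth_le {g n : ℕ} {w : ℂ} (h : S.Reach g n w) : S.depth w ≤ n :=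
  Nat.sInf_le ⟨g, h⟩

theorem Reach.lab_le {g : ℕ} {w : ℂ} (h : S.Reach g (S.depth w) w) : S.lab w ≤ g :=
  Nat.sInf_le h

theorem reach_lab {w : ℂ} (h : ∃ g n, S.Reach g n w) : S.Reach (S.lab w) (S.depth w) w := by
  obtain ⟨g, n, h⟩ := h
  have h1 : S.depth w ∈ {n | ∃ g, S.Reach g n w} := Nat.sInf_mem ⟨n, g, h⟩
  obtain ⟨g', h1⟩ := h1
  exact Nat.sInf_mem (s := {g | S.Reach g (S.depth w) w}) ⟨g', h1⟩

theorem lab_eq_gap {s : ℂ} (hs : ‖s‖ = 1) : S.lab s = S.gap s :=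
  reach_of_norm hs (reach_lab (exists_reach_of_norm hs))

theorem track_mono {C C' : Set ℕ} {H H' : Finset (Fin S.p)} (hC : C ⊆ C') (hH : H ⊆ H') :
    S.track C H ⊆ S.track C' H' := fun _ h => ⟨h.1, hC h.2.1, h.2.2.trans hH⟩

theorem joinedIn_of_continuous {F : Set ℂ} {f : ℝ → ℂ} (hf : Continuous f) (a b : ℝ)
    (h : ∀ s ∈ Icc (0 : ℝ) 1, f (a + s * (b - a)) ∈ F) : JoinedIn F (f a) (f b) := by
  refine JoinedIn.ofLine (f := fun s => f (a + s * (b - a))) (by fun_prop) (by simp) (by simp) ?_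
  rintro _ ⟨s, hs, rfl⟩
  exact h s hs

theorem adj_of_continuous {f : ℝ → ℂ} (hf : Continuous f) (a b : ℝ)
    (h : ∀ s ∈ Ico (0 : ℝ) 1, f (a + s * (b - a)) ∈ S.free) : S.Adj (f a) (f b) := by
  refine ⟨⟨⟨fun s => f (a + s * (b - a)), by fun_prop⟩, by simp, by simp⟩, fun t ht => ?_⟩
  exact h t ⟨t.2.1, lt_of_le_of_ne t.2.2 fun h => ht (Subtype.ext h)⟩

/-- A free point adjacent to `z` is joined to `z` by a path of points with two labels. -/
theorem Adj.joinedIn_track {x z : ℂ} (h : S.Adj x z) (hz : ‖z‖ ≤ 1) {C : Set ℕ}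
    {H : Finset (Fin S.p)} (hx : S.lab x ∈ C) (hzC : S.lab z ∈ C) (hH : S.strands z ⊆ H) :
    JoinedIn (S.track C H) x z := by
  obtain ⟨γ, hγ⟩ := h
  refine ⟨γ, fun t => ?_⟩
  by_cases ht : t = 1
  · subst ht
    rw [γ.target]
    exact ⟨hz, hzC, hH⟩
  · have hf := hγ t ht
    have hJ : JoinedIn S.free x (γ t) := by
      have := joinedIn_of_continuous (F := S.free) γ.continuous_extend 0 t ?_
      · simpa using this
      · intro s hs
        have ht1 : (t : ℝ) < 1 := lt_of_le_of_ne t.2.2 fun h => ht (Subtype.ext h)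
        have hst : s * t < 1 := by nlinarith [hs.1, hs.2, t.2.1]
        have hst0 : 0 ≤ s * t := mul_nonneg hs.1 t.2.1
        rw [zero_add, sub_zero, γ.extend_apply ⟨hst0, hst.le⟩]
        exact hγ _ fun h => hst.ne (congrArg Subtype.val h)
    exact ⟨hf.1.le, lab_congr hJ ▸ hx, by rw [strands_eq_empty hf.2]; exact Finset.empty_subset _⟩

theorem Reach.exists_joinedIn_track {g n : ℕ} {w : ℂ} (h : S.Reach g n w) :
    n = S.depth w → g = S.lab w → ∃ s H, ‖s‖ = 1 ∧ S.gap s = g ∧ H.card ≤ 2 * n ∧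
      JoinedIn (S.track {g} H) w s := by
  induction h with
  | root s hs =>
    intro _ hl
    refine ⟨s, S.strands s, hs, rfl, ?_, JoinedIn.refl ⟨hs.le, hl.symm, subset_rfl⟩⟩
    split_ifs with h
    · exact card_strands_le s
    · rw [strands_eq_empty h]; simp
  | leave g n x z h hz hz' hr ih =>
    intro hn hl
    have h1 := reach_lab ⟨g, n, hr⟩
    have h2 : S.Reach (S.lab z) (S.depth z) x := .leave _ _ _ z h hz hz' h1
    have h3 : n = S.depth z := by
      have := hr.depth_le
      have := h2.depth_le
      omega
    have h4 : g = S.lab z := by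
      rw [h3] at hr
      have h5 := hr.lab_le
      rw [← h3, hn] at h2
      have := h2.lab_le
      omega
    obtain ⟨s, H, a1, a2, a3, a4⟩ := ih h3 h4
    exact ⟨s, H, a1, a2, a3, (h.joinedIn_track hz (by simp [hl]) (by simp [h4])
      a4.source_mem.2.2).trans a4⟩
  | hit g n x z h hz hz' hr ih =>
    classical
    intro hn hl
    have h1 := reach_lab ⟨g, n, hr⟩
    have h2 : S.Reach (S.lab x) (S.depth x + 1) z := .hit _ _ x z h hz hz' h1
    have h3 : n = S.depth x := by
      have := hr.depth_le
      have := h2.depth_le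
      omega
    have h4 : g = S.lab x := by
      rw [h3] at hr
      have h5 := hr.lab_le
      rw [← h3, hn] at h2
      have := h2.lab_le
      omega
    obtain ⟨s, H, a1, a2, a3, a4⟩ := ih h3 h4
    refine ⟨s, H ∪ S.strands z, a1, a2, ?_, JoinedIn.trans (JoinedIn.symm ?_)
      (a4.mono (track_mono subset_rfl Finset.subset_union_left))⟩
    · have := Finset.card_union_le H (S.strands z)
      have := card_strands_le (S := S) z
      omega
    · exact h.joinedIn_track hz.le (by simp [h4]) (by simp [hl]) Finset.subset_union_right

theorem exists_joinedIn_track {w : ℂ} (h : ∃ g n, S.Reach g n w) :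
    ∃ s H, ‖s‖ = 1 ∧ S.gap s = S.lab w ∧ H.card ≤ 2 * S.depth w ∧
      JoinedIn (S.track {S.lab w} H) w s :=
  (reach_lab h).exists_joinedIn_track rfl rfl

/-! ### Every point of the disk is reachable -/

theorem Adj.joinedIn_of_mem_free {x z : ℂ} (h : S.Adj x z) (hf : z ∈ S.free) :
    JoinedIn S.free x z := by
  obtain ⟨γ, hγ⟩ := h
  refine ⟨γ, fun t => ?_⟩
  by_cases ht : t = 1
  · rwa [ht, γ.target]
  · exact hγ t ht

theorem Adj.reach_iff {x z : ℂ} (h : S.Adj x z) (hz : ‖z‖ ≤ 1) :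
    (∃ g n, S.Reach g n x) ↔ ∃ g n, S.Reach g n z := by
  by_cases hf : z ∈ S.free
  · simp only [reach_congr (h.joinedIn_of_mem_free hf)]
  constructor
  · rintro ⟨g, n, hr⟩
    rcases hz.lt_or_eq with h1 | h1
    · exact ⟨g, n + 1, .hit g n x z h h1 (by by_contra h2; exact hf ⟨h1, h2⟩) hr⟩
    · exact exists_reach_of_norm h1
  · rintro ⟨g, n, hr⟩
    exact ⟨g, n, .leave g n x z h hz hf hr⟩

theorem exists_reach_of_bound {z : ℂ} (hz : ‖z‖ ≤ 1) :
    ∃ δ > 0, ∀ w ∈ Metric.ball z δ, ‖w‖ ≤ 1 →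
      ((∃ g n, S.Reach g n z) ↔ ∃ g n, S.Reach g n w) ∧
      ∀ N, (∃ g n, n ≤ N ∧ S.Reach g n z) → ∃ g n, n ≤ N + 1 ∧ S.Reach g n w := by
  obtain ⟨δ, hδ, h⟩ := exists_forall_adj (S := S) hz
  refine ⟨δ, hδ, fun w hw hw1 => ?_⟩
  obtain ⟨δ', hδ', h'⟩ := exists_forall_adj (S := S) hw1
  have hpos : 0 < min δ' (δ - dist w z) := lt_min hδ' (sub_pos.2 hw)
  obtain ⟨x, hx, hxf⟩ := exists_mem_free_near (S := S) hw1 hpos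
  have hxw : S.Adj x w := h' x ⟨Metric.ball_subset_ball (min_le_left _ _) hx, hxf⟩
  have hxz : S.Adj x z := by
    refine h x ⟨?_, hxf⟩
    have h1 : dist x w < δ - dist w z := lt_of_lt_of_le hx (min_le_right _ _)
    have := dist_triangle x w z
    rw [Metric.mem_ball]; linarith
  refine ⟨(hxz.reach_iff hz).symm.trans (hxw.reach_iff hw1), fun N hN => ?_⟩
  obtain ⟨g, n, hn, hr⟩ := hN
  have hr' : S.Reach g n x := by
    by_cases hf : z ∈ S.free
    · exact hr.of_joinedIn (hxz.joinedIn_of_mem_free hf)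
    · exact .leave _ _ _ z hxz hz hf hr
  by_cases hf : w ∈ S.free
  · exact ⟨g, n, by omega, hr'.of_joinedIn (hxw.joinedIn_of_mem_free hf).symm⟩
  rcases hw1.lt_or_eq with h1 | h1
  · exact ⟨g, n + 1, by omega, .hit g n x w hxw h1 (by by_contra h2; exact hf ⟨h1, h2⟩) hr'⟩
  · exact ⟨_, _, by split_ifs <;> omega, .root w h1⟩

theorem exists_reach {z : ℂ} (hz : ‖z‖ ≤ 1) : ∃ g n, S.Reach g n z := by
  have hpre : IsPreconnected (Metric.closedBall (0 : ℂ) 1) := (convex_closedBall _ _).isPreconnected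
  have := hpre.induction₂ (fun x y => (∃ g n, S.Reach g n x) ↔ ∃ g n, S.Reach g n y) ?_
    (fun x y z _ _ _ h h' => h.trans h') (fun x y _ _ h => h.symm)
    (x := 1) (y := z) (by simp) (by simpa using hz)
  · exact this.1 (exists_reach_of_norm (by simp))
  · intro x hx
    obtain ⟨δ, hδ, h⟩ := exists_reach_of_bound (S := S) (z := x) (by simpa using hx)
    filter_upwards [inter_mem_nhdsWithin _ (Metric.ball_mem_nhds x hδ)] with w hw
    exact (h w hw.2 (by simpa using hw.1)).1

theorem exists_reach_bound : ∃ N, ∀ z, ‖z‖ ≤ 1 → ∃ g n, n ≤ N ∧ S.Reach g n z := by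
  have hK : IsCompact (Metric.closedBall (0 : ℂ) 1) := isCompact_closedBall _ _
  have := hK.induction_on (p := fun s => ∃ N, ∀ z ∈ s, ‖z‖ ≤ 1 → ∃ g n, n ≤ N ∧ S.Reach g n z)
    ⟨0, by simp⟩ (fun s t hst ⟨N, h⟩ => ⟨N, fun z hz => h z (hst hz)⟩) ?_ ?_
  · obtain ⟨N, h⟩ := this
    exact ⟨N, fun z hz => h z (by simpa using hz) hz⟩
  · rintro s t ⟨N, h⟩ ⟨M, h'⟩
    refine ⟨max N M, ?_⟩
    rintro z (hz | hz) hz1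
    · obtain ⟨g, n, hn, hr⟩ := h z hz hz1
      exact ⟨g, n, hn.trans (le_max_left _ _), hr⟩
    · obtain ⟨g, n, hn, hr⟩ := h' z hz hz1
      exact ⟨g, n, hn.trans (le_max_right _ _), hr⟩
  · intro x hx
    have hx1 : ‖x‖ ≤ 1 := by simpa using hx
    obtain ⟨δ, hδ, h⟩ := exists_reach_of_bound (S := S) hx1
    obtain ⟨g, n, hr⟩ := exists_reach (S := S) hx1
    exact ⟨_, mem_nhdsWithin_of_mem_nhds (Metric.ball_mem_nhds x hδ), n + 1, fun z hz hz1 =>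
      (h z hz hz1).2 n ⟨g, n, le_rfl, hr⟩⟩

theorem depth_le_of_forall_free {d : ℕ} (hd : ∀ x ∈ S.free, S.depth x ≤ d) {z : ℂ}
    (hz : ‖z‖ ≤ 1) : S.depth z ≤ d + 1 := by
  rcases hz.lt_or_eq with h1 | h1
  · by_cases hi : z ∈ S.img
    · obtain ⟨δ, hδ, h⟩ := exists_forall_adj (S := S) hz
      obtain ⟨x, hx⟩ := exists_mem_free_near (S := S) hz hδ
      have := reach_lab (exists_reach (S := S) hx.2.1.le)
      have := (Reach.hit _ _ _ _ (h x hx) h1 hi this).depth_le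
      have := hd x hx.2
      omega
    · exact (hd z ⟨h1, hi⟩).trans (by omega)
  · have := (Reach.root (S := S) z h1).depth_le
    split_ifs at this <;> omega

end ArcSys

namespace ArcSys

variable {S : ArcSys}

theorem encard_trans_le {x y z : ℂ} (F : Set ℂ) (γ₁ : Path x y) (γ₂ : Path y z) :
    {t | γ₁.trans γ₂ t ∈ F}.encard ≤
      {t | t ≠ 1 ∧ γ₁ t ∈ F}.encard + {t | γ₂ t ∈ F}.encard := by
  have hsub : {t | γ₁.trans γ₂ t ∈ F} ⊆
      (fun t : unitInterval => (⟨t / 2, by constructor <;> linarith [t.2.1, t.2.2]⟩ :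
        unitInterval)) '' {t | t ≠ 1 ∧ γ₁ t ∈ F} ∪
      (fun t : unitInterval => (⟨(t + 1) / 2, by constructor <;> linarith [t.2.1, t.2.2]⟩ :
        unitInterval)) '' {t | γ₂ t ∈ F} := by
    intro t ht
    rw [mem_ofPred_eq] at ht
    by_cases h : (t : ℝ) < 1 / 2
    · rw [Path.trans_apply, dif_pos h.le] at ht
      refine Or.inl ⟨_, ⟨fun h1 => ?_, ht⟩, ?_⟩
      · have h2 : (2 * t : ℝ) = 1 := congrArg Subtype.val h1
        linarith
      · ext; simp
    · right
      rw [Path.trans_apply] at ht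
      split_ifs at ht with h'
      · have h1 : (t : ℝ) = 1 / 2 := le_antisymm h' (not_lt.1 h)
        refine ⟨0, ?_, ?_⟩
        · rw [mem_ofPred_eq, γ₂.source]
          have h2 : (⟨2 * t, (unitInterval.mul_pos_mem_iff zero_lt_two).2 ⟨t.2.1, h'⟩⟩ :
              unitInterval) = 1 := Subtype.ext (show 2 * (t : ℝ) = 1 by linarith)
          rwa [h2, γ₁.target] at ht
        · ext; simp [h1]
      · refine ⟨_, ht, ?_⟩
        ext; simp
  refine (encard_le_encard hsub).trans ((encard_union_le _ _).trans ?_)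
  exact add_le_add (encard_image_le _ _) (encard_image_le _ _)

theorem Reach.norm_eq_one_or_exists_path {g n : ℕ} {w : ℂ} (h : S.Reach g n w) :
    (‖w‖ = 1 ∧ (w ∈ S.img → 1 ≤ n)) ∨
    ∃ s, ∃ γ : Path w s, ‖s‖ = 1 ∧ (∀ t, ‖γ t‖ ≤ 1) ∧ {t | γ t ∈ S.img}.encard ≤ n := by
  induction h with
  | root s hs => exact Or.inl ⟨hs, fun h => by simp [h]⟩
  | leave g n x z h hz hz' hr ih =>
    obtain ⟨γ', h'⟩ := h
    have hn : ∀ t, ‖γ' t‖ ≤ 1 := fun t => by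
      by_cases h3 : t = 1
      · rw [h3, γ'.target]; exact hz
      · exact (h' _ h3).1.le
    right
    rcases ih with ⟨hz1, hzn⟩ | ⟨s, γ, hs, h1, h2⟩
    · refine ⟨z, γ', hz1, hn, ?_⟩
      have hsub : {t | γ' t ∈ S.img} ⊆ {1} := fun t ht => by
        by_contra h3
        exact (h' t h3).2 ht
      by_cases hzi : z ∈ S.img
      · refine (encard_le_encard hsub).trans ((encard_singleton _).le.trans ?_)
        exact_mod_cast hzn hzi
      · have : {t | γ' t ∈ S.img} = ∅ := by
          refine eq_empty_of_forall_notMem fun t ht => hzi ?_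
          have h3 : t = 1 := hsub ht
          rw [← γ'.target, ← h3]
          exact ht
        rw [this, encard_empty]
        exact zero_le
    refine ⟨s, γ'.trans γ, hs, ?_, (encard_trans_le _ _ _).trans ?_⟩
    · intro t
      rw [Path.trans_apply]
      split_ifs with ht
      · exact hn _
      · exact h1 _
    · have : {t | t ≠ 1 ∧ γ' t ∈ S.img} = ∅ := by
        ext t
        simp only [mem_ofPred_eq, mem_empty_iff_false, iff_false, not_and]
        exact fun ht => (h' t ht).2
      rw [this, encard_empty, zero_add]
      exact h2
  | hit g n x z h hz hz' hr ih =>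
    have hxf := h.mem_free
    obtain ⟨γ', h'⟩ := h
    right
    rcases ih with ⟨hx1, -⟩ | ⟨s, γ, hs, h1, h2⟩
    · exact absurd hx1 hxf.1.ne
    refine ⟨s, γ'.symm.trans γ, hs, ?_, (encard_trans_le _ _ _).trans ?_⟩
    · intro t
      rw [Path.trans_apply]
      split_ifs with ht
      · rw [Path.symm_apply]
        by_cases h3 : unitInterval.symm (⟨2 * t,
          (unitInterval.mul_pos_mem_iff zero_lt_two).2 ⟨t.2.1, ht⟩⟩ : unitInterval) = 1
        · rw [Function.comp_apply, h3, γ'.target]; exact hz.le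
        · exact (h' _ h3).1.le
      · exact h1 _
    · have : {t | t ≠ 1 ∧ γ'.symm t ∈ S.img} ⊆ {0} := by
        rintro t ⟨-, ht⟩
        by_contra h0
        refine (h' (unitInterval.symm t) fun h => h0 ?_).2 ht
        rw [mem_singleton_iff, ← unitInterval.symm_symm t, h, unitInterval.symm_one]
      have h3 := (encard_le_encard this).trans (encard_singleton _).le
      push_cast
      rw [add_comm]
      exact add_le_add h2 h3

theorem Reach.exists_path {g n : ℕ} {w : ℂ} (h : S.Reach g n w) (hw : w ∉ S.img) :
    ∃ s, ∃ γ : Path w s, ‖s‖ = 1 ∧ (∀ t, ‖γ t‖ ≤ 1) ∧ {t | γ t ∈ S.img}.encard ≤ n := by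
  rcases h.norm_eq_one_or_exists_path with ⟨h1, -⟩ | h
  · exact ⟨w, Path.refl w, h1, fun t => h1.le, by simp [hw]⟩
  · exact h

theorem exists_reach_of_path {f : ℝ → ℂ} (hf : Continuous f) (hn : ∀ t ∈ Icc (0 : ℝ) 1, ‖f t‖ ≤ 1)
    (h1 : ‖f 1‖ = 1) (hfin : {t | t ∈ Icc (0 : ℝ) 1 ∧ f t ∈ S.img}.Finite) (m : ℕ) :
    ∀ t ∈ Icc (0 : ℝ) 1, f t ∈ S.free →
      {u | u ∈ Icc (0 : ℝ) 1 ∧ f u ∈ S.img ∧ t ≤ u}.ncard ≤ m →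
      ∃ g n, n ≤ m ∧ S.Reach g n (f t) := by
  have hfin' : ∀ t, {u | u ∈ Icc (0 : ℝ) 1 ∧ f u ∈ S.img ∧ t ≤ u}.Finite := fun t =>
    hfin.subset fun u hu => ⟨hu.1, hu.2.1⟩
  induction m using Nat.strong_induction_on with
  | _ m ih =>
  intro t ht htf hm
  have hcl : IsCompact {u | u ∈ Icc t 1 ∧ f u ∉ S.free} :=
    isCompact_Icc.inter_right (isOpen_free.isClosed_compl.preimage hf)
  obtain ⟨b, ⟨⟨hb0, hb1⟩, hbf⟩, hleast⟩ :=
    hcl.exists_isLeast ⟨1, ⟨ht.2, le_rfl⟩, not_mem_free_of_norm h1⟩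
  have hb : b ∈ Icc (0 : ℝ) 1 := ⟨ht.1.trans hb0, hb1⟩
  have htb : t < b := lt_of_le_of_ne hb0 fun h => hbf (h ▸ htf)
  have hadj : S.Adj (f t) (f b) := by
    refine adj_of_continuous hf t b fun s hs => ?_
    by_contra hc
    have hlt : t + s * (b - t) < b := by nlinarith [hs.2]
    have hge : t ≤ t + s * (b - t) := by nlinarith [hs.1]
    exact absurd (hleast ⟨⟨hge, (hlt.trans_le hb1).le⟩, hc⟩) (not_le.2 hlt)
  have hm1 : f b ∈ S.img → 0 < m := fun h => by
    refine lt_of_lt_of_le ((ncard_pos (hfin' t)).2 ⟨b, hb, h, hb0⟩) hm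
  rcases (hn b hb).lt_or_eq with hlt | heq
  · have hbi : f b ∈ S.img := by
      by_contra h
      exact hbf ⟨hlt, h⟩
    have hb1' : b < 1 := lt_of_le_of_ne hb1 fun h => by rw [h, h1] at hlt; exact hlt.false
    obtain ⟨η, hη, hηf⟩ : ∃ η > 0, ∀ u, b < u → u < b + η → f u ∈ S.free ∧ u < 1 := by
      have hO : IsOpen ({t | t ∈ Icc (0 : ℝ) 1 ∧ f t ∈ S.img} \ {b})ᶜ :=
        (hfin.subset sdiff_subset).isClosed.isOpen_compl
      have h3 := hO.mem_nhds (show b ∈ _ by simp)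
      have h4 : ∀ᶠ u in 𝓝 b, ‖f u‖ < 1 := hf.norm.continuousAt.eventually_lt_const hlt
      have h5 : ∀ᶠ u in 𝓝 b, u < 1 := gt_mem_nhds hb1'
      obtain ⟨η, hη, h6⟩ := Metric.eventually_nhds_iff.1 (h4.and (h5.and h3))
      refine ⟨η, hη, fun u hu hu' => ?_⟩
      obtain ⟨h7, h8, h9⟩ := h6 (show dist u b < η by
        rw [Real.dist_eq, abs_of_pos (by linarith)]; linarith)
      refine ⟨⟨h7, fun hi => h9 ⟨⟨⟨hb.1.trans hu.le, h8.le⟩, hi⟩, ?_⟩⟩, h8⟩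
      exact hu.ne'
    obtain ⟨hcf, hc1⟩ := hηf (b + η / 2) (by linarith) (by linarith)
    have hadj' : S.Adj (f (b + η / 2)) (f b) := by
      refine adj_of_continuous hf _ _ fun s hs => (hηf _ ?_ ?_).1 <;> nlinarith [hs.1, hs.2]
    have hlt' : {u | u ∈ Icc (0 : ℝ) 1 ∧ f u ∈ S.img ∧ b + η / 2 ≤ u}.ncard <
        {u | u ∈ Icc (0 : ℝ) 1 ∧ f u ∈ S.img ∧ t ≤ u}.ncard := by
      refine ncard_lt_ncard ⟨fun u hu => ⟨hu.1, hu.2.1, by linarith [hu.2.2]⟩, fun h => ?_⟩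
        (hfin' t)
      have := (h (show b ∈ _ from ⟨hb, hbi, hb0⟩)).2.2
      linarith
    obtain ⟨g, n, hnm, hr⟩ := ih (m - 1) (by have := hm1 hbi; omega) (b + η / 2)
      ⟨by linarith [hb.1], hc1.le⟩ hcf (by omega)
    exact ⟨g, n + 1, by have := hm1 hbi; omega,
      .leave _ _ _ _ hadj hlt.le hbf (.hit _ _ _ _ hadj' hlt hbi hr)⟩
  · refine ⟨_, _, ?_, .leave _ _ _ _ hadj heq.le hbf (.root _ heq)⟩
    split_ifs with h
    · exact hm1 h
    · exact Nat.zero_le _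

end ArcSys

namespace ArcSys

variable {S : ArcSys}

variable (S) in
/-- The crossings, the endpoints, and the cut point of the circle. -/
def special : Set ℂ := S.X ∪ range S.ep ∪ {-1}

theorem special_finite : S.special.Finite :=
  (S.X_fin.union (finite_range _)).union (finite_singleton _)

theorem norm_le_of_mem_special {z : ℂ} (hz : z ∈ S.special) : ‖z‖ ≤ 1 := by
  rcases hz with (hz | ⟨e, rfl⟩) | rfl
  · exact (S.X_lt z hz).le
  · exact (norm_ep e).le
  · simp

theorem eq_of_arg_eq {z w : ℂ} (hz : ‖z‖ = 1) (hw : ‖w‖ = 1) (h : z.arg = w.arg) : z = w :=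
  Complex.ext_norm_arg (hz.trans hw.symm) h

theorem mem_slitPlane_of_norm {s : ℂ} (hs : ‖s‖ = 1) (h : s ≠ -1) : s ∈ Complex.slitPlane := by
  rw [Complex.mem_slitPlane_iff_arg]
  refine ⟨fun h' => h ?_, fun h0 => by simp [h0] at hs⟩
  exact eq_of_arg_eq hs (by simp) (by rw [h', Complex.arg_neg_one])

theorem mem_special_of_norm {s : ℂ} (hs : ‖s‖ = 1) (h : s ∈ S.img) : s ∈ S.special := by
  obtain ⟨i, hi⟩ := mem_img.1 h
  obtain ⟨c, hc⟩ := exists_ep_eq hi hs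
  exact Or.inl (Or.inr ⟨_, hc⟩)

theorem eventually_gap_eq {s : ℂ} (hs : ‖s‖ = 1) (h : s ∉ S.special) :
    ∀ᶠ w in 𝓝 s, S.gap w = S.gap s := by
  have hsp := mem_slitPlane_of_norm hs fun h' => h (Or.inr h')
  have h1 : ∀ᶠ w in 𝓝 s, ∀ e, (S.ep e).arg ≤ w.arg ↔ (S.ep e).arg ≤ s.arg := by
    rw [Filter.eventually_all]
    intro e
    have hne : (S.ep e).arg ≠ s.arg := fun h' =>
      h (Or.inl (Or.inr ⟨e, eq_of_arg_eq (norm_ep e) hs h'⟩))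
    have hc := Complex.continuousAt_arg hsp
    rcases hne.lt_or_gt with h' | h'
    · filter_upwards [hc.eventually_const_lt h'] with w hw
      simp [hw.le, h'.le]
    · filter_upwards [hc.eventually_lt_const h'] with w hw
      exact iff_of_false (not_le.2 hw) (not_le.2 h')
  filter_upwards [h1] with w hw
  unfold gap
  simp only [hw]

/-- Near a point of the circle at most two gaps occur. -/
theorem exists_gap_eq_or {z : ℂ} (hz : ‖z‖ = 1) (hcut : ∀ e, S.ep e ≠ -1) :
    ∃ g, ∀ᶠ w in 𝓝 z, ‖w‖ = 1 → S.gap w = S.gap z ∨ S.gap w = g := by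
  classical
  by_cases h1 : z = -1
  · subst h1
    refine ⟨0, ?_⟩
    have hle : ∀ e, (S.ep e).arg < Real.pi := fun e =>
      (Complex.mem_slitPlane_iff_arg.1 (mem_slitPlane_of_norm (norm_ep e) (hcut e))).1.lt_of_le
        (Complex.arg_le_pi _)
    have hgt : ∀ e, -Real.pi < (S.ep e).arg := fun e => Complex.neg_pi_lt_arg _
    -- the argument of `w` is close to `± π`
    have h2 : ∀ᶠ w in 𝓝 (-1 : ℂ), ∀ e, |(S.ep e).arg| < |w.arg| := by
      rw [Filter.eventually_all]
      intro e
      have : ContinuousAt (fun w : ℂ => |w.arg|) (-1) := by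
        have h3 : ContinuousAt (fun w : ℂ => Real.arccos (w.re / ‖w‖)) (-1) :=
          Real.continuous_arccos.continuousAt.comp (f := fun w : ℂ => w.re / ‖w‖)
            (Complex.continuous_re.continuousAt.div continuous_norm.continuousAt (by simp))
        refine h3.congr ?_
        filter_upwards [isOpen_ne.mem_nhds (show (-1 : ℂ) ≠ 0 by simp)] with w hw
        rw [← Complex.cos_arg hw, ← Real.cos_abs,
          Real.arccos_cos (abs_nonneg _) (Complex.abs_arg_le_pi _)]
      refine this.eventually_const_lt ?_
      dsimp only
      rw [Complex.arg_neg_one, abs_of_pos Real.pi_pos, abs_lt]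
      exact ⟨hgt e, hle e⟩
    filter_upwards [h2] with w hw _
    rcases le_total 0 w.arg with h | h
    · left
      unfold gap
      congr 1
      ext e
      have := hw e
      rw [abs_of_nonneg h] at this
      simp [(hle e).le, (le_abs_self _).trans this.le]
    · right
      unfold gap
      rw [Finset.card_eq_zero, Finset.filter_eq_empty_iff]
      intro e _
      have := hw e
      rw [abs_of_nonpos h] at this
      have := neg_abs_le (S.ep e).arg
      linarith
  · have hsp := mem_slitPlane_of_norm hz h1
    refine ⟨(Finset.univ.filter fun e => (S.ep e).arg < z.arg).card, ?_⟩
    have h1 : ∀ᶠ w in 𝓝 z, ∀ e, (S.ep e).arg ≠ z.arg →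
        ((S.ep e).arg ≤ w.arg ↔ (S.ep e).arg ≤ z.arg) := by
      rw [Filter.eventually_all]
      intro e
      by_cases hne : (S.ep e).arg = z.arg
      · simp [hne]
      have hc := Complex.continuousAt_arg hsp
      rcases lt_or_gt_of_ne hne with h' | h'
      · filter_upwards [hc.eventually_const_lt h'] with w hw
        simp [hw.le, h'.le]
      · filter_upwards [hc.eventually_lt_const h'] with w hw
        exact fun _ => iff_of_false (not_le.2 hw) (not_le.2 h')
    filter_upwards [h1] with w hw _
    rcases le_or_gt z.arg w.arg with h | h
    · left
      unfold gap
      congr 1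
      ext e
      by_cases he : (S.ep e).arg = z.arg
      · simp [he, h]
      · simp [hw e he]
    · right
      unfold gap
      congr 1
      ext e
      by_cases he : (S.ep e).arg = z.arg
      · simp [he, h]
      · simp [hw e he, lt_iff_le_and_ne, he]

/-- Near a point of the circle, the other points are in the gap on their side. -/
theorem exists_joinedIn_circle {z : ℂ} (hz : ‖z‖ = 1) :
    ∀ᶠ y in 𝓝 z, ‖y‖ = 1 →
      JoinedIn {v | ‖v‖ = 1 ∧ (v = z ∨ (S.gap v = S.gap y ∧ v ∉ S.img))} z y := by
  have hz0 : z ≠ 0 := fun h => by simp [h] at hz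
  have hU : ∀ᶠ w in 𝓝 z, w ∉ S.special \ {z} :=
    (special_finite.subset sdiff_subset).isClosed.isOpen_compl.mem_nhds (by simp)
  have hc : Filter.Tendsto (fun φ : ℝ => z * Complex.exp (φ * Complex.I)) (𝓝 0) (𝓝 z) := by
    have : Continuous fun φ : ℝ => z * Complex.exp (φ * Complex.I) := by fun_prop
    simpa using this.tendsto 0
  obtain ⟨η, hη, hη'⟩ := Metric.eventually_nhds_iff.1 (hc.eventually hU)
  have ha : ContinuousAt (fun y : ℂ => (y / z).arg) z := by
    refine (Complex.continuousAt_arg ?_).comp (f := fun y : ℂ => y / z) (by fun_prop)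
    simp [hz0]
  have hlim : ∀ᶠ y in 𝓝 z, |(y / z).arg| < η := by
    have : Filter.Tendsto (fun y : ℂ => |(y / z).arg|) (𝓝 z) (𝓝 0) := by
      simpa [hz0, ContinuousAt] using ha.abs
    exact this.eventually_lt_const hη
  filter_upwards [hlim] with y hy hy1
  set φ := (y / z).arg with hφ
  have hyz : z * Complex.exp (φ * Complex.I) = y := by
    have h1 := Complex.norm_mul_exp_arg_mul_I (y / z)
    rw [norm_div, hy1, hz, div_one, Complex.ofReal_one, one_mul] at h1
    rw [h1]; field_simp
  set f : ℝ → ℂ := fun s => z * Complex.exp ((s * φ : ℝ) * Complex.I) with hf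
  have hf1 : f 1 = y := by simp only [hf, one_mul]; exact hyz
  have hf0 : f 0 = z := by simp [hf]
  have hfn : ∀ s, ‖f s‖ = 1 := fun s => by
    simp only [hf, norm_mul, hz, Complex.norm_exp_ofReal_mul_I, mul_one]
  have hfc : Continuous f := by fun_prop
  by_cases hφ0 : φ = 0
  · have : y = z := by rw [← hyz, hφ0]; simp
    rw [this]
    exact JoinedIn.refl ⟨hz, Or.inl rfl⟩
  have hns : ∀ s ∈ Ioc (0 : ℝ) 1, f s ∉ S.special := by
    intro s hs hsp
    refine hη' (y := s * φ) ?_ ⟨hsp, ?_⟩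
    · rw [Real.dist_eq, sub_zero, abs_mul, abs_of_pos hs.1]
      nlinarith [hs.2, abs_nonneg φ]
    · intro h
      have h2 : Complex.exp ((s * φ : ℝ) * Complex.I) = 1 := by
        have h3 : z * Complex.exp ((s * φ : ℝ) * Complex.I) = z * 1 := by rw [mul_one]; exact h
        exact mul_left_cancel₀ hz0 h3
      have h4 : (s * φ) ∈ Ioc (-Real.pi) Real.pi := by
        have h5 := Complex.neg_pi_lt_arg (y / z)
        have h6 := Complex.arg_le_pi (y / z)
        rw [← hφ] at h5 h6
        constructor <;> nlinarith [hs.1, hs.2, Real.pi_pos]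
      have h5 := Complex.arg_exp_mul_I (s * φ)
      rw [h2, Complex.arg_one, (toIocMod_eq_self Real.two_pi_pos).2 (by
        rwa [two_mul, neg_add_cancel_left])] at h5
      exact mul_ne_zero hs.1.ne' hφ0 h5.symm
  have hconst : ∀ s ∈ Ioc (0 : ℝ) 1, S.gap (f s) = S.gap y := by
    intro s hs
    have hcon : ContinuousOn (fun s => S.gap (f s)) (Ioc 0 1) := by
      intro t ht
      refine ContinuousAt.continuousWithinAt ?_
      have := hfc.continuousAt.eventually (eventually_gap_eq (hfn t) (hns t ht))
      exact continuousAt_const.congr (this.mono fun _ h => h.symm)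
    have := isPreconnected_Ioc.constant hcon hs (⟨one_pos, le_rfl⟩ : (1 : ℝ) ∈ Ioc (0 : ℝ) 1)
    rwa [hf1] at this
  have := joinedIn_of_continuous (F := {v | ‖v‖ = 1 ∧ (v = z ∨ (S.gap v = S.gap y ∧ v ∉ S.img))})
    hfc 0 1 ?_
  · rwa [hf0, hf1] at this
  · intro s hs
    rw [sub_zero, mul_one, zero_add]
    refine ⟨hfn s, ?_⟩
    rcases hs.1.eq_or_lt with h | h
    · left; rw [← h, hf0]
    · right
      exact ⟨hconst s ⟨h, hs.2⟩, fun hi => hns s ⟨h, hs.2⟩ (mem_special_of_norm (hfn s) hi)⟩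

end ArcSys

namespace ArcSys

variable {S : ArcSys}

theorem Reach.exists_adj_lab_eq {g n : ℕ} {w : ℂ} (h : S.Reach g n w) (hn : n = S.depth w)
    (hg : g = S.lab w) (hw : ‖w‖ < 1) (hi : w ∈ S.img) : ∃ x, S.Adj x w ∧ S.lab x = S.lab w := by
  cases h with
  | root s hs => exact absurd hs hw.ne
  | leave g n x z h hz hz' hr => exact absurd hi h.mem_free.2
  | hit g n x z h hz hz' hr =>
    refine ⟨x, h, ?_⟩
    have h1 := reach_lab ⟨g, n, hr⟩
    have h2 : S.Reach (S.lab x) (S.depth x + 1) w := .hit _ _ x w h hz hz' h1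
    have h3 : n = S.depth x := by
      have := hr.depth_le
      have := h2.depth_le
      omega
    rw [h3] at hr
    have h5 := hr.lab_le
    rw [← h3, hn] at h2
    have := h2.lab_le
    omega

theorem Adj.exists_joinedIn_of_mem_nhds {x w : ℂ} (h : S.Adj x w) {U : Set ℂ} (hU : U ∈ 𝓝 w) :
    ∃ x' ∈ U, JoinedIn S.free x x' := by
  obtain ⟨γ, hγ⟩ := h
  have hc : Filter.Tendsto γ.extend (𝓝 1) (𝓝 w) := by
    have := γ.continuous_extend.tendsto 1
    rwa [γ.extend_one] at this
  obtain ⟨η, hη, h1⟩ := Metric.eventually_nhds_iff.1 (hc.eventually hU)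
  set t : ℝ := 1 - min η 1 / 2 with ht
  have hm : 0 < min η 1 := lt_min hη one_pos
  have hm1 : min η 1 ≤ 1 := min_le_right _ _
  have hm2 : min η 1 ≤ η := min_le_left _ _
  refine ⟨γ.extend t, h1 ?_, ?_⟩
  · rw [Real.dist_eq, abs_lt]; constructor <;> linarith
  · have := joinedIn_of_continuous (F := S.free) γ.continuous_extend 0 t ?_
    · simpa using this
    · intro s hs
      have hst : s * t < 1 := by nlinarith [hs.1, hs.2]
      have hst0 : 0 ≤ s * t := mul_nonneg hs.1 (by linarith)
      rw [zero_add, sub_zero, γ.extend_apply ⟨hst0, hst.le⟩]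
      exact hγ _ fun h => hst.ne (congrArg Subtype.val h)

theorem card_strands_le_one {y : ℂ} (hs : y ∉ S.special) : (S.strands y).card ≤ 1 := by
  rw [Finset.card_le_one]
  intro i hi j hj
  by_contra hij
  obtain ⟨s, -, h1⟩ := mem_strands.1 hi
  obtain ⟨t, -, h2⟩ := mem_strands.1 hj
  exact hs (Or.inl (Or.inl (h1 ▸ S.cross i j s t hij (h1.trans h2.symm))))

/-- Near a point which is not special there are at most two labels. -/
theorem exists_two_labels {y : ℂ} (hy : ‖y‖ ≤ 1) (hs : y ∉ S.special) {ε : ℝ} (hε : 0 < ε) :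
    ∃ δ > 0, ∃ x₁ ∈ Metric.ball y ε, ∃ x₂ ∈ Metric.ball y ε, S.Adj x₁ y ∧ S.Adj x₂ y ∧
      (∀ w ∈ Metric.ball y δ, ‖w‖ < 1 → S.lab w = S.lab x₁ ∨ S.lab w = S.lab x₂) ∧
      (‖y‖ = 1 → S.lab x₁ = S.lab x₂) := by
  obtain ⟨δ₀, hδ₀, h₀ε, h₀⟩ := exists_joinedIn_near (S := S) hy hε
  obtain ⟨δ₁, hδ₁, h₁⟩ := exists_forall_adj (S := S) hy
  set δ := min δ₀ δ₁
  have hδ : 0 < δ := lt_min hδ₀ hδ₁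
  have hδ₀' : Metric.ball y δ ⊆ Metric.ball y δ₀ := Metric.ball_subset_ball (min_le_left _ _)
  have hδ₁' : Metric.ball y δ ⊆ Metric.ball y δ₁ := Metric.ball_subset_ball (min_le_right _ _)
  have hδε : Metric.ball y δ ⊆ Metric.ball y ε := hδ₀'.trans (Metric.ball_subset_ball h₀ε)
  obtain ⟨x₁, hx₁, hf₁⟩ := exists_mem_free_near (S := S) hy hδ
  suffices H : ∃ x₂ ∈ Metric.ball y δ ∩ S.free, (‖y‖ = 1 → S.lab x₁ = S.lab x₂) ∧
      ∀ x ∈ Metric.ball y δ ∩ S.free, S.lab x = S.lab x₁ ∨ S.lab x = S.lab x₂ by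
    obtain ⟨x₂, ⟨hx₂, hf₂⟩, hn, hx⟩ := H
    refine ⟨δ, hδ, x₁, hδε hx₁, x₂, hδε hx₂, h₁ _ ⟨hδ₁' hx₁, hf₁⟩, h₁ _ ⟨hδ₁' hx₂, hf₂⟩,
      fun w hw hw1 => ?_, hn⟩
    by_cases hi : w ∈ S.img
    · obtain ⟨x, hxw, hl⟩ := (reach_lab (exists_reach hw1.le)).exists_adj_lab_eq rfl rfl hw1 hi
      obtain ⟨x', hx', hJ⟩ := hxw.exists_joinedIn_of_mem_nhds (Metric.isOpen_ball.mem_nhds hw)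
      rw [← hl, lab_congr hJ]
      exact hx x' ⟨hx', hJ.target_mem⟩
    · exact hx w ⟨hw, hw1, hi⟩
  have hc := card_strands_le_one hs
  by_cases hi : y ∈ S.img
  · have hy1 : ‖y‖ ≠ 1 := fun h => hs (mem_special_of_norm h hi)
    by_cases hall : ∀ x ∈ Metric.ball y δ ∩ S.free, S.lab x = S.lab x₁
    · exact ⟨x₁, ⟨hx₁, hf₁⟩, fun _ => rfl, fun x hx => Or.inl (hall x hx)⟩
    push Not at hall
    obtain ⟨x₂, hx₂, hne⟩ := hall
    refine ⟨x₂, hx₂, fun h => absurd h hy1, fun x hx => ?_⟩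
    obtain ⟨i, j, hij, hJ⟩ := h₀ 2 (by omega) (by omega) ![x₁, x₂, x] (by
      intro j
      fin_cases j
      · exact ⟨hδ₀' hx₁, hf₁⟩
      · exact ⟨hδ₀' hx₂.1, hx₂.2⟩
      · exact ⟨hδ₀' hx.1, hx.2⟩)
    have := lab_congr (hJ.mono inter_subset_right)
    fin_cases i <;> fin_cases j <;> simp at hij this <;>
      first | (left; omega) | (right; omega)
  · refine ⟨x₁, ⟨hx₁, hf₁⟩, fun _ => rfl, fun x hx => Or.inl ?_⟩
    obtain ⟨i, j, hij, hJ⟩ := h₀ 1 (by rw [strands_eq_empty hi]; simp) (by omega) ![x₁, x] (by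
      intro j
      fin_cases j
      · exact ⟨hδ₀' hx₁, hf₁⟩
      · exact ⟨hδ₀' hx.1, hx.2⟩)
    have := lab_congr (hJ.mono inter_subset_right)
    fin_cases i <;> fin_cases j <;> simp at hij this <;> omega

/-- Points of the circle in the gaps `g` and `h` are joined by points with label `g` or `h`
which only meet arcs of `H`. -/
def Conn (S : ArcSys) (H : Finset (Fin S.p)) (g h : ℕ) : Prop :=
  ∃ s t, ‖s‖ = 1 ∧ ‖t‖ = 1 ∧ S.gap s = g ∧ S.gap t = h ∧ JoinedIn (S.track {g, h} H) s t

theorem Conn.symm {H : Finset (Fin S.p)} {g h : ℕ} (hc : S.Conn H g h) : S.Conn H h g := by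
  obtain ⟨s, t, hs, ht, h1, h2, hJ⟩ := hc
  exact ⟨t, s, ht, hs, h2, h1, by rw [pair_comm]; exact hJ.symm⟩

/-- `H` contains the arcs met by a path of minimal depth from `w` to the circle. -/
def Escape (S : ArcSys) (H : Finset (Fin S.p)) (w : ℂ) : Prop :=
  ∃ s, ‖s‖ = 1 ∧ S.gap s = S.lab w ∧ JoinedIn (S.track {S.lab w} H) w s

theorem Escape.mono {H H' : Finset (Fin S.p)} {w : ℂ} (h : S.Escape H w) (hH : H ⊆ H') :
    S.Escape H' w := by
  obtain ⟨s, h1, h2, h3⟩ := h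
  exact ⟨s, h1, h2, h3.mono (track_mono subset_rfl hH)⟩

theorem Escape.strands_subset {H : Finset (Fin S.p)} {w : ℂ} (h : S.Escape H w) :
    S.strands w ⊆ H := by
  obtain ⟨s, h1, h2, h3⟩ := h
  exact h3.source_mem.2.2

theorem exists_escape {w : ℂ} (h : ‖w‖ ≤ 1) : ∃ H, H.card ≤ 2 * S.depth w ∧ S.Escape H w := by
  obtain ⟨s, H, h1, h2, h3, h4⟩ := exists_joinedIn_track (S := S) (exists_reach h)
  exact ⟨H, h3, s, h1, h2, h4⟩

theorem Conn.of_joinedIn {H : Finset (Fin S.p)} {w w' : ℂ} (h : S.Escape H w)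
    (h' : S.Escape H w') (hJ : JoinedIn (S.track {S.lab w, S.lab w'} H) w w') :
    S.Conn H (S.lab w) (S.lab w') := by
  obtain ⟨s, h1, h2, h3⟩ := h
  obtain ⟨t, h4, h5, h6⟩ := h'
  refine ⟨s, t, h1, h4, h2, h5, (h3.symm.mono (track_mono ?_ subset_rfl)).trans
    (hJ.trans (h6.mono (track_mono ?_ subset_rfl)))⟩ <;> simp

theorem Conn.of_adj {H : Finset (Fin S.p)} {x z : ℂ} (hx : S.Escape H x) (hz : S.Escape H z)
    (hz1 : ‖z‖ ≤ 1) (h : S.Adj x z) : S.Conn H (S.lab x) (S.lab z) :=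
  .of_joinedIn hx hz (h.joinedIn_track hz1 (by simp) (by simp) hz.strands_subset)

end ArcSys

namespace ArcSys

variable {S : ArcSys}

/-- The conditions on a radius small enough to separate the special points. -/
structure GoodRadius (S : ArcSys) (r : ℝ) : Prop where
  pos : 0 < r
  eq_of_mem : ∀ z ∈ S.special, ∀ w ∈ Metric.ball z (4 * r), w ∈ S.special → w = z
  adj : ∀ z ∈ S.special, ∀ w ∈ Metric.ball z (4 * r), w ∈ S.free → S.Adj w z
  norm_lt : ∀ z ∈ S.special, ∀ w ∈ Metric.ball z (4 * r), ‖z‖ < 1 → ‖w‖ < 1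
  joined : ∀ z ∈ S.special, ∀ w ∈ Metric.ball z (4 * r), ‖z‖ = 1 → ‖w‖ = 1 →
    JoinedIn {v | ‖v‖ = 1 ∧ (v = z ∨ (S.gap v = S.gap w ∧ v ∉ S.img))} z w
  gap_eq : ∀ z ∈ S.special, ‖z‖ = 1 → ∃ g, ∀ w ∈ Metric.ball z (4 * r), ‖w‖ = 1 →
    S.gap w = S.gap z ∨ S.gap w = g

theorem exists_goodRadius (hcut : ∀ e, S.ep e ≠ -1) : ∃ r, S.GoodRadius r := by
  have key : ∀ {z : ℂ} {P : ℂ → Prop}, (∀ᶠ w in 𝓝 z, P w) →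
      ∀ᶠ r in 𝓝[>] (0 : ℝ), ∀ w ∈ Metric.ball z (4 * r), P w := by
    intro z P h
    obtain ⟨ε, hε, h⟩ := Metric.eventually_nhds_iff.1 h
    filter_upwards [Ioo_mem_nhdsGT (show (0 : ℝ) < ε / 4 by positivity)] with r hr w hw
    refine h (lt_of_lt_of_le hw ?_)
    linarith [hr.2]
  have key' : ∀ {P : ℂ → ℂ → Prop}, (∀ z ∈ S.special, ∀ᶠ w in 𝓝 z, P z w) →
      ∀ᶠ r in 𝓝[>] (0 : ℝ), ∀ z ∈ S.special, ∀ w ∈ Metric.ball z (4 * r), P z w := by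
    intro P h
    rw [Filter.eventually_all_finite special_finite]
    exact fun z hz => key (h z hz)
  have h1 := key' (P := fun z w => w ∈ S.special → w = z) (by
    intro z hz
    have : (S.special \ {z})ᶜ ∈ 𝓝 z :=
      (special_finite.subset sdiff_subset).isClosed.isOpen_compl.mem_nhds (by simp)
    filter_upwards [this] with w hw hs
    by_contra hne
    exact hw ⟨hs, hne⟩)
  have h2 := key' (P := fun z w => w ∈ S.free → S.Adj w z) (by
    intro z hz
    obtain ⟨δ, hδ, h⟩ := exists_forall_adj (S := S) (norm_le_of_mem_special hz)
    filter_upwards [Metric.ball_mem_nhds z hδ] with w hw hf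
    exact h w ⟨hw, hf⟩)
  have h3 := key' (P := fun z w => ‖z‖ < 1 → ‖w‖ < 1) (by
    intro z hz
    by_cases h : ‖z‖ < 1
    · filter_upwards [continuous_norm.continuousAt.eventually_lt_const h] with w hw _ using hw
    · simp [h])
  have h4 := key' (P := fun z w => ‖z‖ = 1 → ‖w‖ = 1 →
      JoinedIn {v | ‖v‖ = 1 ∧ (v = z ∨ (S.gap v = S.gap w ∧ v ∉ S.img))} z w) (by
    intro z hz
    by_cases h : ‖z‖ = 1
    · filter_upwards [exists_joinedIn_circle (S := S) h] with w hw _ using hw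
    · simp [h])
  have h5 : ∀ z : S.special, ∃ g, ∀ᶠ w in 𝓝 (z : ℂ), ‖(z : ℂ)‖ = 1 → ‖w‖ = 1 →
      S.gap w = S.gap z ∨ S.gap w = g := by
    intro z
    by_cases h : ‖(z : ℂ)‖ = 1
    · obtain ⟨g, hg⟩ := exists_gap_eq_or h hcut
      exact ⟨g, by filter_upwards [hg] with w hw _ using hw⟩
    · exact ⟨0, by simp [h]⟩
  choose g hg using h5
  have h6 := key' (P := fun z w => ∀ hz : z ∈ S.special, ‖z‖ = 1 → ‖w‖ = 1 →
      S.gap w = S.gap z ∨ S.gap w = g ⟨z, hz⟩) (by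
    intro z hz
    filter_upwards [hg ⟨z, hz⟩] with w hw _ using hw)
  have h0 : ∀ᶠ r in 𝓝[>] (0 : ℝ), 0 < r := self_mem_nhdsWithin
  obtain ⟨r, a0, a1, a2, a3, a4, a6⟩ :=
    (h0.and (h1.and (h2.and (h3.and (h4.and h6))))).exists
  exact ⟨r, a0, a1, a2, a3, a4, fun z hz h => ⟨g ⟨z, hz⟩, fun w hw => a6 z hz w hw hz h⟩⟩

/-- The labels of a point, once the special points have been thickened to disks. -/
def Lab (S : ArcSys) (r : ℝ) (w : ℂ) (l : ℕ) : Prop :=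
  (‖w‖ = 1 ∧ l = S.gap w) ∨ (∃ z ∈ S.special, dist w z ≤ r ∧ l = S.lab z) ∨
    ((∀ z ∈ S.special, r < dist w z) ∧ l = S.lab w)

theorem exists_lab (r : ℝ) (w : ℂ) : ∃ l, S.Lab r w l := by
  by_cases h : ∀ z ∈ S.special, r < dist w z
  · exact ⟨_, Or.inr (Or.inr ⟨h, rfl⟩)⟩
  · push Not at h
    obtain ⟨z, hz, h⟩ := h
    exact ⟨_, Or.inr (Or.inl ⟨z, hz, h, rfl⟩)⟩

theorem GoodRadius.conn {r : ℝ} (hr : S.GoodRadius r) {z w : ℂ} (hz : z ∈ S.special)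
    (hz1 : ‖z‖ = 1) (hw : dist w z < 4 * r) (hw1 : ‖w‖ = 1) {H : Finset (Fin S.p)}
    (hH : S.strands z ⊆ H) : S.Conn H (S.lab z) (S.gap w) := by
  refine ⟨z, w, hz1, hw1, (lab_eq_gap hz1).symm, rfl, (hr.joined z hz w hw hz1 hw1).mono ?_⟩
  rintro v ⟨hv, rfl | ⟨hg, hi⟩⟩
  · exact ⟨hv.le, by simp, hH⟩
  · exact ⟨hv.le, by simp [lab_eq_gap hv, hg], by simp [strands_eq_empty hi]⟩

/-- Around each point, the labels are pairwise connected using few arcs. -/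
theorem GoodRadius.exists_cluster {r : ℝ} (hr : S.GoodRadius r) {d : ℕ}
    (hd : ∀ x ∈ S.free, S.depth x ≤ d) {y : ℂ} (hy : ‖y‖ ≤ 1) :
    ∃ (C : Set ℕ) (H : Finset (Fin S.p)), H.card ≤ 6 * d + 4 ∧
      (∀ᶠ w in 𝓝 y, ‖w‖ ≤ 1 → ∀ l, S.Lab r w l → l ∈ C) ∧
      ∀ g ∈ C, ∀ h ∈ C, g ≠ h → S.Conn H g h := by
  have hr0 := hr.pos
  have hdz : ∀ z ∈ S.special, S.depth z ≤ d + 1 := fun z hz =>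
    depth_le_of_forall_free hd (norm_le_of_mem_special hz)
  by_cases hA : ∃ z ∈ S.special, dist y z < r
  · obtain ⟨z, hz, hyz⟩ := hA
    have hzn := norm_le_of_mem_special hz
    obtain ⟨H, hHc, hH⟩ := exists_escape (S := S) hzn
    refine ⟨{l | l = S.lab z ∨ ∃ w, ‖w‖ = 1 ∧ dist w z < 4 * r ∧ l = S.gap w}, H, ?_, ?_, ?_⟩
    · have := hdz z hz
      omega
    · filter_upwards [Metric.isOpen_ball.mem_nhds (show y ∈ Metric.ball z r from hyz)] with w hw hw1
      have hwz : dist w z < r := hw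
      rintro l (⟨h1, rfl⟩ | ⟨z', hz', h1, rfl⟩ | ⟨h1, rfl⟩)
      · exact Or.inr ⟨w, h1, by linarith, rfl⟩
      · have : z' = z := hr.eq_of_mem z hz z' (by
          have := dist_triangle_left z' z w
          rw [Metric.mem_ball]; linarith) hz'
        exact Or.inl (by rw [this])
      · exact absurd (h1 z hz) (not_lt.2 hwz.le)
    · have hz1 : ∀ w, ‖w‖ = 1 → dist w z < 4 * r → ‖z‖ = 1 := by
        intro w hw hwz
        by_contra h
        exact (hr.norm_lt z hz w hwz (lt_of_le_of_ne hzn h)).ne hw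
      rintro g (rfl | ⟨w, hw, hwz, rfl⟩) h (rfl | ⟨w', hw', hwz', rfl⟩) hne
      · exact absurd rfl hne
      · exact hr.conn hz (hz1 w' hw' hwz') hwz' hw' hH.strands_subset
      · exact (hr.conn hz (hz1 w hw hwz) hwz hw hH.strands_subset).symm
      · have h1 := hz1 w hw hwz
        obtain ⟨g, hg⟩ := hr.gap_eq z hz h1
        have c1 := hr.conn hz h1 hwz hw hH.strands_subset
        have c2 := hr.conn hz h1 hwz' hw' hH.strands_subset
        rw [lab_eq_gap h1] at c1 c2
        rcases hg w hwz hw with a | a <;> rcases hg w' hwz' hw' with b | b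
        · exact absurd (a.trans b.symm) hne
        · rw [a]; exact c2
        · rw [b]; exact c1.symm
        · exact absurd (a.trans b.symm) hne
  push Not at hA
  have hys : y ∉ S.special := fun h => by
    have := hA y h
    rw [dist_self] at this
    linarith
  obtain ⟨δ, hδ, x₁, hx₁, x₂, hx₂, a₁, a₂, hlab, hlab1⟩ := exists_two_labels hy hys hr0
  obtain ⟨H₁, hH₁, e₁⟩ := exists_escape (S := S) a₁.mem_free.1.le
  obtain ⟨H₂, hH₂, e₂⟩ := exists_escape (S := S) a₂.mem_free.1.le
  obtain ⟨H₃, hH₃, e₃⟩ : ∃ H : Finset (Fin S.p), H.card ≤ 2 * (d + 1) ∧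
      ∀ z ∈ S.special, dist y z = r → S.Escape H z := by
    by_cases h : ∃ z ∈ S.special, dist y z = r
    · obtain ⟨z, hz, hyz⟩ := h
      obtain ⟨H, hHc, hH⟩ := exists_escape (S := S) (norm_le_of_mem_special hz)
      refine ⟨H, by have := hdz z hz; omega, fun z' hz' hyz' => ?_⟩
      have : z' = z := hr.eq_of_mem z hz z' (by
        have := dist_triangle_left z' z y
        rw [Metric.mem_ball]; linarith) hz'
      rwa [this]
    · push Not at h
      exact ⟨∅, by simp, fun z hz h' => absurd h' (h z hz)⟩
  set H := H₁ ∪ H₂ ∪ H₃ ∪ S.strands y with hH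
  have s₁ : H₁ ⊆ H := by
    rw [hH, Finset.union_assoc, Finset.union_assoc]; exact Finset.subset_union_left
  have s₂ : H₂ ⊆ H := by
    rw [hH, Finset.union_comm H₁, Finset.union_assoc, Finset.union_assoc]
    exact Finset.subset_union_left
  have s₃ : H₃ ⊆ H := by
    rw [hH, Finset.union_comm (H₁ ∪ H₂), Finset.union_assoc]; exact Finset.subset_union_left
  have s₄ : S.strands y ⊆ H := Finset.subset_union_right
  replace e₁ := e₁.mono s₁
  replace e₂ := e₂.mono s₂
  replace e₃ := fun z hz h => (e₃ z hz h).mono s₃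
  have ey : ‖y‖ = 1 → S.Escape H y := fun h =>
    ⟨y, h, (lab_eq_gap h).symm, JoinedIn.refl ⟨hy, rfl, s₄⟩⟩
  have c12 : S.lab x₁ ≠ S.lab x₂ → S.Conn H (S.lab x₁) (S.lab x₂) := by
    intro hne
    have hy1 : ‖y‖ < 1 := lt_of_le_of_ne hy fun h => hne (hlab1 h)
    have hl := hlab y (Metric.mem_ball_self hδ) hy1
    exact .of_joinedIn e₁ e₂ ((a₁.joinedIn_track hy (by simp) (by simpa using hl) s₄).trans
      (a₂.joinedIn_track hy (by simp) (by simpa using hl) s₄).symm)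
  have c1y : ‖y‖ = 1 → S.Conn H (S.lab x₁) (S.lab y) := fun h => .of_adj e₁ (ey h) hy a₁
  have c2y : ‖y‖ = 1 → S.Conn H (S.lab x₂) (S.lab y) := fun h => .of_adj e₂ (ey h) hy a₂
  have cxz : ∀ x ∈ Metric.ball y r, x ∈ S.free → S.Escape H x → ∀ z ∈ S.special, dist y z = r →
      S.Conn H (S.lab x) (S.lab z) := fun x hx hxf ex z hz h =>
    .of_adj ex (e₃ z hz h) (norm_le_of_mem_special hz) (hr.adj z hz x (by
      have := dist_triangle x y z
      have : dist x y < r := hx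
      rw [Metric.mem_ball]; linarith) hxf)
  have c1z := cxz x₁ hx₁ a₁.mem_free e₁
  have c2z := cxz x₂ hx₂ a₂.mem_free e₂
  have cyz : ‖y‖ = 1 → ∀ z ∈ S.special, dist y z = r → S.Conn H (S.lab y) (S.lab z) := by
    intro h z hz hyz
    have hzn := norm_le_of_mem_special hz
    have hd4 : dist y z < 4 * r := by linarith
    have hz1 : ‖z‖ = 1 := by
      by_contra h'
      exact (hr.norm_lt z hz y hd4 (lt_of_le_of_ne hzn h')).ne h
    rw [lab_eq_gap h]
    exact (hr.conn hz hz1 hd4 h (e₃ z hz hyz).strands_subset).symm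
  refine ⟨{l | l = S.lab x₁ ∨ l = S.lab x₂ ∨ (‖y‖ = 1 ∧ l = S.lab y) ∨
    ∃ z ∈ S.special, dist y z = r ∧ l = S.lab z}, H, ?_, ?_, ?_⟩
  · have h1 := Finset.card_union_le (H₁ ∪ H₂ ∪ H₃) (S.strands y)
    have h2 := Finset.card_union_le (H₁ ∪ H₂) H₃
    have h3 := Finset.card_union_le H₁ H₂
    have h4 := card_strands_le (S := S) y
    have h5 := hd _ a₁.mem_free
    have h6 := hd _ a₂.mem_free
    rw [hH]
    omega
  · have n1 : ∀ᶠ w in 𝓝 y, ‖y‖ < 1 → ‖w‖ < 1 := by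
      by_cases h : ‖y‖ < 1
      · filter_upwards [continuous_norm.continuousAt.eventually_lt_const h] with w hw _ using hw
      · simp [h]
    have n2 : ∀ᶠ w in 𝓝 y, ‖y‖ = 1 → S.gap w = S.gap y := by
      by_cases h : ‖y‖ = 1
      · filter_upwards [eventually_gap_eq h hys] with w hw _ using hw
      · simp [h]
    have n3 : ∀ᶠ w in 𝓝 y, ∀ z ∈ S.special, r < dist y z → r < dist w z := by
      rw [Filter.eventually_all_finite special_finite]
      intro z _
      by_cases h : r < dist y z
      · have : ContinuousAt (fun w => dist w z) y := by fun_prop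
        filter_upwards [this.eventually_const_lt h] with w hw _ using hw
      · simp [h]
    filter_upwards [n1, n2, n3, Metric.ball_mem_nhds y hδ] with w m1 m2 m3 m4 hw
    have hcirc : ‖w‖ = 1 → ‖y‖ = 1 ∧ S.gap w = S.lab y := fun h => by
      have hy1 : ‖y‖ = 1 := by
        by_contra h'
        exact (m1 (lt_of_le_of_ne hy h')).ne h
      exact ⟨hy1, (m2 hy1).trans (lab_eq_gap hy1).symm⟩
    rintro l (⟨h1, rfl⟩ | ⟨z, hz, h1, rfl⟩ | ⟨-, rfl⟩)
    · exact Or.inr (Or.inr (Or.inl (hcirc h1)))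
    · refine Or.inr (Or.inr (Or.inr ⟨z, hz, ?_, rfl⟩))
      refine le_antisymm (not_lt.1 fun h => ?_) (hA z hz)
      exact absurd (m3 z hz h) (not_lt.2 h1)
    · rcases hw.lt_or_eq with h | h
      · rcases hlab w m4 h with h' | h'
        · exact Or.inl h'
        · exact Or.inr (Or.inl h')
      · rw [lab_eq_gap h]
        exact Or.inr (Or.inr (Or.inl (hcirc h)))
  · rintro g (rfl | rfl | ⟨h1, rfl⟩ | ⟨z, hz, hyz, rfl⟩) h
      (rfl | rfl | ⟨h1', rfl⟩ | ⟨z', hz', hyz', rfl⟩) hne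
    · exact absurd rfl hne
    · exact c12 hne
    · exact c1y h1'
    · exact c1z z' hz' hyz'
    · exact (c12 hne.symm).symm
    · exact absurd rfl hne
    · exact c2y h1'
    · exact c2z z' hz' hyz'
    · exact (c1y h1).symm
    · exact (c2y h1).symm
    · exact absurd rfl hne
    · exact cyz h1 z' hz' hyz'
    · exact (c1z z hz hyz).symm
    · exact (c2z z hz hyz).symm
    · exact (cyz h1' z hz hyz).symm
    · have : z' = z := hr.eq_of_mem z hz z' (by
        have := dist_triangle_left z' z y
        rw [Metric.mem_ball]; linarith) hz'
      exact absurd (by rw [this]) hne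

end ArcSys

namespace ArcSys

variable {S : ArcSys}

/-! ### Chords -/

theorem exp_arg_mul_I {s : ℂ} (hs : ‖s‖ = 1) : Complex.exp (s.arg * Complex.I) = s := by
  have := Complex.norm_mul_exp_arg_mul_I s
  rwa [hs, Complex.ofReal_one, one_mul] at this

/-- Paths in the disk whose endpoints are interlaced on the circle meet. -/
theorem exists_mem_of_joinedIn {F G : Set ℂ} {z₁ z₂ w₁ w₂ : ℂ} (hF : JoinedIn F z₁ z₂)
    (hG : JoinedIn G w₁ w₂) (nF : ∀ v ∈ F, ‖v‖ ≤ 1) (nG : ∀ v ∈ G, ‖v‖ ≤ 1)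
    (nz₁ : ‖z₁‖ = 1) (nz₂ : ‖z₂‖ = 1) (nw₁ : ‖w₁‖ = 1) (nw₂ : ‖w₂‖ = 1)
    (h1 : z₁.arg < w₁.arg) (h2 : w₁.arg < z₂.arg) (h3 : w₂.arg < z₁.arg ∨ z₂.arg < w₂.arg) :
    ∃ v, v ∈ F ∧ v ∈ G := by
  obtain ⟨γ, hγ⟩ := hF
  obtain ⟨δ, hδ⟩ := hG
  have mγ : ∀ t, γ.extend t ∈ F := fun t => hγ _
  have mδ : ∀ t, δ.extend t ∈ G := fun t => hδ _
  obtain ⟨s, t, hst⟩ := paths_intersect γ.continuous_extend δ.continuous_extend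
    (fun t => nF _ (mγ t)) (fun t => nG _ (mδ t))
    (a := z₁.arg) (b := z₂.arg) (c := w₁.arg) (e := w₂.arg)
    (by rw [exp_arg_mul_I nz₁, γ.extend_zero]) (by rw [exp_arg_mul_I nz₂, γ.extend_one])
    (by rw [exp_arg_mul_I nw₁, δ.extend_zero]) (by rw [exp_arg_mul_I nw₂, δ.extend_one]) h1 h2 (by
      have a1 := Complex.neg_pi_lt_arg z₁
      have a2 := Complex.arg_le_pi z₂
      have a3 := Complex.neg_pi_lt_arg w₂
      have a4 := Complex.arg_le_pi w₂
      rcases h3 with h3 | h3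
      · left; constructor <;> linarith
      · right; constructor <;> linarith)
  exact ⟨_, mγ s, hst ▸ mδ t⟩

theorem gap_mono {s t : ℂ} (h : s.arg ≤ t.arg) : S.gap s ≤ S.gap t := by
  classical
  unfold gap
  refine Finset.card_le_card fun e he => ?_
  simp only [Finset.mem_filter] at he ⊢
  exact ⟨he.1, he.2.trans h⟩

theorem arg_lt_of_gap_lt {s t : ℂ} (h : S.gap s < S.gap t) : s.arg < t.arg :=
  not_le.1 fun h' => absurd (gap_mono h') (not_le.2 h)

theorem arg_ep_le_iff {e : Fin S.p × Bool} {s : ℂ} :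
    (S.ep e).arg ≤ s.arg ↔ S.gap (S.ep e) ≤ S.gap s := by
  classical
  refine ⟨gap_mono, fun h => not_lt.1 fun h' => absurd h (not_le.2 ?_)⟩
  unfold gap
  refine Finset.card_lt_card (Finset.ssubset_iff_subset_ne.2 ⟨fun e' he => ?_, fun heq => ?_⟩)
  · simp only [Finset.mem_filter] at he ⊢
    exact ⟨he.1, he.2.trans h'.le⟩
  · have : e ∈ Finset.univ.filter fun e' => (S.ep e').arg ≤ (S.ep e).arg := by simp
    rw [← heq] at this
    simp only [Finset.mem_filter] at this
    exact absurd this.2 (not_le.2 h')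

variable (S) in
/-- The position of an endpoint on the circle. -/
def idx (e : Fin S.p × Bool) : ℕ := S.gap (S.ep e)

theorem idx_injective : Function.Injective S.idx := by
  intro e e' h
  refine ep_injective (eq_of_arg_eq (norm_ep e) (norm_ep e') (le_antisymm ?_ ?_))
  · exact arg_ep_le_iff.2 h.le
  · exact arg_ep_le_iff.2 h.ge

theorem gap_le (s : ℂ) : S.gap s ≤ 2 * S.p := by
  classical
  unfold gap
  refine (Finset.card_filter_le _ _).trans ?_
  simp [mul_comm]

theorem idx_pos (e : Fin S.p × Bool) : 0 < S.idx e := by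
  classical
  unfold idx gap
  exact Finset.card_pos.2 ⟨e, by simp⟩

theorem exists_idx_eq {k : ℕ} (h0 : 0 < k) (hk : k ≤ 2 * S.p) : ∃ e, S.idx e = k := by
  classical
  have h : Finset.univ.image S.idx = Finset.Icc 1 (2 * S.p) := by
    refine Finset.eq_of_subset_of_card_le ?_ ?_
    · intro n hn
      obtain ⟨e, -, rfl⟩ := Finset.mem_image.1 hn
      exact Finset.mem_Icc.2 ⟨idx_pos e, gap_le _⟩
    · rw [Finset.card_image_of_injective _ idx_injective]
      simp [mul_comm]
  have : k ∈ Finset.univ.image S.idx := by rw [h]; exact Finset.mem_Icc.2 ⟨h0, hk⟩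
  obtain ⟨e, -, he⟩ := Finset.mem_image.1 this
  exact ⟨e, he⟩

/-- Two chords do not cross. -/
theorem Conn.not_interlaced {H H' : Finset (Fin S.p)} {g h g' h' : ℕ} (c : S.Conn H g h)
    (c' : S.Conn H' g' h') (h1 : g < g') (h2 : g' < h) (h3 : h' < g ∨ h < h') : False := by
  obtain ⟨s, t, hs, ht, rfl, rfl, hJ⟩ := c
  obtain ⟨s', t', hs', ht', rfl, rfl, hJ'⟩ := c'
  obtain ⟨v, hv, hv'⟩ := exists_mem_of_joinedIn hJ hJ' (fun v h => h.1) (fun v h => h.1)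
    hs ht hs' ht' (arg_lt_of_gap_lt h1) (arg_lt_of_gap_lt h2)
    (h3.imp arg_lt_of_gap_lt arg_lt_of_gap_lt)
  have a := hv.2.1
  have b := hv'.2.1
  simp only [mem_insert_iff, mem_singleton_iff] at a b
  omega

theorem joinedIn_arc (i : Fin S.p) (c : Bool) :
    JoinedIn (S.arc i) (S.ep (i, c)) (S.ep (i, !c)) := by
  have h : JoinedIn (S.arc i) (S.ep (i, false)) (S.ep (i, true)) := by
    refine JoinedIn.ofLine (f := S.σ i) (S.cont i).continuousOn rfl rfl subset_rfl
  cases c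
  · exact h
  · exact h.symm

/-- An arc separated by a chord is met by the chord. -/
theorem Conn.mem_of_separated {H : Finset (Fin S.p)} {g h : ℕ} (c : S.Conn H g h)
    {i : Fin S.p} {b : Bool} (h1 : g < S.idx (i, b)) (h2 : S.idx (i, b) ≤ h)
    (h3 : S.idx (i, !b) ≤ g ∨ h < S.idx (i, !b)) : i ∈ H := by
  obtain ⟨s, t, hs, ht, rfl, rfl, hJ⟩ := c
  suffices ∃ v ∈ S.arc i, v ∈ S.track {S.gap s, S.gap t} H by
    obtain ⟨v, hv, hv'⟩ := this
    exact hv'.2.2 (mem_strands.2 hv)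
  have a1 := arg_lt_of_gap_lt h1
  have a2 := arg_ep_le_iff.2 h2
  rcases a2.eq_or_lt with a2 | a2
  · have := eq_of_arg_eq (norm_ep _) ht a2
    exact ⟨t, this ▸ ep_mem_arc (i, b), hJ.target_mem⟩
  have a3 : (S.ep (i, !b)).arg ≤ s.arg ∨ t.arg < (S.ep (i, !b)).arg :=
    h3.imp arg_ep_le_iff.2 arg_lt_of_gap_lt
  by_cases a4 : (S.ep (i, !b)).arg = s.arg
  · have := eq_of_arg_eq (norm_ep _) hs a4
    exact ⟨s, this ▸ ep_mem_arc (i, !b), hJ.source_mem⟩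
  obtain ⟨v, hv, hv'⟩ := exists_mem_of_joinedIn hJ (joinedIn_arc i b) (fun v h => h.1)
    (fun v h => norm_le_of_mem_arc h) hs ht (norm_ep _) (norm_ep _) a1 a2
    (a3.imp (fun h => lt_of_le_of_ne h a4) id)
  exact ⟨v, hv', hv⟩

end ArcSys

namespace ArcSys

variable {S : ArcSys}

/-! ### An arc interlaced with few others -/

variable (S) in
/-- The endpoints of two arcs separate each other on the circle. -/
def Interlaced (i j : Fin S.p) : Prop :=
  ∃ b c, S.idx (i, b) < S.idx (j, c) ∧ S.idx (j, c) < S.idx (i, !b) ∧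
    (S.idx (j, !c) < S.idx (i, b) ∨ S.idx (i, !b) < S.idx (j, !c))

theorem Interlaced.ne {i j : Fin S.p} (h : S.Interlaced i j) : i ≠ j := by
  rintro rfl
  obtain ⟨b, c, h1, h2, h3⟩ := h
  cases b <;> cases c <;> simp_all

theorem arg_exp_of_mem {θ : ℝ} (h : θ ∈ Ioc (-Real.pi) Real.pi) :
    (Complex.exp (θ * Complex.I)).arg = θ := by
  rw [Complex.arg_exp_mul_I, (toIocMod_eq_self Real.two_pi_pos).2]
  rwa [two_mul, neg_add_cancel_left]

theorem arg_ep_lt_pi (hcut : ∀ e, S.ep e ≠ -1) (e : Fin S.p × Bool) : (S.ep e).arg < Real.pi :=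
  (Complex.mem_slitPlane_iff_arg.1 (mem_slitPlane_of_norm (norm_ep e) (hcut e))).1.lt_of_le
    (Complex.arg_le_pi _)

theorem gap_neg_one : S.gap (-1) = 2 * S.p := by
  classical
  unfold gap
  rw [Finset.filter_true_of_mem fun e _ => by
    rw [Complex.arg_neg_one]; exact Complex.arg_le_pi _]
  simp [mul_comm]

theorem exists_conn_zero {r : ℝ} (hr : S.GoodRadius r) (hp : 0 < S.p) :
    S.Conn (S.strands (-1)) 0 (2 * S.p) := by
  obtain ⟨e, he⟩ := exists_idx_eq (S := S) one_pos (by omega)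
  have hc : Filter.Tendsto (fun φ : ℝ => Complex.exp (φ * Complex.I)) (𝓝 (-Real.pi)) (𝓝 (-1)) := by
    have : Continuous fun φ : ℝ => Complex.exp (φ * Complex.I) := by fun_prop
    have h2 := this.tendsto (-Real.pi)
    simpa [Complex.exp_neg] using h2
  have h1 : ∀ᶠ φ : ℝ in 𝓝[>] (-Real.pi), dist (Complex.exp (φ * Complex.I)) (-1) < 4 * r :=
    (hc.mono_left nhdsWithin_le_nhds).eventually
      (Metric.ball_mem_nhds _ (by linarith [hr.pos]))
  have h2 : ∀ᶠ φ : ℝ in 𝓝[>] (-Real.pi), φ ∈ Ioo (-Real.pi) (S.ep e).arg :=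
    Ioo_mem_nhdsGT (Complex.neg_pi_lt_arg _)
  obtain ⟨φ, h1, h2⟩ := (h1.and h2).exists
  have hn := Complex.norm_exp_ofReal_mul_I φ
  have hcn := hr.conn (z := -1) (w := Complex.exp (φ * Complex.I)) (Or.inr rfl) (by simp) h1 hn
    subset_rfl
  rw [lab_eq_gap (by simp), gap_neg_one] at hcn
  have h0 : S.gap (Complex.exp (φ * Complex.I)) = 0 := by
    by_contra h
    have h3 : S.idx e ≤ S.gap (Complex.exp (φ * Complex.I)) := by omega
    have := arg_ep_le_iff.2 h3
    rw [arg_exp_of_mem ⟨h2.1, h2.2.le.trans (Complex.arg_le_pi _)⟩] at this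
    linarith [h2.2]
  rw [h0] at hcn
  exact hcn.symm

theorem mem_closure_of_gap {r : ℝ} {P : ℕ → Prop} {a b : ℝ} (hab : a < b)
    (h : ∀ θ ∈ Ioo a b, P (S.gap (Complex.exp (θ * Complex.I)))) :
    ∀ θ ∈ Icc a b, Complex.exp (θ * Complex.I) ∈
      closure {w | ‖w‖ ≤ 1 ∧ ∃ l, S.Lab r w l ∧ P l} := by
  intro θ hθ
  rw [← closure_Ioo hab.ne] at hθ
  have hc : Continuous fun φ : ℝ => Complex.exp (φ * Complex.I) := by fun_prop
  refine map_mem_closure (f := fun φ : ℝ => Complex.exp (φ * Complex.I)) hc hθ fun φ hφ => ?_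
  have hn := Complex.norm_exp_ofReal_mul_I φ
  exact ⟨hn.le, _, Or.inl ⟨hn, rfl⟩, h φ hφ⟩

/-- Inside a chord `(g, h)` there is a cluster which splits it into two smaller ones. -/
theorem GoodRadius.exists_split {r : ℝ} (hr : S.GoodRadius r) (hcut : ∀ e, S.ep e ≠ -1) {d : ℕ}
    (hd : ∀ x ∈ S.free, S.depth x ≤ d) {H₀ : Finset (Fin S.p)} {g h : ℕ} (hgh : g + 2 ≤ h)
    (hh : h ≤ 2 * S.p) (c : S.Conn H₀ g h) :
    ∃ (f : ℕ) (H : Finset (Fin S.p)), g < f ∧ f < h ∧ H.card ≤ 6 * d + 4 ∧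
      S.Conn H g f ∧ S.Conn H f h ∧ S.Conn H g h := by
  obtain ⟨e₁, he₁⟩ := exists_idx_eq (S := S) (k := g + 1) (by omega) (by omega)
  obtain ⟨e₂, he₂⟩ := exists_idx_eq (S := S) (k := h) (by omega) (by omega)
  have h12 : (S.ep e₁).arg < (S.ep e₂).arg := arg_lt_of_gap_lt (by
    change S.idx e₁ < S.idx e₂; omega)
  have l1 := Complex.neg_pi_lt_arg (S.ep e₁)
  have l2 := arg_ep_lt_pi hcut e₂
  have key : ∀ θ ∈ Ioc (-Real.pi) Real.pi, ∀ e,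
      (S.ep e).arg ≤ θ ↔ S.idx e ≤ S.gap (Complex.exp (θ * Complex.I)) := by
    intro θ hθ e
    have := arg_ep_le_iff (e := e) (s := Complex.exp (θ * Complex.I))
    rwa [arg_exp_of_mem hθ] at this
  obtain ⟨θ₃, h23, h3, h3'⟩ : ∃ θ₃, (S.ep e₂).arg < θ₃ ∧ θ₃ ≤ Real.pi ∧
      ((θ₃ = Real.pi ∧ h = 2 * S.p) ∨ ∃ e, (S.ep e).arg = θ₃ ∧ S.idx e = h + 1) := by
    by_cases hp : h = 2 * S.p
    · exact ⟨Real.pi, l2, le_rfl, Or.inl ⟨rfl, hp⟩⟩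
    · obtain ⟨e₃, he₃⟩ := exists_idx_eq (S := S) (k := h + 1) (by omega) (by omega)
      refine ⟨_, arg_lt_of_gap_lt (S := S) ?_, Complex.arg_le_pi _, Or.inr ⟨e₃, rfl, he₃⟩⟩
      change S.idx e₂ < S.idx e₃
      omega
  set A : (ℕ → Prop) → Set ℂ := fun P => closure {w | ‖w‖ ≤ 1 ∧ ∃ l, S.Lab r w l ∧ P l} with hA
  obtain ⟨y, hy, y0, y1, y2⟩ := kkm_disc (A₀ := A fun l => g < l ∧ l < h) (A₁ := A fun l => l = h)
    (A₂ := A fun l => l ≤ g ∨ h < l) isClosed_closure isClosed_closure isClosed_closure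
    (fun w hw => by
      obtain ⟨l, hl⟩ := exists_lab (S := S) r w
      rcases lt_trichotomy l h with h1 | h1 | h1
      · rcases le_or_gt l g with h2 | h2
        · exact Or.inr (Or.inr (subset_closure ⟨hw, l, hl, Or.inl h2⟩))
        · exact Or.inl (subset_closure ⟨hw, l, hl, h2, h1⟩)
      · exact Or.inr (Or.inl (subset_closure ⟨hw, l, hl, h1⟩))
      · exact Or.inr (Or.inr (subset_closure ⟨hw, l, hl, Or.inr h1⟩)))
    (θ₁ := (S.ep e₁).arg) (θ₂ := (S.ep e₂).arg) (θ₃ := θ₃) h12.le h23.le (by linarith)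
    (mem_closure_of_gap h12 fun θ hθ => by
      have k := key θ ⟨by linarith [hθ.1], by linarith [hθ.2]⟩
      have k1 := (k e₁).1 hθ.1.le
      have k2 := (not_congr (k e₂)).1 (not_le.2 hθ.2)
      omega)
    (mem_closure_of_gap h23 fun θ hθ => by
      have k := key θ ⟨by linarith [hθ.1], by linarith [hθ.2]⟩
      have k1 := (k e₂).1 hθ.1.le
      rcases h3' with ⟨-, h4⟩ | ⟨e, rfl, h4⟩
      · have := gap_le (S := S) (Complex.exp (θ * Complex.I))
        omega
      · have k2 := (not_congr (k e)).1 (not_le.2 hθ.2)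
        omega)
    (mem_closure_of_gap (by linarith) fun θ hθ => by
      rcases le_or_gt θ Real.pi with h5 | h5
      · have k := key θ ⟨by linarith [hθ.1], h5⟩
        rcases h3' with ⟨h4, -⟩ | ⟨e, rfl, h4⟩
        · linarith [hθ.1]
        · have k2 := (k e).1 hθ.1.le
          omega
      · have k := key (θ - 2 * Real.pi) ⟨by linarith, by linarith [hθ.2, h5, l2, h12]⟩
        have k2 := (not_congr (k e₁)).1 (not_le.2 (by linarith [hθ.2]))
        have h6 : Complex.exp (((θ - 2 * Real.pi : ℝ) : ℂ) * Complex.I)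
            = Complex.exp (θ * Complex.I) := by
          push_cast
          rw [sub_mul, Complex.exp_sub, Complex.exp_two_pi_mul_I, div_one]
        rw [h6] at k2
        omega)
  obtain ⟨C, H, hH, hC, hcl⟩ := hr.exists_cluster hd hy
  have get : ∀ {P : ℕ → Prop}, y ∈ A P → ∃ l ∈ C, P l := by
    intro P hP
    obtain ⟨w, hw, hw1, l, hl, hPl⟩ := mem_closure_iff_nhds.1 hP _ hC
    exact ⟨l, hw hw1 l hl, hPl⟩
  obtain ⟨f, hf, f1, f2⟩ := get y0
  obtain ⟨_, hh', rfl⟩ := get y1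
  obtain ⟨l, hl, hl'⟩ := get y2
  have hlg : l = g := by
    by_contra hne
    exact c.not_interlaced (hcl f hf l hl (by omega)) f1 f2 (by omega)
  subst hlg
  exact ⟨f, H, f1, f2, hH, hcl _ hl _ hf (by omega), hcl _ hf _ hh' (by omega),
    hcl _ hl _ hh' (by omega)⟩

open Classical in
theorem exists_card_interlaced_le (hcut : ∀ e, S.ep e ≠ -1) {d : ℕ}
    (hd : ∀ x ∈ S.free, S.depth x ≤ d) {T : Finset (Fin S.p)} (hT : T.Nonempty) :
    ∃ a ∈ T, (T.filter fun j => S.Interlaced a j).card ≤ 6 * d + 4 := by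
  obtain ⟨r, hr⟩ := exists_goodRadius hcut
  obtain ⟨a₀, ha₀⟩ := hT
  have hp : 0 < S.p := a₀.pos
  have hex : ∃ n g h : ℕ, h = g + n ∧ h ≤ 2 * S.p ∧ (∃ H, S.Conn H g h) ∧
      ∃ a ∈ T, ∀ b, g < S.idx (a, b) ∧ S.idx (a, b) ≤ h :=
    ⟨2 * S.p, 0, 2 * S.p, (zero_add _).symm, le_rfl, ⟨_, exists_conn_zero hr hp⟩, a₀, ha₀,
      fun b => ⟨idx_pos _, gap_le _⟩⟩
  obtain ⟨g, h, hn, hh, ⟨H₀, c₀⟩, a, haT, ha⟩ := Nat.find_spec hex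
  have hmin := fun m (hm : m < Nat.find hex) => Nat.find_min hex hm
  have hgh : g + 2 ≤ h := by
    have h1 := ha true
    have h2 := ha false
    have h3 : S.idx (a, true) ≠ S.idx (a, false) := fun h => by
      simpa using idx_injective h
    omega
  obtain ⟨f, H, f1, f2, hH, c1, c2, c3⟩ := hr.exists_split hcut hd hgh hh c₀
  have hmem : ∀ j ∈ T, ∀ b, g < S.idx (j, b) → S.idx (j, b) ≤ h → j ∈ H := by
    intro j hj b h1 h2
    by_cases h3 : S.idx (j, !b) ≤ g ∨ h < S.idx (j, !b)
    · exact c3.mem_of_separated h1 h2 h3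
    have n1 : ¬ ∀ b, g < S.idx (j, b) ∧ S.idx (j, b) ≤ f := fun h' =>
      hmin (f - g) (by omega) ⟨g, f, by omega, by omega, ⟨_, c1⟩, j, hj, h'⟩
    have n2 : ¬ ∀ b, f < S.idx (j, b) ∧ S.idx (j, b) ≤ h := fun h' =>
      hmin (h - f) (by omega) ⟨f, h, by omega, by omega, ⟨_, c2⟩, j, hj, h'⟩
    have h4 : (S.idx (j, b) ≤ f ∧ f < S.idx (j, !b)) ∨ (f < S.idx (j, b) ∧ S.idx (j, !b) ≤ f) := by
      by_contra h5
      rcases le_or_gt (S.idx (j, b)) f with h6 | h6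
      · refine n1 fun b' => ?_
        rcases Bool.eq_or_eq_not b' b with rfl | rfl <;> omega
      · refine n2 fun b' => ?_
        rcases Bool.eq_or_eq_not b' b with rfl | rfl <;> omega
    rcases h4 with ⟨h5, h6⟩ | ⟨h5, h6⟩
    · exact c1.mem_of_separated h1 h5 (Or.inr h6)
    · exact c1.mem_of_separated (b := !b) (by omega) h6 (Or.inr (by simpa using h5))
  refine ⟨a, haT, (Finset.card_le_card fun j hj => ?_).trans hH⟩
  obtain ⟨hj, b, c, h1, h2, -⟩ := Finset.mem_filter.1 hj
  have := ha b
  have := ha (!b)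
  exact hmem j hj c (by omega) (by omega)

open Classical in
/-- There are few pairs of interlaced arcs. -/
theorem card_interlaced_pairs_le (hcut : ∀ e, S.ep e ≠ -1) {d : ℕ}
    (hd : ∀ x ∈ S.free, S.depth x ≤ d) (hsymm : ∀ i j, S.Interlaced i j → S.Interlaced j i)
    (T : Finset (Fin S.p)) :
    ((T ×ˢ T).filter fun q => q.1 < q.2 ∧ S.Interlaced q.1 q.2).card ≤ (6 * d + 4) * T.card := by
  induction T using Finset.strongInduction with
  | H T ih =>
    rcases T.eq_empty_or_nonempty with rfl | hT
    · simp
    obtain ⟨a, ha, hc⟩ := exists_card_interlaced_le hcut hd hT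
    have h1 := ih (T.erase a) (Finset.erase_ssubset ha)
    have h2 : ((T ×ˢ T).filter fun q => q.1 < q.2 ∧ S.Interlaced q.1 q.2) ⊆
        (((T.erase a) ×ˢ (T.erase a)).filter fun q => q.1 < q.2 ∧ S.Interlaced q.1 q.2) ∪
          (T.filter fun j => S.Interlaced a j).image fun j => (min a j, max a j) := by
      rintro ⟨i, j⟩ hq
      simp only [Finset.mem_filter, Finset.mem_product, Finset.mem_union, Finset.mem_erase,
        Finset.mem_image, Prod.mk.injEq] at hq ⊢
      obtain ⟨⟨hi, hj⟩, hlt, hI⟩ := hq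
      by_cases hia : i = a
      · subst hia
        exact Or.inr ⟨j, ⟨hj, hI⟩, min_eq_left hlt.le, max_eq_right hlt.le⟩
      by_cases hja : j = a
      · subst hja
        exact Or.inr ⟨i, ⟨hi, hsymm _ _ hI⟩, min_eq_right hlt.le, max_eq_left hlt.le⟩
      · exact Or.inl ⟨⟨⟨hia, hi⟩, hja, hj⟩, hlt, hI⟩
    have h3 := Finset.card_le_card h2
    have h4 := Finset.card_union_le
      (((T.erase a) ×ˢ (T.erase a)).filter fun q => q.1 < q.2 ∧ S.Interlaced q.1 q.2)
      ((T.filter fun j => S.Interlaced a j).image fun j => (min a j, max a j))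
    have h5 := Finset.card_image_le (s := T.filter fun j => S.Interlaced a j)
      (f := fun j => (min a j, max a j))
    have h6 := Finset.card_erase_of_mem ha
    have h7 : 0 < T.card := Finset.card_pos.2 ⟨a, ha⟩
    rw [h6] at h1
    obtain ⟨m, hm⟩ : ∃ m, T.card = m + 1 := ⟨T.card - 1, by omega⟩
    rw [hm] at h1 ⊢
    rw [Nat.add_sub_cancel] at h1
    rw [mul_add, mul_one]
    omega

end ArcSys

/-! ### Bent chords -/

/-- The circular arc from `a` to `b` whose bend is measured by `s`; it is a straight segment
when `s = 0`. -/
def bend (a b : ℂ) (s t : ℝ) : ℂ :=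
  ((1 - t) * a + t * (1 + s * Complex.I) * b) / (1 + t * s * Complex.I)

theorem bend_den_ne (s t : ℝ) : (1 + t * s * Complex.I : ℂ) ≠ 0 := by
  intro h
  have := congrArg Complex.re h
  simp at this

theorem bend_zero (a b : ℂ) (s : ℝ) : bend a b s 0 = a := by simp [bend]

theorem bend_one (a b : ℂ) (s : ℝ) : bend a b s 1 = b := by
  have := bend_den_ne s 1
  simp only [Complex.ofReal_one, one_mul] at this
  simp [bend, this]

theorem continuous_bend (a b : ℂ) (s : ℝ) : Continuous (bend a b s) := by
  unfold bend
  exact Continuous.div (by fun_prop) (by fun_prop) (bend_den_ne s)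

theorem bend_sub_left (a b z : ℂ) (s t : ℝ) : (bend a b s t - z) * (1 + t * s * Complex.I) =
    (1 - t) * (a - z) + t * ((1 + s * Complex.I) * (b - z)) := by
  have := bend_den_ne s t
  unfold bend
  field_simp
  ring

theorem bend_cross {a b : ℂ} (hab : a ≠ b) {s s' t t' : ℝ} (h : bend a b s t = bend a b s' t') :
    t * (1 - t') = t' * (1 - t) ∧ t * (1 - t') * s = t' * (1 - t) * s' := by
  unfold bend at h
  rw [div_eq_div_iff (bend_den_ne s t) (bend_den_ne s' t')] at h
  have h1 : (t * (1 - t') * (1 + s * Complex.I) : ℂ) = t' * (1 - t) * (1 + s' * Complex.I) := by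
    have : (b - a) * (t * (1 - t') * (1 + s * Complex.I) - t' * (1 - t) * (1 + s' * Complex.I))
        = 0 := by linear_combination h
    exact sub_eq_zero.1 ((mul_eq_zero.1 this).resolve_left (sub_ne_zero.2 hab.symm))
  have h2 := congrArg Complex.re h1
  have h3 := congrArg Complex.im h1
  simp at h2 h3
  exact ⟨h2, h3⟩

theorem bend_injective {a b : ℂ} (hab : a ≠ b) (s : ℝ) : Function.Injective (bend a b s) := by
  intro t t' h
  have := (bend_cross hab h).1
  linarith

theorem norm_bend_lt {a b : ℂ} (ha : ‖a‖ = 1) (hb : ‖b‖ = 1) {s t : ℝ} (h0 : 0 < t) (h1 : t < 1)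
    (hs : (a * star b).re - 1 + s * (a * star b).im < 0) : ‖bend a b s t‖ < 1 := by
  have hd := bend_den_ne s t
  unfold bend
  rw [norm_div, div_lt_one (norm_pos_iff.2 hd), ← sq_lt_sq₀ (norm_nonneg _) (norm_nonneg _),
    Complex.sq_norm, Complex.sq_norm]
  have ha2 : a.re * a.re + a.im * a.im = 1 := by
    rw [← Complex.normSq_apply, ← Complex.sq_norm, ha, one_pow]
  have hb2 : b.re * b.re + b.im * b.im = 1 := by
    rw [← Complex.normSq_apply, ← Complex.sq_norm, hb, one_pow]
  simp [Complex.normSq_apply] at hs ⊢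
  have key : 0 < t * (1 - t) := mul_pos h0 (by linarith)
  nlinarith [mul_pos key (neg_pos.2 hs), ha2, hb2]

section Quadratic

variable (a b α β : ℂ) (s σ : ℝ)

/-- The constant coefficient of the equation of the intersections of two bent chords. -/
def coefA : ℝ := ((1 - σ * Complex.I) * (a - α) * star (β - a)).im

/-- The middle coefficient of the equation of the intersections of two bent chords. -/
def coefC : ℝ := ((1 - σ * Complex.I) * ((a - α) * star ((1 + s * Complex.I) * (β - b)) +
  (1 + s * Complex.I) * (b - α) * star (β - a))).im

/-- The leading coefficient of the equation of the intersections of two bent chords. -/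
def coefB : ℝ := ((1 - σ * Complex.I) * ((1 + s * Complex.I) * (b - α)) *
  star ((1 + s * Complex.I) * (β - b))).im

variable {a b α β s σ}

theorem quadratic_of_bend_eq {t t' : ℝ} (h : bend a b s t = bend α β σ t') :
    (1 - t) ^ 2 * coefA a α β σ + t * (1 - t) * coefC a b α β s σ +
      t ^ 2 * coefB b α β s σ = 0 := by
  set w := bend a b s t with hw
  have e1 := bend_sub_left a b α s t
  have e2 := bend_sub_left a b β s t
  have e3 := bend_sub_left α β α σ t'
  have e4 := bend_sub_left α β β σ t'
  rw [← hw] at e1 e2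
  rw [← h] at e3 e4
  set D : ℂ := 1 + t * s * Complex.I with hD
  set D' : ℂ := 1 + t' * σ * Complex.I with hD'
  have hD'0 : D' ≠ 0 := bend_den_ne _ _
  have h1 : ((1 - σ * Complex.I) * (w - α) * star (β - w)).im = 0 := by
    have : (1 - σ * Complex.I) * (w - α) * star (β - w) * (D' * star D') =
        (((1 + σ ^ 2) * (t' * (1 - t')) * Complex.normSq (β - α) : ℝ) : ℂ) := by
      have e5 : (β - w) * D' = (1 - t') * (β - α) := by linear_combination -e4
      have e6 : star (β - w) * star D' = (1 - t') * star (β - α) := by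
        rw [mul_comm, ← star_mul, e5, star_mul]; simp [mul_comm]
      have e7 : (w - α) * D' = t' * ((1 + σ * Complex.I) * (β - α)) := by
        rw [e3]; ring
      calc _ = (1 - σ * Complex.I) * ((w - α) * D') * (star (β - w) * star D') := by ring
        _ = (1 - (σ * Complex.I) ^ 2) * (t' * (1 - t')) * ((β - α) * star (β - α)) := by
          rw [e6, e7]; ring
        _ = _ := by
          rw [mul_pow, Complex.I_sq, Complex.star_def, Complex.mul_conj]
          push_cast
          ring
    have h2 : D' * star D' = ((Complex.normSq D' : ℝ) : ℂ) := by
      rw [Complex.star_def, Complex.mul_conj]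
    rw [h2] at this
    have h3 := congrArg Complex.im this
    rw [Complex.im_mul_ofReal, Complex.ofReal_im] at h3
    exact (mul_eq_zero.1 h3).resolve_right (Complex.normSq_pos.2 hD'0).ne'
  have h4 : ((1 - σ * Complex.I) * (w - α) * star (β - w) * (D * star D)).im = 0 := by
    rw [show D * star D = ((Complex.normSq D : ℝ) : ℂ) by rw [Complex.star_def, Complex.mul_conj],
      Complex.im_mul_ofReal, h1, zero_mul]
  have e8 : (β - w) * D = (1 - t) * (β - a) + t * ((1 + s * Complex.I) * (β - b)) := by
    linear_combination -e2
  have e9 : star (β - w) * star D =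
      (1 - t) * star (β - a) + t * star ((1 + s * Complex.I) * (β - b)) := by
    rw [mul_comm, ← star_mul, e8]; simp
  have h5 : (1 - σ * Complex.I) * (w - α) * star (β - w) * (D * star D) =
      (((1 - t) ^ 2 : ℝ) : ℂ) * ((1 - σ * Complex.I) * (a - α) * star (β - a)) +
      ((t * (1 - t) : ℝ) : ℂ) * ((1 - σ * Complex.I) *
        ((a - α) * star ((1 + s * Complex.I) * (β - b)) +
        (1 + s * Complex.I) * (b - α) * star (β - a))) +
      ((t ^ 2 : ℝ) : ℂ) * ((1 - σ * Complex.I) * ((1 + s * Complex.I) * (b - α)) *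
        star ((1 + s * Complex.I) * (β - b))) := by
    calc _ = (1 - σ * Complex.I) * ((w - α) * D) * (star (β - w) * star D) := by ring
      _ = _ := by
        rw [e1, e9]; push_cast; ring
  rw [h5] at h4
  simpa only [coefA, coefB, coefC, Complex.add_im, Complex.re_ofReal_mul, Complex.im_ofReal_mul]
    using h4

end Quadratic

theorem quadratic_unique {A B C t t' : ℝ} (hAB : A * B < 0) (ht : t ∈ Icc (0 : ℝ) 1)
    (ht' : t' ∈ Icc (0 : ℝ) 1) (h : (1 - t) ^ 2 * A + t * (1 - t) * C + t ^ 2 * B = 0)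
    (h' : (1 - t') ^ 2 * A + t' * (1 - t') * C + t' ^ 2 * B = 0) : t = t' := by
  have mem : ∀ {u : ℝ}, u ∈ Icc (0 : ℝ) 1 → (1 - u) ^ 2 * A + u * (1 - u) * C + u ^ 2 * B = 0 →
      0 < u ∧ 0 < 1 - u := by
    intro u hu h
    have hA : A ≠ 0 := fun h => by simp [h] at hAB
    have hB : B ≠ 0 := fun h => by simp [h] at hAB
    constructor
    · refine lt_of_le_of_ne hu.1 fun h0 => hA ?_
      subst h0; simpa using h
    · refine lt_of_le_of_ne (by linarith [hu.2]) fun h0 => hB ?_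
      have : u = 1 := by linarith
      subst this; simpa using h
  obtain ⟨p1, p2⟩ := mem ht h
  obtain ⟨q1, q2⟩ := mem ht' h'
  have key : (t' - t) * (A * ((1 - t) * (1 - t')) - B * (t * t')) = 0 := by
    linear_combination t' * (1 - t') * h - t * (1 - t) * h'
  refine (sub_eq_zero.1 ((mul_eq_zero.1 key).resolve_right fun h0 => ?_)).symm
  have r1 : 0 < (1 - t) * (1 - t') := mul_pos p2 q2
  have r2 : 0 < t * t' := mul_pos p1 q1
  have h2 : A * B * ((1 - t) * (1 - t')) = B ^ 2 * (t * t') := by linear_combination B * h0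
  nlinarith [mul_pos (neg_pos.2 hAB) r1, mul_nonneg (sq_nonneg B) r2.le]

theorem quadratic_ne_zero {A B C t : ℝ} (hAB : 0 < A * B) (hAC : 0 < A * C)
    (ht : t ∈ Icc (0 : ℝ) 1) : (1 - t) ^ 2 * A + t * (1 - t) * C + t ^ 2 * B ≠ 0 := by
  intro h
  have h1 : (1 - t) ^ 2 * A ^ 2 + t * (1 - t) * (A * C) + t ^ 2 * (A * B) = 0 := by
    linear_combination A * h
  have hA : 0 < A ^ 2 := by
    have : A ≠ 0 := fun h => by simp [h] at hAB
    positivity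
  have h2 : 0 ≤ t * (1 - t) * (A * C) := by
    have := ht.1
    have : 0 ≤ 1 - t := by linarith [ht.2]
    positivity
  rcases ht.1.eq_or_lt with h0 | h0
  · rw [← h0] at h1; nlinarith
  · have h3 : 0 < t ^ 2 * (A * B) := by positivity
    have h4 : 0 ≤ (1 - t) ^ 2 * A ^ 2 := by positivity
    linarith

/-- The intersections of two bent chords. -/
def bendInter (a b α β : ℂ) (s σ : ℝ) : Set ℂ :=
  bend a b s '' Icc 0 1 ∩ bend α β σ '' Icc 0 1

/-- Slightly bent chords meet at most once, and do not meet if their endpoints are not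
interlaced. -/
theorem eventually_bendInter {a b α β : ℂ} (h0 : coefA a α β 0 * coefB b α β 0 0 ≠ 0) :
    ∀ᶠ q : ℝ × ℝ in 𝓝 0, (bendInter a b α β q.1 q.2).Subsingleton ∧
      (0 < coefA a α β 0 * coefB b α β 0 0 → bendInter a b α β q.1 q.2 = ∅) := by
  have cA : Continuous fun q : ℝ × ℝ => coefA a α β q.2 := by
    unfold coefA
    exact Complex.continuous_im.comp (by fun_prop)
  have cB : Continuous fun q : ℝ × ℝ => coefB b α β q.1 q.2 := by
    unfold coefB
    exact Complex.continuous_im.comp (by fun_prop)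
  have cC : Continuous fun q : ℝ × ℝ => coefC a b α β q.1 q.2 := by
    unfold coefC
    exact Complex.continuous_im.comp (by fun_prop)
  have hsum : coefC a b α β 0 0 = coefA a α β 0 + coefB b α β 0 0 := by
    simp [coefA, coefB, coefC]
    ring
  rcases lt_or_gt_of_ne h0 with h | h
  · have : ∀ᶠ q : ℝ × ℝ in 𝓝 0, coefA a α β q.2 * coefB b α β q.1 q.2 < 0 :=
      ((cA.mul cB).tendsto 0).eventually_lt_const (by
        simpa only [Pi.mul_apply, Prod.fst_zero, Prod.snd_zero])
    filter_upwards [this] with q hq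
    refine ⟨?_, fun h' => absurd h' h.not_gt⟩
    rintro w ⟨⟨t, ht, rfl⟩, ⟨u, -, hu⟩⟩ w' ⟨⟨t', ht', rfl⟩, ⟨u', -, hu'⟩⟩
    rw [quadratic_unique hq ht ht' (quadratic_of_bend_eq hu.symm) (quadratic_of_bend_eq hu'.symm)]
  · have hC0 : 0 < coefA a α β 0 * coefC a b α β 0 0 := by
      rw [hsum, mul_add]
      exact add_pos_of_nonneg_of_pos (mul_self_nonneg _) h
    have h1 : ∀ᶠ q : ℝ × ℝ in 𝓝 0, 0 < coefA a α β q.2 * coefB b α β q.1 q.2 :=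
      ((cA.mul cB).tendsto 0).eventually_const_lt (by
        simpa only [Pi.mul_apply, Prod.fst_zero, Prod.snd_zero])
    have h2 : ∀ᶠ q : ℝ × ℝ in 𝓝 0, 0 < coefA a α β q.2 * coefC a b α β q.1 q.2 :=
      ((cA.mul cC).tendsto 0).eventually_const_lt (by
        simpa only [Pi.mul_apply, Prod.fst_zero, Prod.snd_zero])
    filter_upwards [h1, h2] with q hq hq'
    have : bendInter a b α β q.1 q.2 = ∅ := by
      rw [eq_empty_iff_forall_notMem]
      rintro w ⟨⟨t, ht, rfl⟩, ⟨u, -, hu⟩⟩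
      exact quadratic_ne_zero hq hq' ht (quadratic_of_bend_eq hu.symm)
    rw [this]
    exact ⟨subsingleton_empty, fun _ => rfl⟩

theorem exists_sin_half_eq {x : ℝ} (h1 : -(2 * Real.pi) < x) (h2 : x < 2 * Real.pi) :
    ∃ c > 0, Real.sin (x / 2) = c * x := by
  rcases lt_trichotomy x 0 with h | rfl | h
  · refine ⟨Real.sin (x / 2) / x, div_pos_of_neg_of_neg ?_ h, (div_mul_cancel₀ _ h.ne).symm⟩
    exact Real.sin_neg_of_neg_of_neg_pi_lt (by linarith) (by linarith)
  · exact ⟨1, one_pos, by simp⟩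
  · refine ⟨Real.sin (x / 2) / x, div_pos ?_ h, (div_mul_cancel₀ _ h.ne').symm⟩
    exact Real.sin_pos_of_pos_of_lt_pi (by linarith) (by linarith)

/-- The sign of the orientation of three points of the circle, in terms of their arguments. -/
theorem exists_coefA_eq {a α β : ℂ} (ha : ‖a‖ = 1) (hα : ‖α‖ = 1) (hβ : ‖β‖ = 1) :
    ∃ c > 0, coefA a α β 0 = c * ((a.arg - β.arg) * (a.arg - α.arg) * (β.arg - α.arg)) := by
  have key : ∀ u v : ℝ, Real.sin (2 * u) + Real.sin (2 * v) - Real.sin (2 * (u + v)) =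
      4 * Real.sin u * Real.sin v * Real.sin (u + v) := by
    intro u v
    rw [Real.sin_two_mul, Real.sin_two_mul, Real.sin_two_mul, Real.sin_add, Real.cos_add]
    linear_combination (-2 * Real.sin v * Real.cos v) * Real.sin_sq_add_cos_sq u +
      (-2 * Real.sin u * Real.cos u) * Real.sin_sq_add_cos_sq v
  have rep : ∀ z : ℂ, ‖z‖ = 1 → z.re = Real.cos z.arg ∧ z.im = Real.sin z.arg := by
    intro z hz
    have h := ArcSys.exp_arg_mul_I hz
    constructor
    · conv_lhs => rw [← h]
      rw [Complex.exp_ofReal_mul_I_re]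
    · conv_lhs => rw [← h]
      rw [Complex.exp_ofReal_mul_I_im]
  obtain ⟨a1, a2⟩ := rep a ha
  obtain ⟨b1, b2⟩ := rep β hβ
  obtain ⟨c1, c2⟩ := rep α hα
  have bd : ∀ z w : ℂ, -(2 * Real.pi) < z.arg - w.arg ∧ z.arg - w.arg < 2 * Real.pi := by
    intro z w
    have := Complex.neg_pi_lt_arg z
    have := Complex.neg_pi_lt_arg w
    have := Complex.arg_le_pi z
    have := Complex.arg_le_pi w
    constructor <;> linarith
  obtain ⟨k1, hk1, e1⟩ := exists_sin_half_eq (bd a β).1 (bd a β).2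
  obtain ⟨k2, hk2, e2⟩ := exists_sin_half_eq (bd a α).1 (bd a α).2
  obtain ⟨k3, hk3, e3⟩ := exists_sin_half_eq (bd β α).1 (bd β α).2
  refine ⟨4 * k1 * k2 * k3, by positivity, ?_⟩
  have h := key ((a.arg - β.arg) / 2) ((β.arg - α.arg) / 2)
  rw [show (a.arg - β.arg) / 2 + (β.arg - α.arg) / 2 = (a.arg - α.arg) / 2 by ring, e1, e2, e3,
    show 2 * ((a.arg - β.arg) / 2) = a.arg - β.arg by ring,
    show 2 * ((β.arg - α.arg) / 2) = β.arg - α.arg by ring,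
    show 2 * ((a.arg - α.arg) / 2) = a.arg - α.arg by ring,
    Real.sin_sub, Real.sin_sub, Real.sin_sub, ← a1, ← a2, ← b1, ← b2, ← c1, ← c2] at h
  simp [coefA]
  linear_combination h

/-- The signs of the coefficients tell whether the endpoints are interlaced. -/
theorem exists_coefA_mul_coefB_eq {a b α β : ℂ} (ha : ‖a‖ = 1) (hb : ‖b‖ = 1) (hα : ‖α‖ = 1)
    (hβ : ‖β‖ = 1) : ∃ c > 0, coefA a α β 0 * coefB b α β 0 0 =
      c * (((a.arg - β.arg) * (a.arg - α.arg)) * ((b.arg - β.arg) * (b.arg - α.arg)) *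
        (β.arg - α.arg) ^ 2) := by
  obtain ⟨c, hc, e⟩ := exists_coefA_eq ha hα hβ
  obtain ⟨c', hc', e'⟩ := exists_coefA_eq hb hα hβ
  refine ⟨c * c', mul_pos hc hc', ?_⟩
  have : coefB b α β 0 0 = coefA b α β 0 := by simp [coefA, coefB]
  rw [this, e, e']
  ring

theorem coefA_mul_coefB_ne_zero {a b α β : ℂ} (ha : ‖a‖ = 1) (hb : ‖b‖ = 1) (hα : ‖α‖ = 1)
    (hβ : ‖β‖ = 1) (haα : a ≠ α) (haβ : a ≠ β) (hbα : b ≠ α) (hbβ : b ≠ β) (hαβ : α ≠ β) :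
    coefA a α β 0 * coefB b α β 0 0 ≠ 0 := by
  obtain ⟨c, hc, e⟩ := exists_coefA_mul_coefB_eq ha hb hα hβ
  have arg_ne : ∀ {z w : ℂ}, ‖z‖ = 1 → ‖w‖ = 1 → z ≠ w → z.arg - w.arg ≠ 0 :=
    fun hz hw h h' => h (ArcSys.eq_of_arg_eq hz hw (sub_eq_zero.1 h'))
  rw [e]
  exact mul_ne_zero hc.ne' (mul_ne_zero (mul_ne_zero
    (mul_ne_zero (arg_ne ha hβ haβ) (arg_ne ha hα haα))
    (mul_ne_zero (arg_ne hb hβ hbβ) (arg_ne hb hα hbα)))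
    (pow_ne_zero 2 (arg_ne hβ hα hαβ.symm)))

section Family

variable {ι : Type*} [Fintype ι] {a b : ι → ℂ}

theorem eventually_norm_bend_lt {a b : ℂ} (ha : ‖a‖ = 1) (hb : ‖b‖ = 1) (hab : a ≠ b) :
    ∀ᶠ s in 𝓝 (0 : ℝ), ∀ t, 0 < t → t < 1 → ‖bend a b s t‖ < 1 := by
  have h : (a * star b).re < 1 := by
    have h1 : 0 < Complex.normSq (a - b) := Complex.normSq_pos.2 (sub_ne_zero.2 hab)
    have ha2 : a.re * a.re + a.im * a.im = 1 := by
      rw [← Complex.normSq_apply, ← Complex.sq_norm, ha, one_pow]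
    have hb2 : b.re * b.re + b.im * b.im = 1 := by
      rw [← Complex.normSq_apply, ← Complex.sq_norm, hb, one_pow]
    simp [Complex.normSq_apply] at h1 ⊢
    nlinarith
  have hc : Continuous fun s : ℝ => (a * star b).re - 1 + s * (a * star b).im := by fun_prop
  have := (hc.tendsto 0).eventually_lt_const (show _ < (0 : ℝ) by simp only [zero_mul]; linarith)
  filter_upwards [this] with s hs t h0 h1
  exact norm_bend_lt ha hb h0 h1 hs

theorem eq_endpoint_of_norm_bend {a b : ℂ} {s t : ℝ}
    (h : ∀ t, 0 < t → t < 1 → ‖bend a b s t‖ < 1) (ht : t ∈ Icc (0 : ℝ) 1)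
    (h1 : ‖bend a b s t‖ = 1) : t = 0 ∨ t = 1 := by
  by_contra! hne
  exact (h t (lt_of_le_of_ne ht.1 hne.1.symm) (lt_of_le_of_ne ht.2 hne.2)).ne h1

open Classical in
theorem exists_bends_of_finset (ha : ∀ i, ‖a i‖ = 1) (hb : ∀ i, ‖b i‖ = 1)
    (hab : ∀ i j, a i ≠ b j) (haa : ∀ i j, i ≠ j → a i ≠ a j) (hbb : ∀ i j, i ≠ j → b i ≠ b j)
    {ε : ℝ} (hε0 : 0 < ε) (f1 : ∀ s σ : ℝ, |s| < ε → |σ| < ε → ∀ i j, i ≠ j →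
      (bendInter (a i) (b i) (a j) (b j) s σ).Subsingleton)
    (f2 : ∀ s : ℝ, |s| < ε → ∀ i, ∀ t, 0 < t → t < 1 → ‖bend (a i) (b i) s t‖ < 1)
    (T : Finset ι) : ∃ s : ι → ℝ, (∀ i, |s i| < ε) ∧
      ∀ i ∈ T, ∀ j ∈ T, ∀ k ∈ T, i ≠ j → j ≠ k → i ≠ k →
        ∀ w, w ∈ bend (a i) (b i) (s i) '' Icc 0 1 → w ∈ bend (a j) (b j) (s j) '' Icc 0 1 →
          w ∉ bend (a k) (b k) (s k) '' Icc 0 1 := by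
  induction T using Finset.induction_on with
  | empty => exact ⟨0, fun _ => by simpa using hε0, by simp⟩
  | insert m T hm ih =>
    obtain ⟨s, hs, hT⟩ := ih
    set bad : ι × ι → Set ℝ := fun q => {x | |x| < ε ∧ q.1 ≠ q.2 ∧ q.1 ≠ m ∧
      ∃ w ∈ bendInter (a q.1) (b q.1) (a q.2) (b q.2) (s q.1) (s q.2),
        w ∈ bend (a m) (b m) x '' Icc 0 1} with hbad
    have hsub : ∀ q, (bad q).Subsingleton := by
      rintro ⟨i, j⟩ x ⟨hx, hij, him, w, hw, t, ht, hwt⟩ x' ⟨hx', -, -, w', hw', t', ht', hwt'⟩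
      dsimp only at *
      have hww : w = w' := f1 _ _ (hs i) (hs j) i j hij hw hw'
      subst hww
      have hend : w ≠ a m ∧ w ≠ b m := by
        obtain ⟨⟨u, hu, hwu⟩, -⟩ := hw
        have hcase : ‖w‖ = 1 → w = a i ∨ w = b i := by
          intro h1
          rw [← hwu] at h1 ⊢
          rcases eq_endpoint_of_norm_bend (f2 _ (hs i) i) hu h1 with rfl | rfl
          · exact Or.inl (bend_zero _ _ _)
          · exact Or.inr (bend_one _ _ _)
        constructor
        · intro h
          rcases hcase (h ▸ ha m) with h' | h'
          · exact haa i m him (h'.symm.trans h)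
          · exact hab m i (h.symm.trans h')
        · intro h
          rcases hcase (h ▸ hb m) with h' | h'
          · exact hab i m (h'.symm.trans h)
          · exact hbb i m him (h'.symm.trans h)
      have h0 : t ≠ 0 := by
        rintro rfl
        exact hend.1 (hwt.symm.trans (bend_zero _ _ _))
      have h1 : t ≠ 1 := by
        rintro rfl
        exact hend.2 (hwt.symm.trans (bend_one _ _ _))
      obtain ⟨c1, c2⟩ := bend_cross (hab m m) (hwt.trans hwt'.symm)
      have htt : t = t' := by linarith
      subst htt
      exact mul_left_cancel₀ (mul_ne_zero h0 (sub_ne_zero.2 h1.symm)) c2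
    have hfin : (⋃ q, bad q).Finite := finite_iUnion fun q => (hsub q).finite
    obtain ⟨x, hx, hxb⟩ := ((Ioo_infinite (show -ε < ε by linarith)).sdiff hfin).nonempty
    have hxε : |x| < ε := abs_lt.2 hx
    have hxb' : ∀ i ∈ T, ∀ j ∈ T, i ≠ j → ∀ w, w ∈ bend (a i) (b i) (s i) '' Icc 0 1 →
        w ∈ bend (a j) (b j) (s j) '' Icc 0 1 → w ∉ bend (a m) (b m) x '' Icc 0 1 := by
      intro i hi j hj hij w hwi hwj hw
      refine hxb (mem_iUnion.2 ⟨(i, j), hxε, hij, ?_, w, ⟨hwi, hwj⟩, hw⟩)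
      rintro rfl
      exact hm hi
    have upd : ∀ i ∈ T, Function.update s m x i = s i := fun i hi =>
      Function.update_of_ne (fun h : i = m => hm (h ▸ hi)) _ _
    refine ⟨Function.update s m x, fun i => ?_, ?_⟩
    · by_cases h : i = m
      · subst h; simpa using hxε
      · simpa [h] using hs i
    · intro i hi j hj k hk hij hjk hik w hwi hwj hwk
      rcases Finset.mem_insert.1 hi with hi' | hi'
      · subst hi'
        have hj' := Finset.mem_of_mem_insert_of_ne hj hij.symm
        have hk' := Finset.mem_of_mem_insert_of_ne hk hik.symm
        rw [upd j hj'] at hwj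
        rw [upd k hk'] at hwk
        rw [Function.update_self] at hwi
        exact hxb' j hj' k hk' hjk w hwj hwk hwi
      rw [upd i hi'] at hwi
      rcases Finset.mem_insert.1 hj with hj' | hj'
      · subst hj'
        have hk' := Finset.mem_of_mem_insert_of_ne hk hjk.symm
        rw [upd k hk'] at hwk
        rw [Function.update_self] at hwj
        exact hxb' i hi' k hk' hik w hwi hwk hwj
      rw [upd j hj'] at hwj
      rcases Finset.mem_insert.1 hk with hk' | hk'
      · subst hk'
        rw [Function.update_self] at hwk
        exact hxb' i hi' j hj' hij w hwi hwj hwk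
      · rw [upd k hk'] at hwk
        exact hT i hi' j hj' k hk' hij hjk hik w hwi hwj hwk

/-- Chords with distinct endpoints can be bent slightly so that no three of them concur. -/
theorem exists_bends (ha : ∀ i, ‖a i‖ = 1) (hb : ∀ i, ‖b i‖ = 1) (hab : ∀ i j, a i ≠ b j)
    (haa : ∀ i j, i ≠ j → a i ≠ a j) (hbb : ∀ i j, i ≠ j → b i ≠ b j)  :
    ∃ s : ι → ℝ, (∀ i t, 0 < t → t < 1 → ‖bend (a i) (b i) (s i) t‖ < 1) ∧
      (∀ i j, i ≠ j → (bendInter (a i) (b i) (a j) (b j) (s i) (s j)).Subsingleton ∧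
        (0 < coefA (a i) (a j) (b j) 0 * coefB (b i) (a j) (b j) 0 0 →
          bendInter (a i) (b i) (a j) (b j) (s i) (s j) = ∅)) ∧
      ∀ i j k, i ≠ j → j ≠ k → i ≠ k → ∀ w ∈ bendInter (a i) (b i) (a j) (b j) (s i) (s j),
        w ∉ bend (a k) (b k) (s k) '' Icc 0 1 := by
  classical
  have e1 : ∀ᶠ q : ℝ × ℝ in 𝓝 0, ∀ i j, i ≠ j →
      (bendInter (a i) (b i) (a j) (b j) q.1 q.2).Subsingleton ∧
        (0 < coefA (a i) (a j) (b j) 0 * coefB (b i) (a j) (b j) 0 0 →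
          bendInter (a i) (b i) (a j) (b j) q.1 q.2 = ∅) := by
    rw [Filter.eventually_all]; intro i
    rw [Filter.eventually_all]; intro j
    by_cases hij : i = j
    · simp [hij]
    · filter_upwards [eventually_bendInter (coefA_mul_coefB_ne_zero (ha i) (hb i) (ha j) (hb j)
        (haa i j hij) (hab i j) (hab j i).symm (hbb i j hij) (hab j j))] with q hq _ using hq
  have e2 : ∀ᶠ s in 𝓝 (0 : ℝ), ∀ i, ∀ t, 0 < t → t < 1 → ‖bend (a i) (b i) s t‖ < 1 := by
    rw [Filter.eventually_all]
    exact fun i => eventually_norm_bend_lt (ha i) (hb i) (hab i i)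
  obtain ⟨ε₁, hε₁, e1⟩ := Metric.eventually_nhds_iff.1 e1
  obtain ⟨ε₂, hε₂, e2⟩ := Metric.eventually_nhds_iff.1 e2
  set ε := min ε₁ ε₂ with hε
  have hε0 : 0 < ε := lt_min hε₁ hε₂
  have f1 : ∀ s σ : ℝ, |s| < ε → |σ| < ε → ∀ i j, i ≠ j →
      (bendInter (a i) (b i) (a j) (b j) s σ).Subsingleton ∧
        (0 < coefA (a i) (a j) (b j) 0 * coefB (b i) (a j) (b j) 0 0 →
          bendInter (a i) (b i) (a j) (b j) s σ = ∅) := fun s σ hs hσ =>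
    e1 (y := (s, σ)) (by
      rw [Prod.dist_eq]
      simp only [Prod.fst_zero, Prod.snd_zero, Real.dist_eq, sub_zero]
      exact max_lt (hs.trans_le (min_le_left _ _)) (hσ.trans_le (min_le_left _ _)))
  have f2 : ∀ s : ℝ, |s| < ε → ∀ i, ∀ t, 0 < t → t < 1 → ‖bend (a i) (b i) s t‖ < 1 :=
    fun s hs => e2 (by rw [Real.dist_eq, sub_zero]; exact hs.trans_le (min_le_right _ _))
  obtain ⟨s, hs, hT⟩ := exists_bends_of_finset ha hb hab haa hbb hε0
    (fun s σ hs hσ i j hij => (f1 s σ hs hσ i j hij).1) f2 Finset.univ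
  exact ⟨s, fun i => f2 _ (hs i) i, fun i j hij => f1 (s i) (s j) (hs i) (hs j) i j hij,
    fun i j k hij hjk hik w hw =>
    hT i (Finset.mem_univ _) j (Finset.mem_univ _) k (Finset.mem_univ _) hij hjk hik w hw.1 hw.2⟩

end Family

namespace ArcSys

variable {S : ArcSys}

theorem idx_lt_iff {e e' : Fin S.p × Bool} : S.idx e < S.idx e' ↔ (S.ep e).arg < (S.ep e').arg := by
  rw [← not_le, ← not_le]
  exact not_congr arg_ep_le_iff.symm

theorem Interlaced.symm {i j : Fin S.p} (h : S.Interlaced i j) : S.Interlaced j i := by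
  obtain ⟨b, c, h1, h2, h3⟩ := h
  rcases h3 with h3 | h3
  · exact ⟨!c, b, h3, by simpa using h1, by simpa using Or.inr h2⟩
  · exact ⟨c, !b, h2, h3, by simpa using Or.inl h1⟩

theorem interlaced_of_coef_neg {i j : Fin S.p}
    (h : coefA (S.ep (i, false)) (S.ep (j, false)) (S.ep (j, true)) 0 *
      coefB (S.ep (i, true)) (S.ep (j, false)) (S.ep (j, true)) 0 0 < 0) : S.Interlaced i j := by
  obtain ⟨c, hc, e⟩ := exists_coefA_mul_coefB_eq (norm_ep (S := S) (i, false))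
    (norm_ep (S := S) (i, true)) (norm_ep (S := S) (j, false)) (norm_ep (S := S) (j, true))
  rw [e] at h
  have h1 := (pos_iff_neg_of_mul_neg h).1 hc
  have h2 := neg_of_mul_neg_left h1 (sq_nonneg _)
  refine Interlaced.symm ?_
  unfold Interlaced
  simp only [idx_lt_iff, Bool.exists_bool, Bool.not_false, Bool.not_true]
  simp only [mul_neg_iff, mul_pos_iff, sub_pos, sub_neg] at h2
  tauto

end ArcSys

namespace ArcFamily

/-- A crossing of a family of arcs lies on two different arcs. -/
theorem exists_of_mem_crossings {A : ArcFamily} {x : Plane} (hx : x ∈ A.crossings) :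
    ∃ i j s t, i < j ∧ A.arcs i s = x ∧ A.arcs j t = x := by
  have hx' : 1 < (A.params x).ncard := by
    rw [← Nat.card_coe_set_eq]; exact hx
  have hfin : (A.params x).Finite := finite_of_ncard_pos (by omega)
  obtain ⟨⟨i, s⟩, ⟨j, t⟩, h1, h2, hne⟩ := (one_lt_ncard_iff hfin).1 hx'
  have e1 : A.arcs i s = x := h1
  have e2 : A.arcs j t = x := h2
  rcases lt_trichotomy i j with h | h | h
  · exact ⟨i, j, s, t, h, e1, e2⟩
  · subst h
    exact absurd (by rw [A.arc_inj i (e1.trans e2.symm)]) hne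
  · exact ⟨j, i, t, s, h, e2, e1⟩

/-- The family of bent chords with prescribed endpoints. -/
def bent (Φ : Plane ≃ₗᵢ[ℝ] ℂ) {p : ℕ} {a b : Fin p → ℂ} {s : Fin p → ℝ} (ha : ∀ i, ‖a i‖ = 1)
    (hb : ∀ i, ‖b i‖ = 1) (hab : ∀ i, a i ≠ b i)
    (hs : ∀ i t, 0 < t → t < 1 → ‖bend (a i) (b i) (s i) t‖ < 1) : ArcFamily where
  p := p
  arcs i := ⟨fun t => Φ.symm (bend (a i) (b i) (s i) t),
    Φ.symm.continuous.comp ((continuous_bend _ _ _).comp continuous_subtype_val)⟩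
  arc_inj i t t' h := Subtype.ext (bend_injective (hab i) (s i) (Φ.symm.injective h))
  endpoint₀ i := by simp [bend_zero, ha]
  endpoint₁ i := by simp [bend_one, hb]
  interior_lt i t h0 h1 := by
    simpa using hs i t (unitInterval.pos_iff_ne_zero.2 h0) (unitInterval.lt_one_iff_ne_one.2 h1)
  mem_disk i t := by
    rcases eq_or_ne t 0 with rfl | h0
    · simp [bend_zero, ha]
    rcases eq_or_ne t 1 with rfl | h1
    · simp [bend_one, hb]
    simpa using
      (hs i t (unitInterval.pos_iff_ne_zero.2 h0) (unitInterval.lt_one_iff_ne_one.2 h1)).le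

section

variable {Φ : Plane ≃ₗᵢ[ℝ] ℂ} {p : ℕ} {a b : Fin p → ℂ} {s : Fin p → ℝ} {ha : ∀ i, ‖a i‖ = 1}
    {hb : ∀ i, ‖b i‖ = 1} {hab : ∀ i, a i ≠ b i}
    {hs : ∀ i t, 0 < t → t < 1 → ‖bend (a i) (b i) (s i) t‖ < 1}

theorem mem_params_bent {x : Plane} {q : Fin p × unitInterval} :
    q ∈ (bent Φ ha hb hab hs).params x ↔ bend (a q.1) (b q.1) (s q.1) q.2 = Φ x :=
  Φ.symm_apply_eq

theorem finite_params_bent (x : Plane) : ((bent Φ ha hb hab hs).params x).Finite := by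
  refine Finite.of_injOn (f := Prod.fst) (t := univ) (fun _ _ => mem_univ _) ?_ finite_univ
  rintro ⟨i, t⟩ h ⟨j, t'⟩ h' (rfl : i = j)
  have e1 := mem_params_bent.1 h
  have e2 := mem_params_bent.1 h'
  exact Prod.ext rfl (Subtype.ext (bend_injective (hab i) (s i) (e1.trans e2.symm)))

theorem ncard_bend_eq_le {p : ℕ} {a b : Fin p → ℂ} {s : Fin p → ℝ} (hab : ∀ i, a i ≠ b i)
    (hT : ∀ i j k, i ≠ j → j ≠ k → i ≠ k →
      ∀ w ∈ bendInter (a i) (b i) (a j) (b j) (s i) (s j),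
        w ∉ bend (a k) (b k) (s k) '' Icc 0 1) (w : ℂ) :
    {q : Fin p × unitInterval | bend (a q.1) (b q.1) (s q.1) q.2 = w}.ncard ≤ 2 := by
  by_contra! h
  obtain ⟨⟨i, r⟩, ⟨j, t⟩, ⟨k, u⟩, h1, h2, h3, h12, h13, h23⟩ :=
    (two_lt_ncard_iff (finite_of_ncard_pos (by omega))).1 h
  have key : ∀ (i j : Fin p) (r t : unitInterval), bend (a i) (b i) (s i) r = w →
      bend (a j) (b j) (s j) t = w → (i, r) ≠ (j, t) → i ≠ j := by
    rintro i j r t h h' hne rfl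
    exact hne (Prod.ext rfl (Subtype.ext (bend_injective (hab i) (s i) (h.trans h'.symm))))
  exact hT i j k (key i j r t h1 h2 h12) (key j k t u h2 h3 h23) (key i k r u h1 h3 h13) w
    ⟨⟨r, r.2, h1⟩, ⟨t, t.2, h2⟩⟩ ⟨u, u.2, h3⟩

theorem card_params_bent_le (hT : ∀ i j k, i ≠ j → j ≠ k → i ≠ k →
      ∀ w ∈ bendInter (a i) (b i) (a j) (b j) (s i) (s j),
        w ∉ bend (a k) (b k) (s k) '' Icc 0 1) (x : Plane) :
    Nat.card ((bent Φ ha hb hab hs).params x) ≤ 2 := by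
  have h : (bent Φ ha hb hab hs).params x =
      {q : Fin p × unitInterval | bend (a q.1) (b q.1) (s q.1) q.2 = Φ x} :=
    Set.ext fun q => mem_params_bent
  rw [Nat.card_coe_set_eq, h]
  exact ncard_bend_eq_le hab hT _

theorem exists_of_mem_crossings_bent {x : Plane} (hx : x ∈ (bent Φ ha hb hab hs).crossings) :
    ∃ q : Fin p × Fin p, q.1 < q.2 ∧
      Φ x ∈ bendInter (a q.1) (b q.1) (a q.2) (b q.2) (s q.1) (s q.2) := by
  obtain ⟨i, j, r, t, hij, h1, h2⟩ := exists_of_mem_crossings hx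
  exact ⟨(i, j), hij, ⟨r, r.2, Φ.symm_apply_eq.1 h1⟩, ⟨t, t.2, Φ.symm_apply_eq.1 h2⟩⟩

theorem crossings_bent_le (P : Finset (Fin p × Fin p))
    (hsub : ∀ i j, i ≠ j → (bendInter (a i) (b i) (a j) (b j) (s i) (s j)).Subsingleton)
    (hP : ∀ i j, i < j → (bendInter (a i) (b i) (a j) (b j) (s i) (s j)).Nonempty → (i, j) ∈ P) :
    (bent Φ ha hb hab hs).crossings.Finite ∧
      (bent Φ ha hb hab hs).crossingNumber ≤ P.card := by
  rcases (bent Φ ha hb hab hs).crossings.eq_empty_or_nonempty with h0 | ⟨x₀, hx₀⟩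
  · rw [crossingNumber, h0]
    simp
  have : Nonempty (Fin p × Fin p) := ⟨(exists_of_mem_crossings_bent hx₀).choose⟩
  choose! f hlt hf using fun x hx => exists_of_mem_crossings_bent (Φ := Φ) (ha := ha) (hb := hb)
    (hab := hab) (hs := hs) (x := x) hx
  have hmaps : ∀ x ∈ (bent Φ ha hb hab hs).crossings, f x ∈ (P : Set (Fin p × Fin p)) :=
    fun x hx => hP _ _ (hlt x hx) ⟨_, hf x hx⟩
  have hinj : InjOn f (bent Φ ha hb hab hs).crossings := by
    intro x hx y hy h
    have h1 := hf x hx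
    rw [h] at h1
    exact Φ.injective (hsub _ _ (hlt y hy).ne h1 (hf y hy))
  refine ⟨Finite.of_injOn hmaps hinj P.finite_toSet, ?_⟩
  rw [← ncard_coe_finset]
  exact ncard_le_ncard_of_injOn f hmaps hinj P.finite_toSet

end

/-- The number of crossings of a system of arcs in minimal position is at most the number of
interlaced pairs of arcs. -/
theorem MinimalPosition.crossingNumber_le {A : ArcFamily} (hmin : A.MinimalPosition)
    {S : ArcSys} (Φ : Plane ≃ₗᵢ[ℝ] ℂ) (hp : S.p = A.p)
    (h0 : ∀ i, S.σ i 0 = Φ (A.arcs (Fin.cast hp i) 0))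
    (h1 : ∀ i, S.σ i 1 = Φ (A.arcs (Fin.cast hp i) 1)) (P : Finset (Fin S.p × Fin S.p))
    (hP : ∀ i j, i < j → S.Interlaced i j → (i, j) ∈ P) : A.crossingNumber ≤ P.card := by
  have ha : ∀ i, ‖S.ep (i, false)‖ = 1 := fun i => ArcSys.norm_ep _
  have hb : ∀ i, ‖S.ep (i, true)‖ = 1 := fun i => ArcSys.norm_ep _
  have hab : ∀ i j, S.ep (i, false) ≠ S.ep (j, true) :=
    fun i j h => by simpa using ArcSys.ep_injective h
  have haa : ∀ i j, i ≠ j → S.ep (i, false) ≠ S.ep (j, false) :=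
    fun i j hij h => hij (by simpa using ArcSys.ep_injective h)
  have hbb : ∀ i j, i ≠ j → S.ep (i, true) ≠ S.ep (j, true) :=
    fun i j hij h => hij (by simpa using ArcSys.ep_injective h)
  obtain ⟨s, hs, hI, hT⟩ := exists_bends ha hb hab haa hbb
  obtain ⟨hfin, hle⟩ := crossings_bent_le (Φ := Φ) (ha := ha) (hb := hb)
    (hab := fun i => hab i i) (hs := hs) P (fun i j hij => (hI i j hij).1) (by
      intro i j hij hne
      refine hP i j hij (ArcSys.interlaced_of_coef_neg ?_)
      refine lt_of_le_of_ne (not_lt.1 fun h => ?_) (coefA_mul_coefB_ne_zero (ha i) (hb i) (ha j)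
        (hb j) (haa i j hij.ne) (hab i j) (hab j i).symm (hbb i j hij.ne) (hab j j))
      exact hne.ne_empty ((hI i j hij.ne).2 h))
  refine (hmin (bent Φ ha hb (fun i => hab i i) hs)
    ⟨hfin, finite_params_bent, card_params_bent_le hT, ?_⟩ hp fun i => ⟨?_, ?_⟩).trans hle
  · intro i j t u ht hu h
    have h' := Φ.symm.injective h
    have e : ∀ (i : Fin S.p) (t : unitInterval), t = 0 ∨ t = 1 → ∃ c : Bool,
        bend (S.ep (i, false)) (S.ep (i, true)) (s i) t = S.ep (i, c) ∧
          t = if c then 1 else 0 := by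
      rintro i t (rfl | rfl)
      · exact ⟨false, bend_zero _ _ _, rfl⟩
      · exact ⟨true, bend_one _ _ _, rfl⟩
    obtain ⟨c, hc, rfl⟩ := e i t ht
    obtain ⟨c', hc', rfl⟩ := e j u hu
    have := ArcSys.ep_injective (hc.symm.trans (h'.trans hc'))
    exact ⟨congrArg Prod.fst this, by rw [show c = c' from congrArg Prod.snd this]⟩
  · refine Φ.symm_apply_eq.2 ?_
    exact (bend_zero _ _ _).trans (h0 i)
  · refine Φ.symm_apply_eq.2 ?_
    exact (bend_one _ _ _).trans (h1 i)

end ArcFamily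

namespace ArcFamily

section Prolongation

/-- The factor by which the ends of an arc are scaled to prolong it radially. -/
def stretch (t : ℝ) : ℝ := 1 + max (-t) 0 + max (t - 1) 0

/-- The projection of the parameters onto the unit interval. -/
def clamp (t : ℝ) : unitInterval := projIcc 0 1 zero_le_one t

theorem stretch_of_mem {t : ℝ} (ht : t ∈ Icc (0 : ℝ) 1) : stretch t = 1 := by
  rw [stretch, max_eq_right (by linarith [ht.1]), max_eq_right (by linarith [ht.2])]
  ring

theorem stretch_of_nonpos {t : ℝ} (ht : t ≤ 0) : stretch t = 1 - t := by
  rw [stretch, max_eq_left (by linarith), max_eq_right (by linarith)]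
  ring

theorem stretch_of_one_le {t : ℝ} (ht : 1 ≤ t) : stretch t = t := by
  rw [stretch, max_eq_right (by linarith), max_eq_left (by linarith)]
  ring

theorem clamp_of_mem {t : ℝ} (ht : t ∈ Icc (0 : ℝ) 1) : clamp t = ⟨t, ht⟩ := projIcc_of_mem _ ht

theorem clamp_of_nonpos {t : ℝ} (ht : t ≤ 0) : clamp t = 0 := projIcc_of_le_left _ ht

theorem clamp_of_one_le {t : ℝ} (ht : 1 ≤ t) : clamp t = 1 := projIcc_of_right_le _ ht

theorem mem_or_clamp (t : ℝ) :
    t ∈ Icc (0 : ℝ) 1 ∨ (1 < stretch t ∧ (clamp t = 0 ∨ clamp t = 1)) := by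
  by_cases h0 : t < 0
  · exact Or.inr ⟨by rw [stretch_of_nonpos h0.le]; linarith, Or.inl (clamp_of_nonpos h0.le)⟩
  by_cases h1 : 1 < t
  · exact Or.inr ⟨by rw [stretch_of_one_le h1.le]; linarith, Or.inr (clamp_of_one_le h1.le)⟩
  · exact Or.inl ⟨not_lt.1 h0, not_lt.1 h1⟩

theorem eq_of_stretch_eq {s t : ℝ} (h : stretch s = stretch t) (h' : clamp s = clamp t) :
    s = t := by
  rcases le_or_gt s 0 with hs | hs <;> rcases le_or_gt t 0 with ht | ht
  · rw [stretch_of_nonpos hs, stretch_of_nonpos ht] at h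
    linarith
  · rw [clamp_of_nonpos hs] at h'
    have : t ≤ 0 := by
      by_contra! h0
      have h2 := projIcc_eq_left (zero_lt_one (α := ℝ)) |>.1 h'.symm
      linarith
    linarith
  · rw [clamp_of_nonpos ht] at h'
    have h2 := projIcc_eq_left (zero_lt_one (α := ℝ)) |>.1 h'
    linarith
  · rcases le_or_gt 1 s with hs' | hs' <;> rcases le_or_gt 1 t with ht' | ht'
    · rwa [stretch_of_one_le hs', stretch_of_one_le ht'] at h
    · rw [clamp_of_one_le hs'] at h'
      have h2 := projIcc_eq_right (zero_lt_one (α := ℝ)) |>.1 h'.symm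
      linarith
    · rw [clamp_of_one_le ht'] at h'
      have h2 := projIcc_eq_right (zero_lt_one (α := ℝ)) |>.1 h'
      linarith
    · rw [clamp_of_mem ⟨hs.le, hs'.le⟩, clamp_of_mem ⟨ht.le, ht'.le⟩] at h'
      exact congrArg Subtype.val h'

end Prolongation

variable {A : ArcFamily} (Φ : Plane ≃ₗᵢ[ℝ] ℂ)

/-- The radial prolongation of an arc. -/
def line (A : ArcFamily) (i : Fin A.p) (t : ℝ) : ℂ := (stretch t : ℂ) * Φ (A.arcs i (clamp t))

variable {Φ}

theorem norm_line (i : Fin A.p) (t : ℝ) :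
    ‖A.line Φ i t‖ = stretch t * ‖A.arcs i (clamp t)‖ := by
  have : 0 ≤ stretch t := by unfold stretch; positivity
  rw [line, norm_mul, Complex.norm_real, Real.norm_eq_abs, abs_of_nonneg this,
    LinearIsometryEquiv.norm_map]

theorem norm_endpoint (i : Fin A.p) {t : unitInterval} (ht : t = 0 ∨ t = 1) :
    ‖A.arcs i t‖ = 1 := by
  rcases ht with rfl | rfl
  exacts [A.endpoint₀ i, A.endpoint₁ i]

theorem endpoint_of_norm {i : Fin A.p} {t : unitInterval} (ht : ‖A.arcs i t‖ = 1) :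
    t = 0 ∨ t = 1 := by
  by_contra! h
  exact (A.interior_lt i t h.1 h.2).ne ht

theorem line_of_mem (i : Fin A.p) {t : ℝ} (ht : t ∈ Icc (0 : ℝ) 1) :
    A.line Φ i t = Φ (A.arcs i ⟨t, ht⟩) := by
  rw [line, stretch_of_mem ht, clamp_of_mem ht, Complex.ofReal_one, one_mul]

/-- The prolonged arcs only meet at points coming from the arcs. -/
theorem of_line_eq {i j : Fin A.p} {s t : ℝ} (h : A.line Φ i s = A.line Φ j t) :
    stretch s = stretch t ∧ A.arcs i (clamp s) = A.arcs j (clamp t) := by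
  have hn := congrArg norm h
  rw [norm_line, norm_line] at hn
  have hst : stretch s = stretch t := by
    rcases mem_or_clamp s with hs | ⟨hs, hs'⟩ <;> rcases mem_or_clamp t with ht | ⟨ht, ht'⟩
    · rw [stretch_of_mem hs, stretch_of_mem ht]
    · rw [stretch_of_mem hs, norm_endpoint j ht'] at hn
      linarith [A.mem_disk i (clamp s)]
    · rw [stretch_of_mem ht, norm_endpoint i hs'] at hn
      linarith [A.mem_disk j (clamp t)]
    · rwa [norm_endpoint i hs', norm_endpoint j ht', mul_one, mul_one] at hn
  refine ⟨hst, Φ.injective ?_⟩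
  rw [line, line, hst] at h
  have h0 : (0 : ℝ) < stretch t := by unfold stretch; positivity
  exact mul_left_cancel₀ (Complex.ofReal_ne_zero.2 h0.ne') h

theorem InGeneralPosition.mem_crossings (hgen : A.InGeneralPosition) {i j : Fin A.p}
    (hij : i ≠ j) {s t : unitInterval} (h : A.arcs i s = A.arcs j t) :
    A.arcs i s ∈ A.crossings := by
  have h2 : 1 < (A.params (A.arcs i s)).ncard :=
    (one_lt_ncard_iff (hgen.2.1 _)).2 ⟨(i, s), (j, t), rfl, h.symm,
      fun h => hij (congrArg Prod.fst h)⟩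
  rw [← Nat.card_coe_set_eq] at h2
  exact h2

theorem InGeneralPosition.norm_lt_of_mem_crossings (hgen : A.InGeneralPosition) {x : Plane}
    (hx : x ∈ A.crossings) : ‖x‖ < 1 := by
  obtain ⟨i, j, s, t, hij, h1, h2⟩ := exists_of_mem_crossings hx
  refine lt_of_le_of_ne (h1 ▸ A.mem_disk i s) fun h => hij.ne ?_
  exact (hgen.2.2.2 i j s t (endpoint_of_norm (h1.symm ▸ h)) (endpoint_of_norm (h2.symm ▸ h))
    (h1.trans h2.symm)).1

/-- The system of arcs of the unit disk of the complex plane given by a family of arcs. -/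
def toArcSys (Φ : Plane ≃ₗᵢ[ℝ] ℂ) (hgen : A.InGeneralPosition) : ArcSys where
  p := A.p
  σ := A.line Φ
  X := Φ '' A.crossings
  cont i := by
    have h1 : Continuous stretch := by
      unfold stretch
      fun_prop
    have h2 : Continuous clamp := continuous_projIcc (h := zero_le_one)
    unfold line
    fun_prop
  inj i s t h := by
    obtain ⟨h1, h2⟩ := of_line_eq h
    exact eq_of_stretch_eq h1 (A.arc_inj i h2)
  norm_lt i t h0 h1 := by
    rw [line_of_mem i ⟨h0.le, h1.le⟩, LinearIsometryEquiv.norm_map]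
    exact A.interior_lt i _ (fun h => h0.ne' (congrArg Subtype.val h))
      (fun h => h1.ne (congrArg Subtype.val h))
  norm_zero i := by
    rw [line_of_mem i ⟨le_rfl, zero_le_one⟩, LinearIsometryEquiv.norm_map]
    exact A.endpoint₀ i
  norm_one i := by
    rw [line_of_mem i ⟨zero_le_one, le_rfl⟩, LinearIsometryEquiv.norm_map]
    exact A.endpoint₁ i
  ext_neg i t ht := by
    rw [line_of_mem i ⟨le_rfl, zero_le_one⟩, line, stretch_of_nonpos ht, clamp_of_nonpos ht]
    rfl
  ext_pos i t ht := by
    rw [line_of_mem i ⟨zero_le_one, le_rfl⟩, line, stretch_of_one_le ht, clamp_of_one_le ht]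
    rfl
  X_fin := hgen.1.image _
  X_lt := by
    rintro _ ⟨x, hx, rfl⟩
    rw [LinearIsometryEquiv.norm_map]
    exact hgen.norm_lt_of_mem_crossings hx
  cross i j s t hij h := by
    obtain ⟨h1, h2⟩ := of_line_eq h
    rcases mem_or_clamp s with hs | ⟨hs, hs'⟩
    · rw [clamp_of_mem hs] at h2
      rw [line_of_mem i hs]
      exact mem_image_of_mem _ (hgen.mem_crossings hij h2)
    · rcases mem_or_clamp t with ht | ⟨ht, ht'⟩
      · rw [stretch_of_mem ht] at h1
        linarith
      · exact absurd (hgen.2.2.2 i j _ _ hs' ht' h2).1 hij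
  triple i j k r s t h h' := by
    by_contra! hne
    have h1 := (of_line_eq h).2
    have h2 := (of_line_eq h').2
    have h3 := hgen.2.2.1 (A.arcs j (clamp s))
    rw [Nat.card_coe_set_eq] at h3
    refine h3.not_gt ((two_lt_ncard_iff (hgen.2.1 _)).2 ⟨(i, clamp r), (j, clamp s), (k, clamp t),
      h1, rfl, h2.symm, fun h => hne.1 (congrArg Prod.fst h),
      fun h => hne.2.2 (congrArg Prod.fst h), fun h => hne.2.1 (congrArg Prod.fst h)⟩)

variable {hgen : A.InGeneralPosition}

theorem mem_img_toArcSys {x : Plane} : Φ x ∈ (toArcSys Φ hgen).img ↔ x ∈ A.image := by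
  rw [ArcSys.mem_img, image, mem_iUnion]
  refine exists_congr fun i => ⟨?_, ?_⟩
  · rintro ⟨t, ht, h⟩
    exact ⟨⟨t, ht⟩, Φ.injective ((line_of_mem i ht).symm.trans h)⟩
  · rintro ⟨t, rfl⟩
    exact ⟨t, t.2, line_of_mem i t.2⟩

theorem isClosed_image : IsClosed A.image :=
  (isCompact_iUnion fun i => isCompact_range (A.arcs i).continuous).isClosed

/-- The faces of a family of arcs are path connected. -/
theorem joinedIn_of_mem_face {x y : Plane}
    (hx : x ∈ Metric.closedBall (0 : Plane) 1 \ A.image)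
    (hy : y ∈ connectedComponentIn (Metric.closedBall (0 : Plane) 1 \ A.image) x) :
    JoinedIn (Metric.closedBall (0 : Plane) 1 \ A.image) x y := by
  set D := Metric.closedBall (0 : Plane) 1 \ A.image with hD
  have hsub : connectedComponentIn D x ⊆ D := connectedComponentIn_subset _ _
  refine isPreconnected_connectedComponentIn.induction₂ (fun x y => JoinedIn D x y) ?_
    (fun _ _ _ _ _ _ h h' => h.trans h') (fun _ _ _ _ h => h.symm)
    (mem_connectedComponentIn hx) hy
  intro z hz
  obtain ⟨ε, hε, hball⟩ := Metric.isOpen_iff.1 isClosed_image.isOpen_compl z (hsub hz).2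
  filter_upwards [mem_nhdsWithin_of_mem_nhds (Metric.ball_mem_nhds z hε), self_mem_nhdsWithin]
    with w hw hw'
  have hconv : Convex ℝ (Metric.closedBall (0 : Plane) 1 ∩ Metric.ball z ε) :=
    (convex_closedBall _ _).inter (convex_ball _ _)
  refine (hconv.isPathConnected ⟨z, (hsub hz).1, Metric.mem_ball_self hε⟩).joinedIn z
    ⟨(hsub hz).1, Metric.mem_ball_self hε⟩ w ⟨(hsub hw').1, hw⟩ |>.mono ?_
  exact fun v hv => ⟨hv.1, hball hv.2⟩

/-- The set of which the distance from a face to the boundary is the infimum. -/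
def faceDistSet (A : ArcFamily) (F : Set Plane) : Set ℕ :=
  {m : ℕ | ∃ γ : C(unitInterval, Plane), (∀ t, ‖γ t‖ ≤ 1) ∧
    γ 0 ∈ F ∧ ‖γ 1‖ = 1 ∧
    {t : unitInterval | γ t ∈ A.image}.Finite ∧
    m = Nat.card {t : unitInterval | γ t ∈ A.image}}

theorem exists_mem_faceDistSet {g n : ℕ} {x : Plane} (hx : x ∉ A.image) {F : Set Plane}
    (hF : x ∈ F) (h : (toArcSys Φ hgen).Reach g n (Φ x)) : ∃ m ≤ n, m ∈ A.faceDistSet F := by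
  obtain ⟨s, γ, hs, hγ, hn⟩ := h.exists_path (fun h => hx (mem_img_toArcSys.1 h))
  have hset : {t : unitInterval | Φ.symm (γ t) ∈ A.image} =
      {t | γ t ∈ (toArcSys Φ hgen).img} := by
    ext t
    rw [mem_ofPred_eq, mem_ofPred_eq, ← mem_img_toArcSys (Φ := Φ) (hgen := hgen),
      LinearIsometryEquiv.apply_symm_apply]
  have hfin : {t : unitInterval | Φ.symm (γ t) ∈ A.image}.Finite := by
    rw [hset]
    exact finite_of_encard_le_coe hn
  refine ⟨_, ?_, ⟨fun t => Φ.symm (γ t), by fun_prop⟩, fun t => ?_, ?_, ?_, hfin, rfl⟩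
  · change Nat.card {t : unitInterval | Φ.symm (γ t) ∈ A.image} ≤ n
    rw [Nat.card_coe_set_eq, ← Nat.cast_le (α := ℕ∞), hfin.cast_ncard_eq, hset]
    exact hn
  · simpa using hγ t
  · simpa using hF
  · simpa using hs

theorem faceDist_le_maxFaceDist (Φ : Plane ≃ₗᵢ[ℝ] ℂ) (hgen : A.InGeneralPosition) {F : Set Plane}
    (hF : A.IsFaceOf F) : A.faceDist F ≤ A.maxFaceDist := by
  obtain ⟨N, hN⟩ := (toArcSys Φ hgen).exists_reach_bound
  refine le_csSup ⟨N, ?_⟩ ⟨F, hF, rfl⟩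
  rintro _ ⟨F, ⟨x, hx, rfl⟩, rfl⟩
  obtain ⟨g, n, hn, h⟩ := hN (Φ x) (by simpa using hx.1)
  obtain ⟨m, hm, hm'⟩ := exists_mem_faceDistSet hx.2 (mem_connectedComponentIn hx) h
  exact (Nat.sInf_le hm').trans (hm.trans hn)

theorem depth_le_maxFaceDist {z : ℂ} (hz : z ∈ (toArcSys Φ hgen).free) :
    (toArcSys Φ hgen).depth z ≤ A.maxFaceDist := by
  obtain ⟨x, rfl⟩ := Φ.surjective z
  have hxi : x ∉ A.image := fun h => hz.2 (mem_img_toArcSys.2 h)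
  have hx1 : ‖x‖ < 1 := by simpa using hz.1
  have hx : x ∈ Metric.closedBall (0 : Plane) 1 \ A.image := ⟨by simpa using hx1.le, hxi⟩
  set F := connectedComponentIn (Metric.closedBall (0 : Plane) 1 \ A.image) x with hF
  refine le_trans ?_ (faceDist_le_maxFaceDist Φ hgen ⟨x, hx, hF⟩)
  obtain ⟨g, n, h⟩ := ArcSys.exists_reach (S := toArcSys Φ hgen) hz.1.le
  obtain ⟨m, -, hm⟩ := exists_mem_faceDistSet hxi (mem_connectedComponentIn hx) h
  obtain ⟨γ, hγ, h0, h1, hfin, hcard⟩ : A.faceDist F ∈ A.faceDistSet F := Nat.sInf_mem ⟨m, hm⟩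
  obtain ⟨δ, hδ⟩ := joinedIn_of_mem_face hx h0
  let γ' : Path (Φ (γ 0)) (Φ (γ 1)) := ⟨⟨fun t => Φ (γ t), by fun_prop⟩, rfl, rfl⟩
  let δ' : Path (Φ x) (Φ (γ 0)) := δ.map Φ.continuous
  have hγ' : ∀ t, γ' t = Φ (γ t) := fun t => rfl
  have hδ' : ∀ t, δ' t = Φ (δ t) := fun t => rfl
  have hbound := ArcSys.encard_trans_le (toArcSys Φ hgen).img δ' γ'
  simp only [hγ', hδ', mem_img_toArcSys, (hδ _).2, and_false, ofPred_false, encard_empty, zero_add]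
    at hbound
  rw [← hfin.cast_ncard_eq, ← Nat.card_coe_set_eq, ← hcard] at hbound
  have hnorm : ∀ t, ‖δ'.trans γ' t‖ ≤ 1 := by
    intro t
    have ht : δ'.trans γ' t ∈ range (δ'.trans γ') := mem_range_self t
    rw [Path.trans_range] at ht
    rcases ht with ⟨u, hu⟩ | ⟨u, hu⟩
    · rw [← hu, hδ', LinearIsometryEquiv.norm_map]
      simpa using (hδ u).1
    · rw [← hu, hγ', LinearIsometryEquiv.norm_map]
      exact hγ u
  have hset : {t | t ∈ Icc (0 : ℝ) 1 ∧ (δ'.trans γ').extend t ∈ (toArcSys Φ hgen).img} =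
      Subtype.val '' {t | δ'.trans γ' t ∈ (toArcSys Φ hgen).img} := by
    ext t
    constructor
    · rintro ⟨ht, h⟩
      rw [Path.extend_apply _ ht] at h
      exact ⟨⟨t, ht⟩, h, rfl⟩
    · rintro ⟨u, hu, rfl⟩
      exact ⟨u.2, by rwa [Path.extend_apply _ u.2]⟩
  have hcard' : {t | t ∈ Icc (0 : ℝ) 1 ∧
      (δ'.trans γ').extend t ∈ (toArcSys Φ hgen).img}.encard ≤ A.faceDist F := by
    rw [hset]
    exact (encard_image_le _ _).trans hbound
  have hfin' := finite_of_encard_le_coe hcard'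
  have hext : (δ'.trans γ').extend 0 = Φ x := Path.extend_zero _
  obtain ⟨g', n', hn', hr⟩ := ArcSys.exists_reach_of_path (S := toArcSys Φ hgen)
    (δ'.trans γ').continuous_extend
    (fun t ht => by rw [Path.extend_apply _ ht]; exact hnorm _)
    (by rw [Path.extend_one, LinearIsometryEquiv.norm_map, h1]) hfin' (A.faceDist F) 0
    ⟨le_rfl, zero_le_one⟩ (by rw [hext]; exact hz) (by
      have hsub : {u | u ∈ Icc (0 : ℝ) 1 ∧ (δ'.trans γ').extend u ∈ (toArcSys Φ hgen).img ∧ 0 ≤ u} ⊆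
          {t | t ∈ Icc (0 : ℝ) 1 ∧ (δ'.trans γ').extend t ∈ (toArcSys Φ hgen).img} :=
        fun u hu => ⟨hu.1, hu.2.1⟩
      rw [← Nat.cast_le (α := ℕ∞), (hfin'.subset hsub).cast_ncard_eq]
      exact (encard_le_encard hsub).trans hcard')
  rw [hext] at hr
  exact hr.depth_le.trans hn'

/-- Finitely many points of the circle can be rotated off a given point. -/
theorem exists_isometry_ne {T : Set Plane} (hT : T.Finite) :
    ∃ Φ : Plane ≃ₗᵢ[ℝ] ℂ, ∀ x ∈ T, Φ x ≠ -1 := by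
  let Φ₀ : Plane ≃ₗᵢ[ℝ] ℂ := Complex.orthonormalBasisOneI.repr.symm
  have hinf : (univ : Set Circle).Infinite := by
    have : Infinite (Ioc (-Real.pi) Real.pi) :=
      (Ioc_infinite (by linarith [Real.pi_pos])).to_subtype
    have : Infinite Circle := Infinite.of_injective _ Circle.argEquiv.symm.injective
    exact infinite_univ
  have hfin : (⋃ x ∈ T, {c : Circle | (c : ℂ) * Φ₀ x = -1}).Finite := by
    refine hT.biUnion fun x _ => Set.Subsingleton.finite ?_
    intro c hc c' hc'
    have h0 : Φ₀ x ≠ 0 := by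
      intro h
      have : (c : ℂ) * Φ₀ x = -1 := hc
      rw [h, mul_zero] at this
      norm_num at this
    exact Circle.coe_injective (mul_right_cancel₀ h0 (Eq.trans hc (Eq.symm hc')))
  obtain ⟨c, -, hc⟩ := (hinf.sdiff hfin).nonempty
  refine ⟨Φ₀.trans (rotation c), fun x hx h => hc (mem_iUnion₂.2 ⟨x, hx, ?_⟩)⟩
  simpa [rotation_apply] using h

end ArcFamily

/-- For a system `A` of `p` arcs in minimal position in a closed disk,
with `n` intersection points between the arcs and `d` the largest distance from a face
of `A` to the boundary of the disk, we have `n ≤ (6d + 7)·p`. -/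
theorem arcFamily_crossingNumber_le (A : ArcFamily)
    (hgen : A.InGeneralPosition) (hmin : A.MinimalPosition) :
    A.crossingNumber ≤ (6 * A.maxFaceDist + 7) * A.p := by
  classical
  obtain ⟨Φ, hΦ⟩ := ArcFamily.exists_isometry_ne
    (finite_range fun q : Fin A.p × Bool => A.arcs q.1 (if q.2 then 1 else 0))
  have h0 : ∀ i, A.line Φ i 0 = Φ (A.arcs i 0) :=
    fun i => ArcFamily.line_of_mem i ⟨le_rfl, zero_le_one⟩
  have h1 : ∀ i, A.line Φ i 1 = Φ (A.arcs i 1) :=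
    fun i => ArcFamily.line_of_mem i ⟨zero_le_one, le_rfl⟩
  set S : ArcSys := ArcFamily.toArcSys Φ hgen with hS
  have hcut : ∀ e, S.ep e ≠ -1 := by
    rintro ⟨i, c⟩ h
    refine hΦ _ ⟨(i, c), rfl⟩ (Eq.trans ?_ h)
    cases c
    · exact (h0 i).symm
    · exact (h1 i).symm
  have hcard := ArcSys.card_interlaced_pairs_le hcut
    (fun x hx => ArcFamily.depth_le_maxFaceDist hx) (fun i j h => h.symm) Finset.univ
  rw [Finset.card_univ, Fintype.card_fin] at hcard
  refine (hmin.crossingNumber_le (S := S) Φ rfl h0 h1 _ fun i j hij hI => ?_).trans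
    (hcard.trans (Nat.mul_le_mul_right _ (by omega)))
  exact Finset.mem_filter.2 ⟨by simp, hij, hI⟩

end
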